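/- arXiv:1212.1905 — 4 statements merged into one kernel-verified Lean document; each statement's English description precedes it below -/
import Mathlib

section
/- Fix an integer k ≥ 3. Let f(x) = e^x − 1 − x, ψ(x) = x(e^x − 1)/(e^x − 1 − x) for x ≠ 0 with ψ(0) = 2, let λ(k) be the unique positive root of ψ(x) = k, let g_k(x) = x / (k(1 − e^{−x})^{k−1}), and set c*_k = g_k(λ(k)). Let (m_j) and (n_j) be sequences of positive integers tending to infinity with m_j/n_j → c. If c < c*_k then the probability that a uniformly random unconstrained k-XORSAT instance with m_j equations and n_j variables is satisfiable tends to 1; if c > c*_k it tends to 0. -/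
open scoped Classical

/-- The set of `m × n` matrices over `F₂` in which every row has exactly `k`
entries equal to `1` (no condition on column sums). -/
noncomputable def unconstrainedSet (k m n : ℕ) : Finset (Matrix (Fin m) (Fin n) (ZMod 2)) :=
  Finset.univ.filter (fun A =>
    ∀ i : Fin m, (Finset.univ.filter (fun j : Fin n => A i j = 1)).card = k)

/-- The probability that a uniformly random unconstrained `k`-XORSAT instance with
`m` equations and `n` variables is satisfiable. -/
noncomputable def satProbU (k m n : ℕ) : ℝ :=
  (((unconstrainedSet k m n ×ˢ (Finset.univ : Finset (Fin m → ZMod 2))).filter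
      (fun p => ∃ x : Fin n → ZMod 2, p.1.mulVec x = p.2)).card : ℝ) /
    (((unconstrainedSet k m n).card : ℝ) * 2 ^ m)

/-- `ψ(x) = x (e^x - 1) / (e^x - 1 - x)` for `x ≠ 0`, extended by `ψ(0) = 2`. -/
noncomputable def psi (x : ℝ) : ℝ :=
  if x = 0 then 2 else x * (Real.exp x - 1) / (Real.exp x - 1 - x)

/-- `g_k(x) = x / (k (1 - e^{-x})^{k-1})`. -/
noncomputable def gfun (k : ℕ) (x : ℝ) : ℝ :=
  x / (k * (1 - Real.exp (-x)) ^ (k - 1))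

namespace KX

abbrev V (n : ℕ) := Fin n → ZMod 2
abbrev Sub (n : ℕ) := Submodule (ZMod 2) (V n)

noncomputable def adj {n : ℕ} (W : Sub n) (v : V n) : Sub n :=
  W ⊔ Submodule.span (ZMod 2) {v}

lemma adj_comm {n : ℕ} (W : Sub n) (u v : V n) : adj (adj W u) v = adj (adj W v) u := by
  unfold adj; exact sup_right_comm _ _ _

lemma le_adj {n : ℕ} (W : Sub n) (v : V n) : W ≤ adj W v := le_sup_left

lemma mem_adj {n : ℕ} (W : Sub n) (v : V n) : v ∈ adj W v :=
  (le_sup_right : _ ≤ adj W v) (Submodule.mem_span_singleton_self v)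

lemma adj_of_mem {n : ℕ} {W : Sub n} {v : V n} (h : v ∈ W) : adj W v = W := by
  unfold adj
  exact sup_eq_left.2 ((Submodule.span_singleton_le_iff_mem _ _).2 h)

noncomputable def op {n : ℕ} (μ : V n → ℝ) : Module.End ℝ (Sub n → ℝ) where
  toFun f W := ∑ v, μ v * f (adj W v)
  map_add' f g := by
    ext W; simp [mul_add, Finset.sum_add_distrib]
  map_smul' c f := by
    ext W; simp only [Pi.smul_apply, smul_eq_mul, RingHom.id_apply, Finset.mul_sum]
    exact Finset.sum_congr rfl (fun v _ => by ring)

lemma op_apply {n : ℕ} (μ : V n → ℝ) (f : Sub n → ℝ) (W : Sub n) :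
    op μ f W = ∑ v, μ v * f (adj W v) := rfl

lemma op_comm {n : ℕ} (μ ν : V n → ℝ) : Commute (op μ) (op ν) := by
  show op μ * op ν = op ν * op μ
  apply LinearMap.ext; intro f; ext W
  simp only [Module.End.mul_apply, op_apply, Finset.mul_sum]
  rw [Finset.sum_comm]
  refine Finset.sum_congr rfl fun v _ => Finset.sum_congr rfl fun u _ => ?_
  rw [adj_comm]; ring

structure IsProb {n : ℕ} (μ : V n → ℝ) : Prop where
  nonneg : ∀ v, 0 ≤ μ v
  sum_one : ∑ v, μ v = 1

def Up {n : ℕ} (f : Sub n → ℝ) : Prop := ∀ W v, f W ≤ f (adj W v)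
def Lip {n : ℕ} (f : Sub n → ℝ) : Prop := ∀ W v, f W ≤ f (adj W v) ∧ f (adj W v) ≤ f W + 1

structure Av {n : ℕ} (N : ℕ) (A : Module.End ℝ (Sub n → ℝ)) : Prop where
  mono : ∀ f g : Sub n → ℝ, (∀ W, f W ≤ g W) → ∀ W, A f W ≤ A g W
  const : ∀ c : ℝ, A (fun _ => c) = fun _ => c
  lip : ∀ f, Lip f → Lip (A f)
  up : ∀ f, Up f → Up (A f)
  var : ∀ f, Lip f → ∀ W, A (fun W => f W ^ 2) W ≤ (A f W) ^ 2 + N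

lemma Av.one {n : ℕ} : Av 0 (1 : Module.End ℝ (Sub n → ℝ)) where
  mono f g h := h
  const c := rfl
  lip f h := h
  up f h := h
  var f h W := by simp

lemma Av.mul {n N M : ℕ} {A B : Module.End ℝ (Sub n → ℝ)} (hA : Av N A) (hB : Av M B) :
    Av (N + M) (A * B) where
  mono f g h W := hA.mono _ _ (hB.mono _ _ h) W
  const c := by rw [Module.End.mul_apply, hB.const, hA.const]
  lip f h := hA.lip _ (hB.lip _ h)
  up f h := hA.up _ (hB.up _ h)
  var f h W := by
    simp only [Module.End.mul_apply]
    have h1 := hA.mono _ _ (fun W => hB.var f h W) W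
    have h2 : (fun W => (B f W) ^ 2 + (M : ℝ)) = (fun W => (B f W) ^ 2) + (fun _ => (M : ℝ)) := rfl
    rw [h2, map_add, hA.const] at h1
    have h3 := hA.var (B f) (hB.lip f h) W
    simp only [Pi.add_apply] at h1
    push_cast; linarith

lemma Av.pow {n : ℕ} {A : Module.End ℝ (Sub n → ℝ)} (hA : Av 1 A) (m : ℕ) : Av m (A ^ m) := by
  induction m with
  | zero => simpa using Av.one
  | succ m ih => rw [pow_succ]; exact ih.mul hA

lemma Av.op {n : ℕ} {μ : V n → ℝ} (hμ : IsProb μ) : Av 1 (op μ) where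
  mono f g h W := Finset.sum_le_sum fun v _ => mul_le_mul_of_nonneg_left (h _) (hμ.nonneg v)
  const c := by
    ext W; rw [op_apply, ← Finset.sum_mul, hμ.sum_one, one_mul]
  lip f h W v := by
    have e : f = f := rfl
    constructor
    · refine Finset.sum_le_sum fun u _ => mul_le_mul_of_nonneg_left ?_ (hμ.nonneg u)
      rw [adj_comm]; exact (h _ _).1
    · have : ∑ u, μ u * f (adj (adj W v) u) ≤ ∑ u, (μ u * f (adj W u) + μ u) := by
        refine Finset.sum_le_sum fun u _ => ?_
        rw [adj_comm]
        have := mul_le_mul_of_nonneg_left (h (adj W u) v).2 (hμ.nonneg u)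
        linarith
      rw [Finset.sum_add_distrib, hμ.sum_one] at this
      exact this
  up f h W v := by
    refine Finset.sum_le_sum fun u _ => mul_le_mul_of_nonneg_left ?_ (hμ.nonneg u)
    rw [adj_comm]; exact h _ _
  var f h W := by
    simp only [op_apply]
    have key : ∑ v, μ v * f (adj W v) ^ 2 ≤ ∑ v, (2 * f W * (μ v * f (adj W v)) - f W ^ 2 * μ v + μ v) := by
      refine Finset.sum_le_sum fun v _ => ?_
      have h1 := h W v
      have h2 := hμ.nonneg v
      have h3 : (f (adj W v) - f W) ^ 2 ≤ 1 := by nlinarith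
      nlinarith
    rw [Finset.sum_add_distrib, Finset.sum_sub_distrib, ← Finset.mul_sum, ← Finset.mul_sum,
      hμ.sum_one] at key
    push_cast
    nlinarith [sq_nonneg (∑ v, μ v * f (adj W v) - f W)]

noncomputable def avg {ι : Type*} [Fintype ι] (g : ι → ℝ) : ℝ := (∑ i, g i) / Fintype.card ι

noncomputable def unif {n : ℕ} {ι : Type*} [Fintype ι] (vec : ι → V n) : V n → ℝ :=
  fun v => avg (fun i => if vec i = v then 1 else 0)

lemma op_unif {n : ℕ} {ι : Type*} [Fintype ι] (vec : ι → V n) (f : Sub n → ℝ) (W : Sub n) :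
    op (unif vec) f W = avg (fun i => f (adj W (vec i))) := by
  simp only [op_apply, unif, avg, div_mul_eq_mul_div, Finset.sum_mul, ← Finset.sum_div]
  rw [Finset.sum_comm]
  simp

lemma avg_const {ι : Type*} [Fintype ι] [Nonempty ι] (c : ℝ) : avg (fun _ : ι => c) = c := by
  simp [avg]

lemma avg_mono {ι : Type*} [Fintype ι] {f g : ι → ℝ} (h : ∀ i, f i ≤ g i) : avg f ≤ avg g := by
  unfold avg; gcongr; exact h _

lemma avg_add {ι : Type*} [Fintype ι] (f g : ι → ℝ) :
    avg (fun i => f i + g i) = avg f + avg g := by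
  simp [avg, Finset.sum_add_distrib, add_div]

lemma avg_sub {ι : Type*} [Fintype ι] (f g : ι → ℝ) :
    avg (fun i => f i - g i) = avg f - avg g := by
  simp [avg, Finset.sum_sub_distrib, sub_div]

lemma avg_mul_left {ι : Type*} [Fintype ι] (c : ℝ) (f : ι → ℝ) :
    avg (fun i => c * f i) = c * avg f := by
  simp [avg, ← Finset.mul_sum, mul_div_assoc]

lemma avg_sum {ι κ : Type*} [Fintype ι] (s : Finset κ) (f : κ → ι → ℝ) :
    avg (fun i => ∑ j ∈ s, f j i) = ∑ j ∈ s, avg (f j) := by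
  simp only [avg]; rw [Finset.sum_comm, Finset.sum_div]

lemma avg_equiv {ι κ : Type*} [Fintype ι] [Fintype κ] (e : ι ≃ κ) (f : κ → ℝ) :
    avg (fun i => f (e i)) = avg f := by
  simp only [avg]; rw [Fintype.card_congr e, Equiv.sum_comp e f]

lemma avg_prod {ι κ : Type*} [Fintype ι] [Fintype κ] (f : ι × κ → ℝ) :
    avg f = avg (fun i => avg (fun j => f (i, j))) := by
  simp only [avg, Fintype.sum_prod_type, Fintype.card_prod, ← Finset.sum_div]
  push_cast
  rw [div_div, mul_comm]

lemma avg_insertNth {ι : Type*} [Fintype ι] {m : ℕ} (p : Fin (m+1)) (f : (Fin (m+1) → ι) → ℝ) :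
    avg f = avg (fun i : ι => avg (fun t : Fin m → ι => f (p.insertNth i t))) := by
  rw [← avg_equiv (Fin.insertNthEquiv (fun _ => ι) p) f, avg_prod]
  rfl

lemma unif_prob {n : ℕ} {ι : Type*} [Fintype ι] [Nonempty ι] (vec : ι → V n) :
    IsProb (unif vec) where
  nonneg v := by
    unfold unif avg
    exact div_nonneg (Finset.sum_nonneg fun i _ => by split_ifs <;> norm_num) (by positivity)
  sum_one := by
    have := op_unif vec (fun _ => 1) ⊥
    simpa [op_apply, avg_const] using this

noncomputable def mix {n : ℕ} (p : ℝ) (μ : V n → ℝ) : V n → ℝ :=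
  fun v => p * μ v + (1 - p) * (if v = 0 then 1 else 0)

lemma mix_prob {n : ℕ} {p : ℝ} {μ : V n → ℝ} (h0 : 0 ≤ p) (h1 : p ≤ 1) (hμ : IsProb μ) :
    IsProb (mix p μ) where
  nonneg v := by
    unfold mix
    have := hμ.nonneg v
    have : 0 ≤ p * μ v := by positivity
    split_ifs <;> simp <;> linarith
  sum_one := by
    simp [mix, Finset.sum_add_distrib, ← Finset.mul_sum, hμ.sum_one]

lemma op_mix {n : ℕ} (p : ℝ) (μ : V n → ℝ) : op (mix p μ) = p • op μ + (1 - p) • 1 := by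
  apply LinearMap.ext; intro f; ext W
  have : adj W 0 = W := adj_of_mem (Submodule.zero_mem _)
  simp only [op_apply, mix, add_mul, Finset.sum_add_distrib, LinearMap.add_apply, Pi.add_apply,
    LinearMap.smul_apply, Pi.smul_apply, smul_eq_mul, Module.End.one_apply, Finset.mul_sum]
  congr 1
  · exact Finset.sum_congr rfl fun v _ => by ring
  · simp [this]

lemma op_unif_pow {n : ℕ} {ι : Type*} [Fintype ι] (vec : ι → V n) (m : ℕ) (f : Sub n → ℝ)
    (W : Sub n) :
    (op (unif vec) ^ m) f W =
      avg (fun t : Fin m → ι => f (W ⊔ Submodule.span (ZMod 2) (Set.range (fun i => vec (t i))))) := by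
  induction m generalizing W with
  | zero =>
    simp [avg]
  | succ m ih =>
    rw [pow_succ', Module.End.mul_apply, op_unif, avg_insertNth 0]
    congr 1; ext i
    rw [ih]
    congr 1; ext t
    congr 1
    unfold adj
    rw [sup_assoc, ← Submodule.span_union]
    congr 2
    ext x
    simp only [Set.singleton_union, Set.mem_insert_iff, Set.mem_range]
    rw [Fin.exists_fin_succ]
    simp [eq_comm]

noncomputable def rk {n : ℕ} (W : Sub n) : ℝ := (Module.finrank (ZMod 2) W : ℝ)

noncomputable def ind (p : Prop) : ℝ := if p then 1 else 0

lemma ind_nonneg (p : Prop) : 0 ≤ ind p := by unfold ind; split_ifs <;> norm_num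
lemma ind_le_one (p : Prop) : ind p ≤ 1 := by unfold ind; split_ifs <;> norm_num
lemma ind_mono {p q : Prop} (h : p → q) : ind p ≤ ind q := by
  unfold ind; split_ifs with h1 h2 h2 <;> first | exact absurd (h h1) h2 | norm_num

lemma rk_adj {n : ℕ} (W : Sub n) (v : V n) : rk (adj W v) = rk W + 1 - ind (v ∈ W) := by
  unfold ind
  split_ifs with h
  · rw [adj_of_mem h]; ring
  · have h1 := Submodule.finrank_sup_add_finrank_inf_eq W (Submodule.span (ZMod 2) {v})
    have hv : v ≠ 0 := fun h0 => h (h0 ▸ W.zero_mem)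
    have h2 : W ⊓ Submodule.span (ZMod 2) {v} = ⊥ := by
      rw [← disjoint_iff, Submodule.disjoint_span_singleton' hv]; exact h
    rw [h2, finrank_bot, finrank_span_singleton hv] at h1
    unfold rk adj
    rw [← Nat.cast_one, ← Nat.cast_add, ← h1]; simp

lemma rk_lip {n : ℕ} : Lip (rk (n := n)) := by
  intro W v
  rw [rk_adj]
  have := ind_nonneg (v ∈ W); have := ind_le_one (v ∈ W)
  constructor <;> linarith

noncomputable def fr {n : ℕ} {ι : Type*} [Fintype ι] (vec : ι → V n) (W : Sub n) : ℝ :=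
  avg (fun i => ind (vec i ∈ W))

lemma fr_nonneg {n : ℕ} {ι : Type*} [Fintype ι] (vec : ι → V n) (W : Sub n) : 0 ≤ fr vec W := by
  unfold fr avg
  exact div_nonneg (Finset.sum_nonneg fun i _ => ind_nonneg _) (by positivity)

lemma fr_le_one {n : ℕ} {ι : Type*} [Fintype ι] [Nonempty ι] (vec : ι → V n) (W : Sub n) :
    fr vec W ≤ 1 := by
  have := avg_mono (fun i => ind_le_one (vec i ∈ W))
  rwa [avg_const] at this

lemma fr_up {n : ℕ} {ι : Type*} [Fintype ι] (vec : ι → V n) : Up (fr vec) := by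
  intro W v
  exact avg_mono fun i => ind_mono fun h => le_adj W v h

lemma op_unif_rk {n : ℕ} {ι : Type*} [Fintype ι] [Nonempty ι] (vec : ι → V n) (W : Sub n) :
    op (unif vec) rk W = rk W + 1 - fr vec W := by
  rw [op_unif]
  simp only [rk_adj]
  rw [avg_sub, avg_const]; rfl

end KX

namespace KX

lemma avg_comm {ι κ : Type*} [Fintype ι] [Fintype κ] (f : ι → κ → ℝ) :
    avg (fun i => avg (fun j => f i j)) = avg (fun j => avg (fun i => f i j)) := by
  simp only [avg, ← Finset.sum_div]
  rw [Finset.sum_comm, div_right_comm]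

lemma avg_pow {ι : Type*} [Fintype ι] (g : ι → ℝ) (k : ℕ) :
    (avg g) ^ k = avg (fun t : Fin k → ι => ∏ j, g (t j)) := by
  simp only [avg, div_pow, Fintype.sum_pow]
  simp

noncomputable def e {n : ℕ} (i : Fin n) : V n := Pi.single i 1

noncomputable def rowv {n : ℕ} (k : ℕ) (t : Fin k → Fin n) : V n := ∑ j, e (t j)

noncomputable abbrev P (n : ℕ) : Module.End ℝ (Sub n → ℝ) := op (unif (e (n := n)))
noncomputable abbrev R (n k : ℕ) : Module.End ℝ (Sub n → ℝ) := op (unif (rowv (n := n) k))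
noncomputable abbrev S (n k : ℕ) : Module.End ℝ (Sub n → ℝ) :=
  op (mix (1 / (k : ℝ)) (unif (rowv (n := n) k)))
noncomputable abbrev X {n : ℕ} (W : Sub n) : ℝ := fr (e (n := n)) W
noncomputable abbrev Y {n : ℕ} (k : ℕ) (W : Sub n) : ℝ := fr (rowv (n := n) k) W

lemma X_pow_le {n : ℕ} (k : ℕ) (W : Sub n) : X W ^ k ≤ Y k W := by
  unfold X Y fr
  rw [avg_pow]
  refine avg_mono fun t => ?_
  by_cases h : ∀ j, e (t j) ∈ W
  · have : rowv k t ∈ W := Submodule.sum_mem _ fun j _ => h j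
    simp [ind, h, this]
  · push Not at h
    obtain ⟨j, hj⟩ := h
    rw [Finset.prod_eq_zero (Finset.mem_univ j) (by simp [ind, hj])]
    exact ind_nonneg _

lemma Y_le_aux {n j : ℕ} (W : Sub n) (p : Fin (j+1)) :
    avg (fun t : Fin (j+1) → Fin n => ind (rowv (j+1) t ∈ W ∧ e (t p) ∉ W)) ≤
      (P n ^ j) X W - X W := by
  rw [op_unif_pow, avg_insertNth p]
  have h1 : avg (fun t : Fin j → Fin n => X (W ⊔ Submodule.span (ZMod 2) (Set.range fun i => e (t i))))
     = avg (fun i : Fin n => avg (fun t : Fin j → Fin n =>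
        ind (e i ∈ W ⊔ Submodule.span (ZMod 2) (Set.range fun l => e (t l))))) := by
    unfold X fr; rw [avg_comm]
  rw [h1]
  unfold X fr
  rw [← avg_sub]
  refine avg_mono fun i => ?_
  rcases isEmpty_or_nonempty (Fin j → Fin n) with hE | hE
  · exfalso
    exact hE.false (fun _ => i)
  rw [← avg_const (ι := Fin j → Fin n) (ind (e i ∈ W)), ← avg_sub]
  refine avg_mono fun t => ?_
  have hmono : ind (e i ∈ W) ≤ ind (e i ∈ W ⊔ Submodule.span (ZMod 2) (Set.range fun l => e (t l))) :=
    ind_mono fun h => (le_sup_left : W ≤ _) h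
  by_cases hc : rowv (j+1) (p.insertNth (α := fun _ => Fin n) i t) ∈ W ∧ e i ∉ W
  · have hr : rowv (j+1) (p.insertNth (α := fun _ => Fin n) i t) = e i + ∑ l, e (t l) := by
      unfold rowv; rw [Fin.sum_univ_succAbove _ p]; simp
    have hs : ∑ l, e (t l) ∈ W ⊔ Submodule.span (ZMod 2) (Set.range fun l => e (t l)) :=
      Submodule.sum_mem _ fun l _ => (le_sup_right : _ ≤ W ⊔ _) (Submodule.subset_span ⟨l, rfl⟩)
    have hi : e i ∈ W ⊔ Submodule.span (ZMod 2) (Set.range fun l => e (t l)) := by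
      have := Submodule.sub_mem _ ((le_sup_left : W ≤ _) hc.1) hs
      rw [hr] at this; simpa using this
    simp [ind, hc, hi]
  · have : ind (rowv (j+1) (p.insertNth (α := fun _ => Fin n) i t) ∈ W ∧
      e ((p.insertNth (α := fun _ => Fin n) i t) p) ∉ W) = 0 := by
      simp only [Fin.insertNth_apply_same]
      simp [ind, hc]
    rw [this]; linarith

lemma Y_le {n : ℕ} (j : ℕ) (W : Sub n) :
    Y (j+1) W ≤ X W ^ (j+1) + (j+1 : ℝ) * ((P n ^ j) X W - X W) := by
  have hs : ∑ p : Fin (j+1), avg (fun t : Fin (j+1) → Fin n => ind (rowv (j+1) t ∈ W ∧ e (t p) ∉ W)) ≤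
      ∑ p : Fin (j+1), ((P n ^ j) X W - X W) := Finset.sum_le_sum fun p _ => Y_le_aux W p
  simp only [Finset.sum_const, Finset.card_univ, Fintype.card_fin, nsmul_eq_mul] at hs
  push_cast at hs
  refine le_trans ?_ (add_le_add_right hs _)
  rw [← avg_sum]
  unfold X Y fr
  rw [avg_pow, ← avg_add]
  refine avg_mono fun t => ?_
  by_cases h : ∀ j, e (t j) ∈ W
  · have h2 : ∏ l : Fin (j+1), ind (e (t l) ∈ W) = 1 := by simp [ind, h]
    rw [h2]
    have := ind_le_one (rowv (j+1) t ∈ W)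
    have : 0 ≤ ∑ p : Fin (j+1), ind (rowv (j+1) t ∈ W ∧ e (t p) ∉ W) :=
      Finset.sum_nonneg fun _ _ => ind_nonneg _
    linarith
  · push Not at h
    obtain ⟨l, hl⟩ := h
    have h3 : ind (rowv (j+1) t ∈ W ∧ e (t l) ∉ W) ≤
      ∑ p : Fin (j+1), ind (rowv (j+1) t ∈ W ∧ e (t p) ∉ W) :=
      Finset.single_le_sum (f := fun p => ind (rowv (j+1) t ∈ W ∧ e (t p) ∉ W))
        (fun _ _ => ind_nonneg _) (Finset.mem_univ l)
    have h4 : 0 ≤ ∏ l : Fin (j+1), ind (e (t l) ∈ W) := Finset.prod_nonneg fun _ _ => ind_nonneg _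
    have h5 : ind (rowv (j+1) t ∈ W) ≤ ind (rowv (j+1) t ∈ W ∧ e (t l) ∉ W) :=
      ind_mono fun h => ⟨h, hl⟩
    linarith

/-- number of non-frozen coordinates is at least the nullity -/
lemma nullity_le {n : ℕ} (hn : 0 < n) (W : Sub n) : (n : ℝ) - rk W ≤ n * (1 - X W) := by
  have : Nonempty (Fin n) := ⟨⟨0, hn⟩⟩
  have key : ∀ s : Finset (Fin n), rk (W ⊔ Submodule.span (ZMod 2) (e '' (s : Set (Fin n)))) ≤
      rk W + ∑ i ∈ s, (1 - ind (e i ∈ W)) := by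
    intro s
    induction s using Finset.induction_on with
    | empty => simp
    | insert i s hi ih =>
      rw [Finset.sum_insert hi, Finset.coe_insert, Set.image_insert_eq, Submodule.span_insert]
      have : W ⊔ (Submodule.span (ZMod 2) {e i} ⊔ Submodule.span (ZMod 2) (e '' (s : Set (Fin n))))
        = adj (W ⊔ Submodule.span (ZMod 2) (e '' (s : Set (Fin n)))) (e i) := by
        unfold adj; rw [sup_comm (Submodule.span (ZMod 2) {e i}), sup_assoc]
      rw [this, rk_adj]
      have : ind (e i ∈ W) ≤ ind (e i ∈ W ⊔ Submodule.span (ZMod 2) (e '' (s : Set (Fin n)))) :=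
        ind_mono fun h => (le_sup_left : W ≤ _) h
      linarith
  have h1 := key Finset.univ
  have h2 : W ⊔ Submodule.span (ZMod 2) (e '' ((Finset.univ : Finset (Fin n)) : Set (Fin n))) = ⊤ := by
    rw [Finset.coe_univ, Set.image_univ]
    have := (Pi.basisFun (ZMod 2) (Fin n)).span_eq
    have h3 : (e : Fin n → V n) = Pi.basisFun (ZMod 2) (Fin n) := by
      ext i j; simp [e]
    rw [h3, this]; simp
  rw [h2] at h1
  have h4 : rk (⊤ : Sub n) = n := by simp [rk]
  rw [h4] at h1
  have h5 : (n : ℝ) * (1 - X W) = ∑ i : Fin n, (1 - ind (e i ∈ W)) := by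
    unfold X fr avg
    rw [Finset.sum_sub_distrib]
    simp
    field_simp
  rw [h5]; linarith

lemma P_rk {n : ℕ} (hn : 0 < n) (W : Sub n) : P n rk W = rk W + 1 - X W := by
  have : Nonempty (Fin n) := ⟨⟨0, hn⟩⟩
  exact op_unif_rk _ W

lemma R_rk {n : ℕ} (k : ℕ) (hn : 0 < n) (W : Sub n) : R n k rk W = rk W + 1 - Y k W := by
  have : Nonempty (Fin n) := ⟨⟨0, hn⟩⟩
  exact op_unif_rk _ W

lemma mix_rk {n : ℕ} {ι : Type*} [Fintype ι] [Nonempty ι] (vec : ι → V n) (p : ℝ) (W : Sub n) :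
    op (mix p (unif vec)) rk W = rk W + p * (1 - fr vec W) := by
  rw [op_mix]
  simp only [LinearMap.add_apply, Pi.add_apply, LinearMap.smul_apply, Pi.smul_apply, smul_eq_mul,
    Module.End.one_apply, op_unif_rk]
  ring

lemma S_rk {n : ℕ} (k : ℕ) (hn : 0 < n) (W : Sub n) :
    S n k rk W = rk W + (1 / (k : ℝ)) * (1 - Y k W) := by
  have : Nonempty (Fin n) := ⟨⟨0, hn⟩⟩
  exact mix_rk _ _ W

lemma P_av {n : ℕ} (hn : 0 < n) : Av 1 (P n) := by
  have : Nonempty (Fin n) := ⟨⟨0, hn⟩⟩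
  exact Av.op (unif_prob _)

lemma R_av {n : ℕ} (k : ℕ) (hn : 0 < n) : Av 1 (R n k) := by
  have : Nonempty (Fin n) := ⟨⟨0, hn⟩⟩
  exact Av.op (unif_prob _)

lemma S_av {n : ℕ} (k : ℕ) (hk : 1 ≤ k) (hn : 0 < n) : Av 1 (S n k) := by
  have : Nonempty (Fin n) := ⟨⟨0, hn⟩⟩
  have : (1 : ℝ) ≤ k := by exact_mod_cast hk
  exact Av.op (mix_prob (by positivity) (by rw [div_le_one] <;> linarith) (unif_prob _))

end KX

namespace KX

lemma Av.add_const {n N : ℕ} {A : Module.End ℝ (Sub n → ℝ)} (hA : Av N A) (f : Sub n → ℝ) (c : ℝ)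
    (W : Sub n) : A (fun W => f W + c) W = A f W + c := by
  have : (fun W => f W + c) = f + (fun _ => c) := rfl
  rw [this, map_add, hA.const]; rfl

lemma Av.sub {n : ℕ} (A : Module.End ℝ (Sub n → ℝ)) (f g : Sub n → ℝ)
    (W : Sub n) : A (fun W => f W - g W) W = A f W - A g W := by
  have : (fun W => f W - g W) = f - g := rfl
  rw [this, map_sub]; rfl

lemma Av.add {n : ℕ} (A : Module.End ℝ (Sub n → ℝ)) (f g : Sub n → ℝ)
    (W : Sub n) : A (fun W => f W + g W) W = A f W + A g W := by
  have : (fun W => f W + g W) = f + g := rfl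
  rw [this, map_add]; rfl

lemma Av.smul {n : ℕ} (A : Module.End ℝ (Sub n → ℝ)) (c : ℝ) (f : Sub n → ℝ)
    (W : Sub n) : A (fun W => c * f W) W = c * A f W := by
  have : (fun W => c * f W) = c • f := rfl
  rw [this, map_smul]; rfl

lemma Av.sumf {n : ℕ} (A : Module.End ℝ (Sub n → ℝ)) {κ : Type*} (s : Finset κ)
    (f : κ → Sub n → ℝ) (W : Sub n) :
    A (fun W => ∑ i ∈ s, f i W) W = ∑ i ∈ s, A (f i) W := by
  have : (fun W => ∑ i ∈ s, f i W) = ∑ i ∈ s, f i := by ext W; simp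
  rw [this, map_sum]; simp

/-- second moment of deviation -/
lemma Av.dev_sq {n N : ℕ} {A : Module.End ℝ (Sub n → ℝ)} (hA : Av N A) {f : Sub n → ℝ}
    (hf : Lip f) (W : Sub n) : A (fun W' => (f W' - A f W) ^ 2) W ≤ N := by
  have h1 : (fun W' => (f W' - A f W) ^ 2) =
      fun W' => (f W' ^ 2 - (2 * A f W) * f W') + (A f W) ^ 2 := by ext; ring
  rw [h1, hA.add_const, Av.sub A (fun W => f W ^ 2) (fun W' => (2 * A f W) * f W'),
    Av.smul A (2 * A f W) f]
  have := hA.var f hf W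
  nlinarith

lemma Av.dev {n N : ℕ} {A : Module.End ℝ (Sub n → ℝ)} (hA : Av N A) {f : Sub n → ℝ}
    (hf : Lip f) (W : Sub n) : A (fun W' => |f W' - A f W|) W ≤ Real.sqrt (N + 1) := by
  set c := Real.sqrt (N + 1) with hc
  have hc0 : 0 < c := Real.sqrt_pos.2 (by positivity)
  have hcs : c ^ 2 = N + 1 := Real.sq_sqrt (by positivity)
  have h1 : ∀ W', |f W' - A f W| ≤ (1 / (2 * c)) * (f W' - A f W) ^ 2 + c / 2 := by
    intro W'
    rw [← sq_abs (f W' - A f W)]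
    have : (1 / (2 * c)) * |f W' - A f W| ^ 2 + c / 2 - |f W' - A f W| =
      (|f W' - A f W| - c) ^ 2 / (2 * c) := by field_simp; ring
    have h2 : 0 ≤ (|f W' - A f W| - c) ^ 2 / (2 * c) := by positivity
    linarith
  have h2 := hA.mono _ _ h1 W
  rw [hA.add_const (fun W' => (1 / (2 * c)) * (f W' - A f W) ^ 2),
    Av.smul A (1 / (2 * c)) (fun W' => (f W' - A f W) ^ 2)] at h2
  have h3 := hA.dev_sq hf W
  have h4 : (1 / (2 * c)) * A (fun W' => (f W' - A f W) ^ 2) W ≤ (1 / (2 * c)) * (N + 1) := by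
    gcongr; linarith
  have h5 : (1 / (2 * c)) * ((N : ℝ) + 1) = c / 2 := by rw [← hcs]; field_simp
  linarith

lemma P_pow_rk {n : ℕ} (hn : 0 < n) (s : ℕ) (W : Sub n) :
    (P n ^ s) rk W = rk W + s - ∑ l ∈ Finset.range s, (P n ^ l) X W := by
  induction s with
  | zero => simp
  | succ s ih =>
    rw [pow_succ, Module.End.mul_apply]
    have h1 : P n rk = fun W => (rk W - X W) + 1 := by ext W; rw [P_rk hn]; ring
    rw [h1, ((P_av hn).pow s).add_const (fun W => rk W - X W), Av.sub (P n ^ s) rk X, ih,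
      Finset.sum_range_succ]
    push_cast; ring

/-- the state with M row slots and T pins -/
noncomputable def ph (n k M T : ℕ) (f : Sub n → ℝ) : ℝ := (S n k ^ M * P n ^ T) f ⊥

lemma ph_av {n k : ℕ} (hk : 1 ≤ k) (hn : 0 < n) (M T : ℕ) : Av (M + T) (S n k ^ M * P n ^ T) :=
  ((S_av k hk hn).pow M).mul ((P_av hn).pow T)

lemma ph_P {n k M T : ℕ} (j : ℕ) (f : Sub n → ℝ) :
    ph n k M T ((P n ^ j) f) = ph n k M (T + j) f := by
  unfold ph
  rw [← Module.End.mul_apply, mul_assoc, ← pow_add]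

lemma ph_S {n k M T : ℕ} (f : Sub n → ℝ) :
    ph n k M T (S n k f) = ph n k (M + 1) T f := by
  unfold ph
  have h : Commute (P n ^ T) (S n k) := (op_comm _ _).pow_left T
  rw [← Module.End.mul_apply, mul_assoc, h.eq, ← mul_assoc, ← pow_succ]

lemma X_mem {n : ℕ} (hn : 0 < n) (W : Sub n) : 0 ≤ X W ∧ X W ≤ 1 := by
  have : Nonempty (Fin n) := ⟨⟨0, hn⟩⟩
  exact ⟨fr_nonneg _ _, fr_le_one _ _⟩

lemma ph_X_mem {n k : ℕ} (hk : 1 ≤ k) (hn : 0 < n) (M T : ℕ) :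
    0 ≤ ph n k M T X ∧ ph n k M T X ≤ 1 := by
  have hA := ph_av hk hn M T
  constructor
  · have := hA.mono _ _ (fun W => (X_mem hn W).1) ⊥
    rw [hA.const] at this; exact this
  · have := hA.mono _ _ (fun W => (X_mem hn W).2) ⊥
    rw [hA.const] at this; exact this

lemma P_pow_up {n : ℕ} (hn : 0 < n) {f : Sub n → ℝ} (hf : Up f) (l : ℕ) (W : Sub n) :
    f W ≤ (P n ^ l) f W := by
  induction l generalizing W with
  | zero => simp
  | succ l ih =>
    rw [pow_succ', Module.End.mul_apply]
    refine le_trans (ih W) ?_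
    have hu := ((P_av hn).pow l).up f hf
    have hne : Nonempty (Fin n) := ⟨⟨0, hn⟩⟩
    rw [op_unif, ← avg_const (ι := Fin n) ((P n ^ l) f W)]
    exact avg_mono fun i => hu W (e i)

lemma ph_X_mono {n k : ℕ} (hk : 1 ≤ k) (hn : 0 < n) (M T : ℕ) :
    ph n k M T X ≤ ph n k M (T + 1) X := by
  rw [← ph_P 1]
  exact (ph_av hk hn M T).mono _ _ (fun W => P_pow_up hn (fr_up _) 1 W) ⊥

lemma conc {n k : ℕ} (hk : 1 ≤ k) (hn : 0 < n) (M T s : ℕ) :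
    s * ph n k M T (fun W => |X W - ph n k M T X|) ≤ 2 * Real.sqrt ((M + T : ℕ) + 1) +
      2 * ∑ l ∈ Finset.range s, (ph n k M (T + l) X - ph n k M T X) := by
  have hA := ph_av hk hn M T
  set A := S n k ^ M * P n ^ T with hAdef
  have hph : ∀ f, ph n k M T f = A f ⊥ := fun f => rfl
  set f1 : Sub n → ℝ := (P n ^ s) rk with hf1
  have hl1 : Lip f1 := ((P_av hn).pow s).lip _ rk_lip
  set B : Sub n → ℝ := fun W => ∑ l ∈ Finset.range s, ((P n ^ l) X W - X W) with hB
  have hB0 : ∀ W, 0 ≤ B W := fun W => Finset.sum_nonneg fun l _ => by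
    have := P_pow_up hn (fr_up (e (n := n))) l W
    show 0 ≤ (P n ^ l) (fr e) W - fr e W
    linarith
  have hid : ∀ W, s * X W = s - f1 W + rk W - B W := by
    intro W
    simp only [hf1, hB, P_pow_rk hn, Finset.sum_sub_distrib, Finset.sum_const, Finset.card_range,
      nsmul_eq_mul]
    ring
  have hEB : A B ⊥ = ∑ l ∈ Finset.range s, (ph n k M (T + l) X - ph n k M T X) := by
    rw [hB, Av.sumf A _ (fun l W => (P n ^ l) X W - X W)]
    refine Finset.sum_congr rfl fun l _ => ?_
    rw [Av.sub A ((P n ^ l) X) X, ← hph, ← hph, ph_P]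
  have hEid : s * A X ⊥ = s - A f1 ⊥ + A rk ⊥ - A B ⊥ := by
    rw [← Av.smul A (s : ℝ) X]
    have : (fun W => (s : ℝ) * X W) = fun W => ((rk W - f1 W) - B W) + s := by
      ext W; rw [hid]; ring
    rw [this, hA.add_const (fun W => (rk W - f1 W) - B W), Av.sub A (fun W => rk W - f1 W) B,
      Av.sub A rk f1]
    ring
  have hpt : ∀ W, s * |X W - A X ⊥| ≤ ((|f1 W - A f1 ⊥| + |rk W - A rk ⊥|) + B W) + A B ⊥ := by
    intro W
    have h0 : (s : ℝ) * |X W - A X ⊥| = |s * X W - s * A X ⊥| := by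
      rw [← mul_sub, abs_mul, abs_of_nonneg (by positivity : (0:ℝ) ≤ s)]
    rw [h0, hid, hEid]
    have hEB0 : 0 ≤ A B ⊥ := by
      have := hA.mono _ _ hB0 ⊥
      rwa [hA.const] at this
    have := hB0 W
    have h1 := abs_le.1 (le_refl |f1 W - A f1 ⊥|)
    have h2 := abs_le.1 (le_refl |rk W - A rk ⊥|)
    rw [abs_le]; constructor <;> linarith [h1.1, h1.2, h2.1, h2.2]
  have h := hA.mono _ _ hpt ⊥
  rw [Av.smul A (s : ℝ) (fun W => |X W - A X ⊥|),
    hA.add_const (fun W => (|f1 W - A f1 ⊥| + |rk W - A rk ⊥|) + B W),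
    Av.add A (fun W => |f1 W - A f1 ⊥| + |rk W - A rk ⊥|) B,
    Av.add A (fun W => |f1 W - A f1 ⊥|) (fun W => |rk W - A rk ⊥|)] at h
  have d1 := hA.dev hl1 ⊥
  have d2 := hA.dev (rk_lip (n := n)) ⊥
  rw [← hEB]
  have : ph n k M T (fun W => |X W - ph n k M T X|) = A (fun W => |X W - A X ⊥|) ⊥ := rfl
  rw [this]
  linarith

lemma tele (a : ℕ → ℝ) (h0 : ∀ T, 0 ≤ a T) (h1 : ∀ T, a T ≤ 1) (Tm l : ℕ) :
    ∑ T ∈ Finset.range Tm, (a (T + l) - a T) ≤ l := by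
  induction l with
  | zero => simp
  | succ l ih =>
    have : ∑ T ∈ Finset.range Tm, (a (T + (l + 1)) - a (T + l)) = a (Tm + l) - a l := by
      have := Finset.sum_range_sub (fun T => a (T + l)) Tm
      simp only [zero_add] at this
      rw [← this]
      refine Finset.sum_congr rfl fun T _ => ?_
      congr 2; ring
    have h2 : ∑ T ∈ Finset.range Tm, (a (T + (l + 1)) - a T) =
      ∑ T ∈ Finset.range Tm, (a (T + (l + 1)) - a (T + l)) + ∑ T ∈ Finset.range Tm, (a (T + l) - a T) := by
      rw [← Finset.sum_add_distrib]
      exact Finset.sum_congr rfl fun T _ => by ring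
    rw [h2, this]
    have := h0 l; have := h1 (Tm + l)
    push_cast; linarith

lemma pow_sub_le {x y : ℝ} (hx0 : 0 ≤ x) (hx : x ≤ 1) (hy0 : 0 ≤ y) (hy : y ≤ 1) (k : ℕ) :
    x ^ k - y ^ k ≤ k * |x - y| := by
  have h := abs_pow_sub_pow_le x y k
  have h2 : max |x| |y| ^ (k - 1) ≤ 1 := by
    apply pow_le_one₀ (by positivity)
    rw [abs_of_nonneg hx0, abs_of_nonneg hy0]; exact max_le hx hy
  have h3 := le_abs_self (x ^ k - y ^ k)
  have h4 : |x - y| * k * max |x| |y| ^ (k - 1) ≤ |x - y| * k * 1 := by gcongr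
  linarith

/-- error term -/
noncomputable def eps (n k M T : ℕ) : ℝ := ph n k M T (Y k) - (ph n k M T X) ^ k

lemma eps_le {n j : ℕ} (hn : 0 < n) (M T s : ℕ) (hs : 0 < s) :
    eps n (j+1) M T ≤ (j+1 : ℝ) * (ph n (j+1) M (T + j) X - ph n (j+1) M T X) +
      (j+1 : ℝ) * ((2 * Real.sqrt ((M + T : ℕ) + 1) +
      2 * ∑ l ∈ Finset.range s, (ph n (j+1) M (T + l) X - ph n (j+1) M T X)) / s) := by
  have hk : 1 ≤ j + 1 := by omega
  have hA := ph_av hk hn M T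
  set A := S n (j+1) ^ M * P n ^ T with hAdef
  have hph : ∀ f, ph n (j+1) M T f = A f ⊥ := fun f => rfl
  have hc := conc hk hn M T s
  have hs' : (0 : ℝ) < s := by exact_mod_cast hs
  rw [mul_comm, ← le_div_iff₀ hs'] at hc
  have hx := ph_X_mem hk hn M T
  have hpt : ∀ W : Sub n, Y (j+1) W ≤ ((j+1 : ℝ) * |X W - ph n (j+1) M T X| +
      (j+1 : ℝ) * ((P n ^ j) X W - X W)) + (ph n (j+1) M T X) ^ (j+1) := by
    intro W
    have h1 := Y_le j W
    have h2 := pow_sub_le (X_mem hn W).1 (X_mem hn W).2 hx.1 hx.2 (j+1)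
    push_cast at h2
    linarith
  have h := hA.mono _ _ hpt ⊥
  rw [hA.add_const (fun W => (j+1 : ℝ) * |X W - ph n (j+1) M T X| +
      (j+1 : ℝ) * ((P n ^ j) X W - X W)), Av.add A (fun W => (j+1 : ℝ) * |X W - ph n (j+1) M T X|)
      (fun W => (j+1 : ℝ) * ((P n ^ j) X W - X W)),
      Av.smul A (j+1 : ℝ) (fun W => |X W - ph n (j+1) M T X|),
      Av.smul A (j+1 : ℝ) (fun W => (P n ^ j) X W - X W), Av.sub A ((P n ^ j) X) X,
      ← hph, ← hph, ← hph, ← hph, ph_P] at h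
  unfold eps
  have h3 : (j+1 : ℝ) * ph n (j+1) M T (fun W => |X W - ph n (j+1) M T X|) ≤ _ :=
    mul_le_mul_of_nonneg_left hc (by positivity)
  linarith

lemma sum_eps {n j : ℕ} (hn : 0 < n) (M Tm s : ℕ) (hs : 0 < s) :
    ∑ T ∈ Finset.range Tm, eps n (j+1) M T ≤
      (j+1 : ℝ) * (j + Tm * (2 * Real.sqrt (M + Tm + 1)) / s + 2 * s) := by
  have hk : 1 ≤ j + 1 := by omega
  have hs' : (0 : ℝ) < s := by exact_mod_cast hs
  set a : ℕ → ℝ := fun T => ph n (j+1) M T X with ha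
  have ht : ∀ l, ∑ T ∈ Finset.range Tm, (a (T + l) - a T) ≤ l :=
    fun l => tele a (fun T => (ph_X_mem hk hn M T).1) (fun T => (ph_X_mem hk hn M T).2) Tm l
  have h1 : ∑ T ∈ Finset.range Tm, eps n (j+1) M T ≤ ∑ T ∈ Finset.range Tm,
     ((j+1 : ℝ) * (a (T + j) - a T) +
      (j+1 : ℝ) * ((2 * Real.sqrt (M + Tm + 1) +
      2 * ∑ l ∈ Finset.range s, (a (T + l) - a T)) / s)) := by
    refine Finset.sum_le_sum fun T hT => le_trans (eps_le hn M T s hs) ?_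
    have : (T : ℝ) ≤ Tm := by exact_mod_cast (Finset.mem_range.1 hT).le
    push_cast
    gcongr
  refine h1.trans ?_
  rw [Finset.sum_add_distrib, ← Finset.mul_sum, ← Finset.mul_sum, ← mul_add, ← Finset.sum_div,
    Finset.sum_add_distrib, Finset.sum_const, ← Finset.mul_sum, Finset.sum_comm]
  have h2 : ∑ l ∈ Finset.range s, ∑ T ∈ Finset.range Tm, (a (T + l) - a T) ≤ s * s := by
    calc _ ≤ ∑ l ∈ Finset.range s, (s : ℝ) := by
          refine Finset.sum_le_sum fun l hl => (ht l).trans ?_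
          exact_mod_cast (Finset.mem_range.1 hl).le
      _ = _ := by simp
  simp only [Finset.card_range, nsmul_eq_mul]
  have h3 : ((Tm : ℝ) * (2 * Real.sqrt (M + Tm + 1)) + 2 * ∑ l ∈ Finset.range s, ∑ T ∈ Finset.range Tm, (a (T + l) - a T)) / s
     ≤ Tm * (2 * Real.sqrt (M + Tm + 1)) / s + 2 * s := by
    rw [add_div]
    gcongr
    rw [div_le_iff₀ hs']; linarith
  have := ht j
  refine mul_le_mul_of_nonneg_left ?_ (by positivity)
  linarith

end KX

namespace KX

lemma mono_of_hasDeriv {f f' : ℝ → ℝ} {D : Set ℝ} (hD : Convex ℝ D)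
    (hf : ∀ x ∈ D, HasDerivAt f (f' x) x) (hp : ∀ x ∈ D, 0 ≤ f' x) : MonotoneOn f D := by
  refine monotoneOn_of_deriv_nonneg hD (fun x hx => (hf x hx).continuousAt.continuousWithinAt)
    (fun x hx => (hf x (interior_subset hx)).differentiableAt.differentiableWithinAt)
    (fun x hx => ?_)
  rw [(hf x (interior_subset hx)).deriv]
  exact hp x (interior_subset hx)

lemma anti_of_hasDeriv {f f' : ℝ → ℝ} {D : Set ℝ} (hD : Convex ℝ D)
    (hf : ∀ x ∈ D, HasDerivAt f (f' x) x) (hp : ∀ x ∈ D, f' x ≤ 0) : AntitoneOn f D := by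
  have := mono_of_hasDeriv (f := fun x => - f x) (f' := fun x => - f' x) hD
    (fun x hx => (hf x hx).neg) (fun x hx => by have := hp x hx; linarith)
  intro a ha b hb hab
  have := this ha hb hab
  simpa using this

lemma hd_congr {f g : ℝ → ℝ} {a b x : ℝ} (h : HasDerivAt g a x) (hf : ∀ y, f y = g y) (hb : b = a) :
    HasDerivAt f b x := by
  have : f = g := funext hf
  rw [this, hb]; exact h

lemma an1 (K : ℝ) (hK : 0 ≤ K) (y : ℝ) (hy : 0 ≤ y) :
    0 ≤ Real.exp y * ((y - K) ^ 2 + y) - ((K - 1) ^ 2 * y + K ^ 2) := by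
  have d1 : ∀ y : ℝ, HasDerivAt (fun y => Real.exp y * ((y - K + 1) ^ 2 + y) - (K - 1) ^ 2)
      (Real.exp y * ((y - K + 2) ^ 2 + y)) y := by
    intro y
    have h := ((Real.hasDerivAt_exp y).mul
      (((((hasDerivAt_id y).sub_const K).add_const 1).pow 2).add (hasDerivAt_id y))).sub_const ((K-1)^2)
    exact hd_congr h (fun y => by simp) (by simp; ring)
  have m1 := mono_of_hasDeriv (convex_Ici (0:ℝ)) (fun y _ => d1 y)
    (fun y hy => by have : (0:ℝ) ≤ y := hy; positivity)
  have d2 : ∀ y : ℝ, HasDerivAt (fun y => Real.exp y * ((y - K) ^ 2 + y) - ((K - 1) ^ 2 * y + K ^ 2))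
      (Real.exp y * ((y - K + 1) ^ 2 + y) - (K - 1) ^ 2) y := by
    intro y
    have h := ((Real.hasDerivAt_exp y).mul
      ((((hasDerivAt_id y).sub_const K).pow 2).add (hasDerivAt_id y))).sub
      ((((hasDerivAt_id y).const_mul ((K-1)^2))).add_const (K^2))
    exact hd_congr h (fun y => by simp) (by simp; ring)
  have m2 := mono_of_hasDeriv (convex_Ici (0:ℝ)) (fun y _ => d2 y)
    (fun y hy => by
      have := m1 (Set.mem_Ici.2 le_rfl) hy hy
      simp at this; nlinarith)
  have := m2 (Set.mem_Ici.2 le_rfl) hy hy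
  simpa using this

noncomputable def nn (K y : ℝ) : ℝ := y * (Real.exp y - 1) - K * (Real.exp y - 1 - y)

lemma nn_mono (k : ℕ) : MonotoneOn (fun y => nn k y / y ^ k) (Set.Ioi 0) := by
  have d : ∀ y ∈ Set.Ioi (0:ℝ), HasDerivAt (fun y => nn k y / y ^ k)
     (((Real.exp y - 1 + y * Real.exp y - k * (Real.exp y - 1)) * y ^ k - nn k y * (k * y ^ (k-1))) / (y ^ k) ^ 2) y := by
    intro y hy
    have hy0 : y ≠ 0 := ne_of_gt hy
    have h1 : HasDerivAt (fun y => nn k y) (Real.exp y - 1 + y * Real.exp y - k * (Real.exp y - 1)) y := by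
      have h := ((hasDerivAt_id y).mul ((Real.hasDerivAt_exp y).sub_const 1)).sub
        ((((Real.hasDerivAt_exp y).sub_const 1).sub (hasDerivAt_id y)).const_mul (k:ℝ))
      exact hd_congr h (fun y => by simp [nn]) (by simp)
    exact h1.div (hasDerivAt_pow k y) (pow_ne_zero _ hy0)
  refine mono_of_hasDeriv (convex_Ioi 0) d fun y hy => ?_
  have hy0 : (0:ℝ) < y := hy
  refine div_nonneg ?_ (by positivity)
  rcases Nat.eq_zero_or_pos k with rfl | hk
  · simp
    have := Real.add_one_le_exp y
    nlinarith [Real.exp_pos y]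
  obtain ⟨j, rfl⟩ : ∃ j, k = j + 1 := ⟨k - 1, by omega⟩
  have h1 := an1 (j + 1 : ℝ) (by positivity) y hy0.le
  have : (Real.exp y - 1 + y * Real.exp y - ((j+1:ℕ):ℝ) * (Real.exp y - 1)) * y ^ (j+1) - nn ((j+1:ℕ):ℝ) y * (((j+1:ℕ):ℝ) * y ^ (j+1-1))
    = y ^ j * (Real.exp y * ((y - (j+1)) ^ 2 + y) - (((j+1:ℝ) - 1) ^ 2 * y + (j+1) ^ 2)) := by
    unfold nn; push_cast
    rw [pow_succ]; ring
  rw [this]; positivity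

noncomputable def ww (y : ℝ) : ℝ := Real.exp (-y) - 1 + y

lemma ww_pos {y : ℝ} (hy : 0 < y) : 0 < ww y := by
  have := Real.add_one_lt_exp (x := -y) (by linarith)
  unfold ww; linarith

section
variable {k : ℕ} (hk : 3 ≤ k) {lam : ℝ} (hlam : 0 < lam) (hroot : psi lam = k)
include hlam hroot

lemma nn_root : nn k lam = 0 := by
  have h : 0 < Real.exp lam - 1 - lam := by
    have := Real.add_one_lt_exp (x := lam) (by linarith); linarith
  unfold psi at hroot
  rw [if_neg (by linarith), div_eq_iff h.ne'] at hroot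
  unfold nn; linarith

lemma Q_min (y : ℝ) (hy : 0 < y) :
    k * Real.log lam - (k - 1 : ℝ) * Real.log (ww lam) ≤ k * Real.log y - (k - 1 : ℝ) * Real.log (ww y) := by
  have hr := nn_root hlam hroot
  have hm := nn_mono k
  have d : ∀ y ∈ Set.Ioi (0:ℝ), HasDerivAt (fun y => k * Real.log y - (k - 1 : ℝ) * Real.log (ww y))
      (Real.exp (-y) * nn k y / (y * ww y)) y := by
    intro y hy
    have hy0 : 0 < y := hy
    have hw := ww_pos hy0
    have h1 : HasDerivAt ww (-Real.exp (-y) + 1) y := by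
      have h := (((Real.hasDerivAt_exp (-y)).comp y (hasDerivAt_neg y)).sub_const 1).add (hasDerivAt_id y)
      exact hd_congr h (fun y => by simp [ww]) (by simp)
    have h := ((Real.hasDerivAt_log hy0.ne').const_mul (k:ℝ)).sub ((h1.log hw.ne').const_mul (k - 1 : ℝ))
    refine hd_congr h (fun y => by simp) ?_
    have he : Real.exp (-y) * Real.exp y = 1 := by rw [← Real.exp_add]; simp
    field_simp
    have : Real.exp (-y) * nn k y = y * (1 - Real.exp (-y)) - k * (1 - Real.exp (-y) - Real.exp (-y) * y) := by
      unfold nn; linear_combination (y - k) * he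
    rw [this]; unfold ww; ring
  rcases le_total y lam with h | h
  · have ha : AntitoneOn (fun y => k * Real.log y - (k - 1 : ℝ) * Real.log (ww y)) (Set.Ioc 0 lam) := by
      refine anti_of_hasDeriv (convex_Ioc 0 lam) (fun y hy => d y hy.1) fun y hy => ?_
      have := hm hy.1 hlam hy.2
      simp only [hr, zero_div] at this
      have h2 : nn k y ≤ 0 := by
        by_contra hc; push Not at hc
        have : 0 < nn k y / y ^ k := div_pos hc (pow_pos hy.1 k)
        linarith
      have := ww_pos hy.1
      have := hy.1
      apply div_nonpos_of_nonpos_of_nonneg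
      · exact mul_nonpos_of_nonneg_of_nonpos (Real.exp_pos _).le h2
      · positivity
    exact ha ⟨hy, h⟩ ⟨hlam, le_rfl⟩ h
  · have ha : MonotoneOn (fun y => k * Real.log y - (k - 1 : ℝ) * Real.log (ww y)) (Set.Ici lam) := by
      refine mono_of_hasDeriv (convex_Ici lam) (fun y hy => d y (lt_of_lt_of_le hlam hy)) fun y hy => ?_
      have hy0 : 0 < y := (lt_of_lt_of_le hlam hy)
      have := hm hlam hy0 hy
      simp only [hr, zero_div] at this
      have h2 : 0 ≤ nn k y := by
        by_contra hc; push Not at hc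
        have : nn k y / y ^ k < 0 := div_neg_of_neg_of_pos hc (pow_pos hy0 k)
        linarith
      have := ww_pos hy0
      positivity
    exact ha (Set.mem_Ici.2 le_rfl) h h

lemma als_mem : 0 < 1 - Real.exp (-lam) ∧ 1 - Real.exp (-lam) < 1 := by
  have : Real.exp (-lam) < 1 := by rw [Real.exp_lt_one_iff]; linarith
  have := Real.exp_pos (-lam)
  constructor <;> linarith

lemma ww_root : k * ww lam = (k - 1 : ℝ) * lam * (1 - Real.exp (-lam)) := by
  have hr := nn_root hlam hroot
  have he : Real.exp (-lam) * Real.exp lam = 1 := by rw [← Real.exp_add]; simp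
  unfold nn at hr; unfold ww
  linear_combination Real.exp (-lam) * hr + (k - lam) * he

include hk in
lemma c_star_pos : 0 < gfun k lam := by
  have := (als_mem hlam hroot).1
  have : (0:ℝ) < k := by positivity
  unfold gfun; positivity

include hk in
lemma Phi0_le {c : ℝ} (hc0 : 0 ≤ c) (hc : c ≤ gfun k lam) {a : ℝ} (ha0 : 0 ≤ a) :
    Real.exp (-(c * k * a ^ (k-1))) - c + c * k * a ^ (k-1) - c * (k - 1 : ℝ) * a ^ k ≤ 1 - c := by
  obtain ⟨j, rfl⟩ : ∃ j, k = j + 1 := ⟨k - 1, by omega⟩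
  have hj : (2:ℝ) ≤ j := by exact_mod_cast (by omega : 2 ≤ j)
  have hs := (als_mem hlam hroot).1
  set as := 1 - Real.exp (-lam) with has
  simp only [Nat.add_sub_cancel]
  push_cast
  rcases eq_or_lt_of_le hc0 with h0 | hcp
  · subst h0; simp
  rcases eq_or_lt_of_le ha0 with h0 | hap
  · subst h0; simp [show j ≠ 0 by rintro rfl; norm_num at hj]
  set y := c * (j+1) * a ^ j with hy
  have hyp : 0 < y := by positivity
  have hQ := Q_min hlam hroot y hyp
  have hwr := ww_root hlam hroot
  rw [← has] at hwr
  push_cast at hQ hwr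
  have hwl := ww_pos hlam
  have hww := ww_pos hyp
  have hl1 : Real.log (j+1) + Real.log (ww lam) = Real.log j + Real.log lam + Real.log as := by
    rw [← Real.log_mul (by positivity) hwl.ne', hwr, Real.log_mul (by simp; constructor <;> [linarith; exact hlam.ne']) hs.ne',
      Real.log_mul (by simp; linarith) hlam.ne']
    ring_nf
  have hl2 : Real.log y ≤ Real.log lam + j * (Real.log a - Real.log as) := by
    have : y ≤ lam * (a / as) ^ j := by
      rw [hy]
      have : c * ((j+1) * as ^ j) ≤ lam := by
        have := hc
        unfold gfun at this
        rw [le_div_iff₀ (by rw [← has]; positivity), ← has] at this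
        push_cast at this; simpa using this
      rw [div_pow, ← mul_div_assoc, le_div_iff₀ (by positivity)]
      nlinarith [pow_pos hap j]
    have := Real.log_le_log hyp this
    rwa [Real.log_mul hlam.ne' (by positivity), Real.log_pow, Real.log_div hap.ne' hs.ne'] at this
  have hfin : Real.log (ww y) ≤ Real.log (j * c * a ^ (j+1)) := by
    have e1 : Real.log (j * c * a ^ (j+1)) = Real.log j + Real.log c + (j+1) * Real.log a := by
      rw [Real.log_mul (by positivity) (by positivity), Real.log_mul (by positivity) (by positivity), Real.log_pow]
      push_cast; ring
    have e2 : Real.log y = Real.log c + Real.log (j+1) + j * Real.log a := by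
      rw [hy, Real.log_mul (by positivity) (by positivity), Real.log_mul (by positivity) (by positivity), Real.log_pow]
    rw [e1]
    have : (j:ℝ) * Real.log (ww y) ≤ j * (Real.log j + Real.log c + (j+1) * Real.log a) := by
      have e3 : Real.log (ww lam) = Real.log j + Real.log lam + Real.log as - Real.log (j+1) := by linarith
      rw [e3] at hQ
      have e4 : Real.log c = Real.log y - Real.log (j+1) - j * Real.log a := by linarith
      rw [e4]
      linarith
    exact le_of_mul_le_mul_left this (by linarith)
  have := (Real.log_le_log_iff hww (by positivity)).1 hfin
  unfold ww at this
  linarith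

include hk in
lemma Phi0_ge (c : ℝ) : 1 - c + (c - gfun k lam) * (1 - Real.exp (-lam)) ^ k ≤
    Real.exp (-(c * k * (1 - Real.exp (-lam)) ^ (k-1))) - c + c * k * (1 - Real.exp (-lam)) ^ (k-1)
      - c * (k - 1 : ℝ) * (1 - Real.exp (-lam)) ^ k := by
  obtain ⟨j, rfl⟩ : ∃ j, k = j + 1 := ⟨k - 1, by omega⟩
  have hs := (als_mem hlam hroot).1
  have hwr := ww_root hlam hroot
  unfold ww at hwr
  have hexp : Real.exp (-lam) = 1 - (1 - Real.exp (-lam)) := by ring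
  have hg : gfun (j+1) lam * ((j+1) * (1 - Real.exp (-lam)) ^ j) = lam := by
    unfold gfun
    push_cast
    field_simp
  set a := 1 - Real.exp (-lam) with ha
  set g := gfun (j+1) lam
  push_cast at hwr ⊢
  have h1 : Real.exp (-(c * (j+1) * a ^ j)) ≥ Real.exp (-lam) * (1 - (c - g) * (j+1) * a ^ j) := by
    have : -(c * (j+1) * a ^ j) = -lam + (-(c - g) * (j+1) * a ^ j) := by rw [← hg]; ring
    rw [this, Real.exp_add]
    have := Real.add_one_le_exp (-(c - g) * (j+1) * a ^ j)
    have := mul_le_mul_of_nonneg_left this (Real.exp_pos (-lam)).le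
    linarith
  have h2 : (j + 1 : ℝ) * (Real.exp (-lam) - 1 + lam) = j * lam * a := by linarith
  rw [← hg] at h2
  have h3 : Real.exp (-lam) - 1 + lam = j * (g * a ^ j) * a := by
    have : (j + 1 : ℝ) ≠ 0 := by positivity
    apply mul_left_cancel₀ this
    rw [← hg]; linarith
  rw [pow_succ]
  have h4 : Real.exp (-lam) * (1 - (c - g) * (j+1) * a ^ j) = Real.exp (-lam) - (1 - a) * ((c - g) * (j+1) * a ^ j) := by
    rw [hexp]; ring
  rw [h4] at h1
  have h5 : Real.exp (-lam) = 1 - g * ((j+1) * a ^ j) + j * (g * a ^ j) * a := by linarith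
  nlinarith
end

/-- the potential, k = j+1 -/
noncomputable def Phi (j : ℕ) (c u a : ℝ) : ℝ :=
  Real.exp (-u - c * (j+1) * a ^ j) - c + c * (j+1) * a ^ j - c * j * a ^ (j+1)

lemma Phi_deriv (i : ℕ) (c u a : ℝ) : HasDerivAt (Phi (i+1) c u)
    (c * (i+2) * (i+1) * a ^ i * (1 - a - Real.exp (-u - c * (i+2) * a ^ (i+1)))) a := by
  have h1 : HasDerivAt (fun a : ℝ => c * (i+2) * a ^ (i+1)) (c * (i+2) * ((i+1) * a ^ i)) a := by
    have := (hasDerivAt_pow (i+1) a).const_mul (c * (i+2))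
    simpa using this
  have h2 : HasDerivAt (fun a : ℝ => c * (i+1) * a ^ (i+2)) (c * (i+1) * ((i+2) * a ^ (i+1))) a := by
    have := (hasDerivAt_pow (i+2) a).const_mul (c * (i+1))
    exact hd_congr this (fun y => rfl) (by push_cast; ring)
  have h := ((((h1.const_sub (-u)).exp).sub_const c).add h1).sub h2
  refine hd_congr h (fun y => ?_) (by ring)
  simp only [Phi, Pi.add_apply, Pi.sub_apply]; push_cast; ring_nf

lemma exists_max (i : ℕ) {c u : ℝ} (hc : 0 ≤ c) (hu : 0 ≤ u) :
    ∃ a, 0 ≤ a ∧ a ≤ 1 ∧ (∀ b, 0 ≤ b → b ≤ 1 → Phi (i+1) c u b ≤ Phi (i+1) c u a) ∧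
      1 - a = Real.exp (-u - c * (i+2) * a ^ (i+1)) := by
  have he1 : Real.exp (-u) ≤ 1 := by rw [Real.exp_le_one_iff]; linarith
  have he0 := Real.exp_pos (-u)
  rcases eq_or_lt_of_le hc with h0 | hcp
  · subst h0
    exact ⟨1 - Real.exp (-u), by linarith, by linarith, by intro b _ _; simp [Phi], by simp⟩
  have hcont : Continuous (Phi (i+1) c u) := by unfold Phi; fun_prop
  obtain ⟨a, ha, hmax⟩ := isCompact_Icc.exists_isMaxOn (⟨0, by simp⟩ : (Set.Icc (0:ℝ) 1).Nonempty)
    hcont.continuousOn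
  have hmax' : ∀ b, 0 ≤ b → b ≤ 1 → Phi (i+1) c u b ≤ Phi (i+1) c u a := fun b h0 h1 => hmax ⟨h0, h1⟩
  refine ⟨a, ha.1, ha.2, hmax', ?_⟩
  rcases eq_or_lt_of_le ha.1 with h0 | h0
  · subst h0
    rcases eq_or_lt_of_le hu with hu0 | hup
    · subst hu0; simp
    exfalso
    set b := 1 - Real.exp (-u) with hb
    have hlt : Real.exp (-u) < 1 := by rw [Real.exp_lt_one_iff]; linarith
    have hb0 : 0 < b := by linarith
    have hsm : StrictMonoOn (Phi (i+1) c u) (Set.Icc 0 b) := by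
      refine strictMonoOn_of_deriv_pos (convex_Icc 0 b) hcont.continuousOn fun x hx => ?_
      rw [interior_Icc] at hx
      have hx0 := hx.1
      rw [(Phi_deriv i c u x).deriv]
      have : Real.exp (-u - c * (i+2) * x ^ (i+1)) ≤ Real.exp (-u) := by
        rw [Real.exp_le_exp]
        have : 0 ≤ c * (i+2) * x ^ (i+1) := by positivity
        linarith
      have : 0 < 1 - x - Real.exp (-u - c * (i+2) * x ^ (i+1)) := by linarith [hx.2]
      positivity
    have := hsm ⟨le_rfl, hb0.le⟩ ⟨hb0.le, le_rfl⟩ hb0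
    have := hmax' b hb0.le (by linarith)
    linarith
  rcases eq_or_lt_of_le ha.2 with h1 | h1
  · subst h1
    exfalso
    set b := 1 - Real.exp (-u - c * (i+2)) with hb
    have hp := Real.exp_pos (-u - c * (i+2))
    have hle : Real.exp (-u - c * (i+2)) ≤ 1 := by
      rw [Real.exp_le_one_iff]
      have : 0 ≤ c * (i+2) := by positivity
      linarith
    have hsm : StrictAntiOn (Phi (i+1) c u) (Set.Icc b 1) := by
      refine strictAntiOn_of_deriv_neg (convex_Icc b 1) hcont.continuousOn fun x hx => ?_
      rw [interior_Icc] at hx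
      have hx0 : 0 < x := by linarith [hx.1]
      rw [(Phi_deriv i c u x).deriv]
      have : Real.exp (-u - c * (i+2)) ≤ Real.exp (-u - c * (i+2) * x ^ (i+1)) := by
        rw [Real.exp_le_exp]
        have : c * (i+2) * x ^ (i+1) ≤ c * (i+2) * 1 := by
          gcongr; exact pow_le_one₀ hx0.le hx.2.le
        linarith
      have : 1 - x - Real.exp (-u - c * (i+2) * x ^ (i+1)) < 0 := by linarith [hx.1]
      exact mul_neg_of_pos_of_neg (by positivity) this
    have hb1 : b < 1 := by linarith
    have := hsm ⟨le_rfl, hb1.le⟩ ⟨hb1.le, le_rfl⟩ hb1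
    have := hmax' b (by linarith) hb1.le
    linarith
  have hloc : IsLocalMax (Phi (i+1) c u) a := hmax.isLocalMax (Icc_mem_nhds h0 h1)
  have hd := hloc.hasDerivAt_eq_zero (Phi_deriv i c u a)
  have : c * (i+2) * (i+1) * a ^ i ≠ 0 := by positivity
  have := (mul_eq_zero.1 hd).resolve_left this
  linarith

noncomputable def al (i : ℕ) (c u : ℝ) : ℝ :=
  if h : 0 ≤ c ∧ 0 ≤ u then (exists_max i h.1 h.2).choose else 0

lemma al_spec (i : ℕ) {c u : ℝ} (hc : 0 ≤ c) (hu : 0 ≤ u) :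
    0 ≤ al i c u ∧ al i c u ≤ 1 ∧ (∀ b, 0 ≤ b → b ≤ 1 → Phi (i+1) c u b ≤ Phi (i+1) c u (al i c u)) ∧
      1 - al i c u = Real.exp (-u - c * (i+2) * (al i c u) ^ (i+1)) := by
  unfold al
  rw [dif_pos ⟨hc, hu⟩]
  exact (exists_max i hc hu).choose_spec

noncomputable def KK (i : ℕ) (c u : ℝ) : ℝ := Phi (i+1) c u (al i c u)

lemma KK_c (i : ℕ) {c u d : ℝ} (hc : 0 ≤ c) (hu : 0 ≤ u) (hd : 0 ≤ d) :
    d * (-1 + al i c u ^ (i+2)) ≤ KK i (c + d) u - KK i c u := by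
  obtain ⟨h0, h1, hm, hf⟩ := al_spec i hc hu
  obtain ⟨_, _, hm', _⟩ := al_spec i (add_nonneg hc hd) hu
  have h := hm' _ h0 h1
  set a := al i c u
  have h2 : KK i (c + d) u ≥ Phi (i+1) (c+d) u a := h
  have h3 : KK i c u = Phi (i+1) c u a := rfl
  have h4 : Real.exp (-u - (c+d) * (i+2) * a ^ (i+1)) ≥ (1 - a) * (1 - d * (i+2) * a ^ (i+1)) := by
    rw [hf, show -u - (c+d) * (i+2) * a ^ (i+1) = (-u - c * (i+2) * a ^ (i+1)) + (-(d * (i+2) * a ^ (i+1))) by ring,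
      Real.exp_add]
    have := Real.add_one_le_exp (-(d * (i+2) * a ^ (i+1)))
    have := mul_le_mul_of_nonneg_left this (Real.exp_pos (-u - c * (i+2) * a ^ (i+1))).le
    linarith
  unfold Phi at h2 h3
  push_cast at h2 h3
  have e2 : ((i:ℝ)+1+1) = i + 2 := by ring
  rw [e2] at h2 h3
  rw [← hf] at h3
  have e3 : a ^ (i+1+1) = a ^ (i+1) * a := pow_succ _ _
  have e4 : a ^ (i+2) = a ^ (i+1) * a := pow_succ _ _
  rw [e3] at h2 h3
  rw [e4]
  nlinarith

lemma KK_u_ge (i : ℕ) {c u d : ℝ} (hc : 0 ≤ c) (hu : 0 ≤ u) (hd : 0 ≤ d) :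
    -d * (1 - al i c u) ≤ KK i c (u + d) - KK i c u := by
  obtain ⟨h0, h1, hm, hf⟩ := al_spec i hc hu
  obtain ⟨_, _, hm', _⟩ := al_spec i hc (add_nonneg hu hd)
  have h := hm' _ h0 h1
  set a := al i c u
  have h2 : KK i c (u+d) ≥ Phi (i+1) c (u+d) a := h
  have h3 : KK i c u = Phi (i+1) c u a := rfl
  have h4 : Real.exp (-(u+d) - c * (i+2) * a ^ (i+1)) ≥ (1 - a) * (1 - d) := by
    rw [hf, show -(u+d) - c * (i+2) * a ^ (i+1) = (-u - c * (i+2) * a ^ (i+1)) + (-d) by ring,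
      Real.exp_add]
    have := Real.add_one_le_exp (-d)
    have := mul_le_mul_of_nonneg_left this (Real.exp_pos (-u - c * (i+2) * a ^ (i+1))).le
    linarith
  unfold Phi at h2 h3
  push_cast at h2 h3
  have e2 : ((i:ℝ)+1+1) = i + 2 := by ring
  rw [e2] at h2 h3
  rw [← hf] at h3
  linarith

lemma KK_u_le (i : ℕ) {c u d : ℝ} (hc : 0 ≤ c) (hu : 0 ≤ u) (hd : 0 ≤ d) :
    KK i c (u + d) - KK i c u ≤ -d * (1 - al i c (u+d)) := by
  obtain ⟨_, _, hm', _⟩ := al_spec i hc hu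
  obtain ⟨h0, h1, hm, hf⟩ := al_spec i hc (add_nonneg hu hd)
  have h := hm' _ h0 h1
  set a := al i c (u+d)
  have h2 : KK i c u ≥ Phi (i+1) c u a := h
  have h3 : KK i c (u+d) = Phi (i+1) c (u+d) a := rfl
  have h4 : Real.exp (-u - c * (i+2) * a ^ (i+1)) ≥ (1 - a) * (1 + d) := by
    rw [hf, show -u - c * (i+2) * a ^ (i+1) = (-(u+d) - c * (i+2) * a ^ (i+1)) + d by ring,
      Real.exp_add]
    have := Real.add_one_le_exp d
    have := mul_le_mul_of_nonneg_left this (Real.exp_pos (-(u+d) - c * (i+2) * a ^ (i+1))).le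
    linarith
  unfold Phi at h2 h3
  push_cast at h2 h3
  have e2 : ((i:ℝ)+1+1) = i + 2 := by ring
  rw [e2] at h2 h3
  rw [← hf] at h3
  linarith

lemma KK_nonneg (i : ℕ) {c u : ℝ} (hc : 0 ≤ c) (hu : 0 ≤ u) : 0 ≤ KK i c u := by
  obtain ⟨h0, h1, hm, hf⟩ := al_spec i hc hu
  have := hm 1 zero_le_one le_rfl
  have h3 : 0 ≤ Phi (i+1) c u 1 := by
    unfold Phi
    simp only [one_pow, mul_one]
    have := Real.exp_pos (-u - c * ((i+1:ℕ) + 1))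
    linarith
  exact h3.trans this

lemma KK_zero (i : ℕ) (u : ℝ) : KK i 0 u = Real.exp (-u) := by
  unfold KK Phi; simp

lemma KK_star {i : ℕ} (hi : 1 ≤ i) {lam : ℝ} (hlam : 0 < lam) (hroot : psi lam = (i + 2 : ℕ)) {c : ℝ}
    (hc0 : 0 ≤ c) (hc : c ≤ gfun (i+2) lam) : KK i c 0 ≤ 1 - c := by
  obtain ⟨h0, h1, hm, hf⟩ := al_spec i hc0 le_rfl
  have := Phi0_le (k := i + 2) (by omega) hlam hroot hc0 hc h0
  unfold KK Phi
  push_cast at this ⊢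
  have e2 : ((i:ℝ)+1+1) = i + 2 := by ring
  have e3 : ((i:ℝ)+2-1) = i + 1 := by ring
  rw [e2]; rw [e3] at this
  simpa using this

end KX

namespace KX

lemma tangent {a b : ℝ} (ha : 0 ≤ a) (hb : 0 ≤ b) (j : ℕ) :
    (j+1 : ℝ) * b ^ j * a - j * b ^ (j+1) ≤ a ^ (j+1) := by
  induction j with
  | zero => simp
  | succ j ih =>
    have h1 := mul_le_mul_of_nonneg_left ih ha
    have h2 : 0 ≤ (j+1 : ℝ) * b ^ j * (a - b) ^ 2 := by positivity
    push_cast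
    have e : a ^ (j+1+1) = a * a ^ (j+1) := pow_succ' _ _
    rw [e]
    refine le_trans ?_ h1
    have e2 : b ^ (j+1+1) = b ^ j * b * b := by ring
    have e3 : b ^ (j+1) = b ^ j * b := by ring
    rw [e2, e3]
    nlinarith

lemma abel_sum (b d : ℕ → ℝ) (hb : ∀ T, 0 ≤ b T) (hbm : ∀ T, b T ≤ b (T+1)) (hd : ∀ T, 0 ≤ d T) (Tm : ℕ) :
    ∑ T ∈ Finset.range Tm, b T * (d (T+1) - d T) ≤ b Tm * d Tm := by
  induction Tm with
  | zero => simp; exact mul_nonneg (hb 0) (hd 0)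
  | succ Tm ih =>
    rw [Finset.sum_range_succ]
    have := mul_le_mul_of_nonneg_right (hbm Tm) (hd (Tm+1))
    linarith

section
variable {n i : ℕ} (hn : 0 < n)

noncomputable def HH (n i M T : ℕ) : ℝ := n - ph n (i+2) M T rk
noncomputable def Kh (n i M T : ℕ) : ℝ := n * KK i ((M:ℝ) / ((i+2) * n)) ((T:ℝ) / n)
noncomputable def DD (n i M T : ℕ) : ℝ := HH n i M T - Kh n i M T
noncomputable def xx (n i M T : ℕ) : ℝ := ph n (i+2) M T X
noncomputable def aa (n i M T : ℕ) : ℝ := al i ((M:ℝ) / ((i+2) * n)) ((T:ℝ) / n)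
noncomputable def zz (n i M T : ℕ) : ℝ := 1 + Kh n i M (T+1) - Kh n i M T

lemma rk_le {n : ℕ} (W : Sub n) : rk W ≤ n := by
  unfold rk
  have := Submodule.finrank_le W
  simp at this
  exact_mod_cast this

include hn

lemma HH_T (M T : ℕ) : HH n i M (T+1) = HH n i M T - (1 - xx n i M T) := by
  unfold HH xx
  rw [← ph_P 1, pow_one]
  have hA := ph_av (k := i+2) (by omega) hn M T
  have h1 : P n rk = fun W => (rk W - X W) + 1 := by ext W; rw [P_rk hn]; ring
  rw [h1]
  unfold ph
  rw [hA.add_const (fun W => rk W - X W), Av.sub _ rk X]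
  ring

lemma HH_M (M T : ℕ) : HH n i (M+1) T =
    HH n i M T + (1 / (i+2 : ℝ)) * (-1 + xx n i M T ^ (i+2) + eps n (i+2) M T) := by
  unfold HH xx eps
  rw [← ph_S]
  have hA := ph_av (k := i+2) (by omega) hn M T
  have h1 : S n (i+2) rk = fun W => (rk W - (1 / (i+2:ℝ)) * Y (i+2) W) + (1 / (i+2:ℝ)) := by
    ext W; rw [S_rk _ hn]; push_cast; ring
  rw [h1]
  unfold ph
  rw [hA.add_const (fun W => rk W - (1 / (i+2:ℝ)) * Y (i+2) W),
    Av.sub _ rk (fun W => (1 / (i+2:ℝ)) * Y (i+2) W), Av.smul _ (1 / (i+2:ℝ)) (Y (i+2))]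
  ring

lemma eps_nonneg (M T : ℕ) : 0 ≤ eps n (i+2) M T := by
  unfold eps
  have hA := ph_av (k := i+2) (by omega) hn M T
  have hx := ph_X_mem (k := i+2) (by omega) hn M T
  set x := ph n (i+2) M T X with hxd
  have hpt : ∀ W : Sub n, (((i+1:ℕ) + 1 : ℝ) * x ^ (i+1)) * X W + (-((i+1:ℕ) * x ^ (i+2))) ≤ Y (i+2) W := by
    intro W
    have h1 := X_pow_le (i+2) W
    have h2 := tangent (X_mem hn W).1 hx.1 (i+1)
    have h3 : x ^ (i+2) = x ^ (i+1+1) := rfl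
    have h4 : (X W) ^ (i+2) = (X W) ^ (i+1+1) := rfl
    rw [h3]; rw [h4] at h1
    linarith
  have := hA.mono _ _ hpt ⊥
  rw [hA.add_const (fun W => (((i+1:ℕ) + 1 : ℝ) * x ^ (i+1)) * X W), Av.smul _ _ X] at this
  have e1 : (S n (i + 2) ^ M * P n ^ T) X ⊥ = x := rfl
  rw [e1] at this
  have e2 : ph n (i+2) M T (Y (i+2)) = (S n (i + 2) ^ M * P n ^ T) (Y (i+2)) ⊥ := rfl
  rw [e2]
  have e3 : x ^ (i+2) = x ^ (i+1) * x := pow_succ _ _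
  rw [e3] at this ⊢
  push_cast at this
  linarith

lemma HH_nonneg (M T : ℕ) : 0 ≤ HH n i M T := by
  have hA := ph_av (k := i+2) (by omega) hn M T
  have := hA.mono _ _ (fun W => rk_le W) ⊥
  rw [hA.const] at this
  unfold HH ph; linarith

lemma HH_le_x (M T : ℕ) : HH n i M T ≤ n * (1 - xx n i M T) := by
  have hA := ph_av (k := i+2) (by omega) hn M T
  have := hA.mono (fun W => (n:ℝ) * X W) rk (fun W => by have := nullity_le hn W; linarith) ⊥
  rw [Av.smul _ (n:ℝ) X] at this
  unfold HH xx ph; linarith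

lemma HH_M_le (M T : ℕ) : HH n i (M+1) T ≤ HH n i M T := by
  unfold HH
  rw [← ph_S]
  have hA := ph_av (k := i+2) (by omega) hn M T
  have : ∀ W : Sub n, rk W ≤ S n (i+2) rk W := by
    intro W; rw [S_rk _ hn]
    have hne : Nonempty (Fin n) := ⟨⟨0, hn⟩⟩
    have h1 : Y (i+2) W ≤ 1 := fr_le_one _ _
    have : 0 ≤ (1 / ((i+2:ℕ):ℝ)) * (1 - Y (i+2) W) := mul_nonneg (by positivity) (by linarith)
    linarith
  have := hA.mono _ _ this ⊥
  unfold ph; linarith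

lemma HH_zero (T : ℕ) : HH n i 0 T ≤ n * Real.exp (-((T:ℝ) / n)) := by
  have hn' : (0:ℝ) < n := by exact_mod_cast hn
  induction T with
  | zero =>
    unfold HH ph
    simp [rk]
  | succ T ih =>
    rw [HH_T hn]
    have h1 := HH_le_x (i := i) hn 0 T
    have h0 := HH_nonneg (i := i) hn 0 T
    have h2 : HH n i 0 T / n ≤ 1 - xx n i 0 T := by rw [div_le_iff₀ hn']; linarith
    have h3 : -((T+1:ℕ):ℝ) / n = -((T:ℝ)/n) + (-(1/n)) := by push_cast; field_simp; ring
    rw [← neg_div, h3, Real.exp_add]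
    have h4 := Real.add_one_le_exp (-(1/(n:ℝ)))
    have h5 := mul_le_mul_of_nonneg_left h4 h0
    have h6 := mul_le_mul_of_nonneg_right ih (Real.exp_pos (-(1/(n:ℝ)))).le
    have h7 : HH n i 0 T / n = HH n i 0 T * (1 / n) := by ring
    nlinarith

lemma HH_le (M T : ℕ) : HH n i M T ≤ n * Real.exp (-((T:ℝ) / n)) := by
  induction M with
  | zero => exact HH_zero hn T
  | succ M ih => exact (HH_M_le hn M T).trans ih

lemma aa_mem (M T : ℕ) : 0 ≤ aa n i M T ∧ aa n i M T ≤ 1 := by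
  have := al_spec i (c := (M:ℝ) / ((i+2) * n)) (u := (T:ℝ)/n) (by positivity) (by positivity)
  exact ⟨this.1, this.2.1⟩

lemma zz_ge (M T : ℕ) : aa n i M T ≤ zz n i M T := by
  have hn' : (0:ℝ) < n := by exact_mod_cast hn
  have h := KK_u_ge i (c := (M:ℝ) / ((i+2) * n)) (u := (T:ℝ)/n) (d := 1/n) (by positivity) (by positivity) (by positivity)
  have e : (T:ℝ)/n + 1/n = ((T+1:ℕ):ℝ)/n := by push_cast; ring
  rw [e] at h
  have h2 := mul_le_mul_of_nonneg_left h hn'.le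
  have e2 : (n:ℝ) * (-(1/n) * (1 - aa n i M T)) = -(1 - aa n i M T) := by field_simp
  unfold zz Kh
  unfold aa at *
  rw [e2] at h2
  linarith

lemma zz_le (M T : ℕ) : zz n i M T ≤ aa n i M (T+1) := by
  have hn' : (0:ℝ) < n := by exact_mod_cast hn
  have h := KK_u_le i (c := (M:ℝ) / ((i+2) * n)) (u := (T:ℝ)/n) (d := 1/n) (by positivity) (by positivity) (by positivity)
  have e : (T:ℝ)/n + 1/n = ((T+1:ℕ):ℝ)/n := by push_cast; ring
  rw [e] at h
  have h2 := mul_le_mul_of_nonneg_left h hn'.le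
  have e2 : (n:ℝ) * (-(1/n) * (1 - aa n i M (T+1))) = -(1 - aa n i M (T+1)) := by field_simp
  unfold zz Kh
  unfold aa at *
  rw [e2] at h2
  linarith

lemma Kh_M (M T : ℕ) : (1 / (i+2:ℝ)) * (-1 + aa n i M T ^ (i+2)) ≤ Kh n i (M+1) T - Kh n i M T := by
  have hn' : (0:ℝ) < n := by exact_mod_cast hn
  have h := KK_c i (c := (M:ℝ) / ((i+2) * n)) (u := (T:ℝ)/n) (d := 1 / ((i+2) * n)) (by positivity) (by positivity) (by positivity)
  have e : (M:ℝ) / ((i+2) * n) + 1 / ((i+2) * n) = ((M+1:ℕ):ℝ)/((i+2) * n) := by push_cast; ring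
  rw [e] at h
  have h2 := mul_le_mul_of_nonneg_left h hn'.le
  have e2 : (n:ℝ) * (1 / ((i+2) * n) * (-1 + aa n i M T ^ (i+2))) = (1 / (i+2:ℝ)) * (-1 + aa n i M T ^ (i+2)) := by field_simp
  unfold Kh
  unfold aa at *
  rw [e2] at h2
  linarith

noncomputable def bb (n i M T : ℕ) : ℝ :=
  (1 / (i+2:ℝ)) * ∑ l ∈ Finset.range (i+2), xx n i M T ^ l * zz n i M T ^ (i+2-1-l)

lemma xx_mem (M T : ℕ) : 0 ≤ xx n i M T ∧ xx n i M T ≤ 1 := ph_X_mem (by omega) hn M T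

lemma zz_mem (M T : ℕ) : 0 ≤ zz n i M T ∧ zz n i M T ≤ 1 :=
  ⟨(aa_mem hn M T).1.trans (zz_ge hn M T), (zz_le hn M T).trans (aa_mem hn M (T+1)).2⟩

lemma bb_nonneg (M T : ℕ) : 0 ≤ bb n i M T := by
  have h1 := (xx_mem (i := i) hn M T).1
  have h2 := (zz_mem (i := i) hn M T).1
  unfold bb; positivity

lemma bb_le (M T : ℕ) : bb n i M T ≤ 1 := by
  have h1 := (xx_mem (i := i) hn M T)
  have h2 := (zz_mem (i := i) hn M T)
  unfold bb
  have : ∑ l ∈ Finset.range (i+2), xx n i M T ^ l * zz n i M T ^ (i+2-1-l) ≤ ∑ l ∈ Finset.range (i+2), (1:ℝ) :=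
    Finset.sum_le_sum fun l _ => mul_le_one₀ (pow_le_one₀ h1.1 h1.2) (by have := h2.1; positivity) (pow_le_one₀ h2.1 h2.2)
  simp at this
  rw [one_div, inv_mul_le_iff₀ (by positivity), mul_one]
  exact this

lemma bb_mono (M T : ℕ) : bb n i M T ≤ bb n i M (T+1) := by
  have h1 := (xx_mem (i := i) hn M T).1
  have h2 := (zz_mem (i := i) hn M T).1
  have h3 : xx n i M T ≤ xx n i M (T+1) := ph_X_mono (by omega) hn M T
  have h5 := (xx_mem (i := i) hn M (T+1)).1
  have h4 : zz n i M T ≤ zz n i M (T+1) := (zz_le hn M T).trans (zz_ge hn M (T+1))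
  unfold bb
  gcongr

lemma bb_mul (M T : ℕ) : bb n i M T * (xx n i M T - zz n i M T) =
    (1 / (i+2:ℝ)) * (xx n i M T ^ (i+2) - zz n i M T ^ (i+2)) := by
  unfold bb
  rw [mul_assoc, geom_sum₂_mul]

lemma DD_T (M T : ℕ) : DD n i M (T+1) - DD n i M T = xx n i M T - zz n i M T := by
  unfold DD; rw [HH_T hn]; unfold zz; ring

lemma DD_M (M T : ℕ) : DD n i (M+1) T ≤ DD n i M T + bb n i M T * (DD n i M (T+1) - DD n i M T) +
    (1 / (i+2:ℝ)) * (eps n (i+2) M T + (aa n i M (T+1) ^ (i+2) - aa n i M T ^ (i+2))) := by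
  rw [DD_T hn, bb_mul hn]
  have h1 := Kh_M (i := i) hn M T
  have h2 : zz n i M T ^ (i+2) ≤ aa n i M (T+1) ^ (i+2) :=
    pow_le_pow_left₀ (zz_mem hn M T).1 (zz_le hn M T) _
  have h3 : 0 ≤ (1 / (i+2:ℝ)) * (aa n i M (T+1) ^ (i+2) - zz n i M T ^ (i+2)) :=
    mul_nonneg (by positivity) (by linarith)
  unfold DD
  rw [HH_M hn]
  linarith

lemma DD_pos_step (M Tm : ℕ) : ∑ T ∈ Finset.range Tm, max (DD n i (M+1) T) 0 ≤
    ∑ T ∈ Finset.range Tm, max (DD n i M T) 0 + n * Real.exp (-((Tm:ℝ) / n)) +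
      (1 / (i+2:ℝ)) * (∑ T ∈ Finset.range Tm, eps n (i+2) M T + 1) := by
  have hpt : ∀ T, max (DD n i (M+1) T) 0 ≤ max (DD n i M T) 0 +
      bb n i M T * (max (DD n i M (T+1)) 0 - max (DD n i M T) 0) +
      (1 / (i+2:ℝ)) * (eps n (i+2) M T + (aa n i M (T+1) ^ (i+2) - aa n i M T ^ (i+2))) := by
    intro T
    have b0 := bb_nonneg (i := i) hn M T
    have b1 := bb_le (i := i) hn M T
    have e0 := eps_nonneg (i := i) hn M T
    have a0 : aa n i M T ^ (i+2) ≤ aa n i M (T+1) ^ (i+2) :=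
      pow_le_pow_left₀ (aa_mem hn M T).1 ((zz_ge hn M T).trans (zz_le hn M T)) _
    have e1 : 0 ≤ (1 / (i+2:ℝ)) * (eps n (i+2) M T + (aa n i M (T+1) ^ (i+2) - aa n i M T ^ (i+2))) :=
      mul_nonneg (by positivity) (by linarith)
    have c1 := mul_le_mul_of_nonneg_left (le_max_left (DD n i M T) 0) (by linarith : 0 ≤ 1 - bb n i M T)
    have c2 := mul_le_mul_of_nonneg_left (le_max_left (DD n i M (T+1)) 0) b0
    have c3 := mul_nonneg (by linarith : 0 ≤ 1 - bb n i M T) (le_max_right (DD n i M T) 0)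
    have c4 := mul_nonneg b0 (le_max_right (DD n i M (T+1)) 0)
    apply max_le
    · have := DD_M (i := i) hn M T
      linarith
    · linarith
  refine (Finset.sum_le_sum fun T _ => hpt T).trans ?_
  rw [Finset.sum_add_distrib, Finset.sum_add_distrib, ← Finset.mul_sum, Finset.sum_add_distrib,
    Finset.sum_range_sub (fun T => aa n i M T ^ (i+2))]
  have h1 := abel_sum (bb n i M) (fun T => max (DD n i M T) 0) (bb_nonneg hn M) (bb_mono hn M)
    (fun T => le_max_right _ _) Tm
  have h2 : bb n i M Tm * max (DD n i M Tm) 0 ≤ n * Real.exp (-((Tm:ℝ) / n)) := by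
    have : max (DD n i M Tm) 0 ≤ n * Real.exp (-((Tm:ℝ) / n)) := by
      refine max_le ?_ (by positivity)
      have := HH_le (i := i) hn M Tm
      have hk : 0 ≤ Kh n i M Tm := mul_nonneg (by positivity) (KK_nonneg i (by positivity) (by positivity))
      unfold DD; linarith
    have h3 := mul_le_mul_of_nonneg_right (bb_le (i := i) hn M Tm) (le_max_right (DD n i M Tm) 0)
    linarith
  have h3 : aa n i M Tm ^ (i+2) ≤ 1 := pow_le_one₀ (aa_mem hn M Tm).1 (aa_mem hn M Tm).2
  have h4 : 0 ≤ aa n i M 0 ^ (i+2) := pow_nonneg (aa_mem hn M 0).1 _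
  have h5 : (1 / (i+2:ℝ)) * (∑ T ∈ Finset.range Tm, eps n (i+2) M T + (aa n i M Tm ^ (i+2) - aa n i M 0 ^ (i+2)))
    ≤ (1 / (i+2:ℝ)) * (∑ T ∈ Finset.range Tm, eps n (i+2) M T + 1) := by
    gcongr; linarith
  linarith

lemma DD_zero (T : ℕ) : DD n i 0 T ≤ 0 := by
  have := HH_zero (i := i) hn T
  unfold DD Kh
  simp only [Nat.cast_zero, zero_div]
  rw [KK_zero]; linarith

lemma DD_sum (M Tm s : ℕ) (hs : 0 < s) (M' : ℕ) (hM : M' ≤ M) : ∑ T ∈ Finset.range Tm, max (DD n i M' T) 0 ≤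
    M' * (n * Real.exp (-((Tm:ℝ) / n)) + ((i + 1 : ℝ) + Tm * (2 * Real.sqrt (M + Tm + 1)) / s + 2 * s + 1)) := by
  induction M' with
  | zero =>
    simp only [max_eq_right (DD_zero hn _)]
    simp
  | succ M' ih =>
    have h1 := DD_pos_step (i := i) hn M' Tm
    have h2 := ih (by omega)
    have h3 := sum_eps (j := i+1) hn M' Tm s hs
    have h4 : Real.sqrt (M' + Tm + 1) ≤ Real.sqrt (M + Tm + 1) := by
      apply Real.sqrt_le_sqrt
      have : (M' : ℝ) ≤ M := by exact_mod_cast (by omega : M' ≤ M)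
      linarith
    push_cast at h3 ⊢
    have h5 : (1 / (i+2:ℝ)) * (∑ T ∈ Finset.range Tm, eps n (i+2) M' T + 1) ≤
       (i + 1 : ℝ) + Tm * (2 * Real.sqrt (M + Tm + 1)) / s + 2 * s + 1 := by
      rw [one_div, inv_mul_le_iff₀ (by positivity)]
      have h6 : (i+1+1 : ℝ) * ((i+1) + Tm * (2 * Real.sqrt (M' + Tm + 1)) / s + 2 * s) ≤
        (i+1+1 : ℝ) * ((i+1) + Tm * (2 * Real.sqrt (M + Tm + 1)) / s + 2 * s) := by gcongr
      have : (0:ℝ) ≤ i := by positivity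
      have e : i + 1 + 1 = i + 2 := rfl
      rw [e] at h3
      nlinarith
    linarith

lemma DD_lower (M T : ℕ) : DD n i M 0 - T ≤ DD n i M T := by
  induction T with
  | zero => simp
  | succ T ih =>
    have := DD_T (i := i) hn M T
    have := (xx_mem (i := i) hn M T).1
    have := (zz_mem (i := i) hn M T).2
    push_cast; linarith

lemma DD_sum_lower (M Tm : ℕ) (r : ℝ) (hr : 0 ≤ r) (h : 2 * r ≤ DD n i M 0) (hT : r ≤ Tm) :
    r ^ 2 ≤ ∑ T ∈ Finset.range Tm, max (DD n i M T) 0 := by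
  have hL : ⌈r⌉₊ ≤ Tm := Nat.ceil_le.2 hT
  calc r ^ 2 ≤ ⌈r⌉₊ * r := by
        have := Nat.le_ceil r; nlinarith
    _ = ∑ T ∈ Finset.range ⌈r⌉₊, r := by simp
    _ ≤ ∑ T ∈ Finset.range ⌈r⌉₊, max (DD n i M T) 0 := by
        refine Finset.sum_le_sum fun T hT => ?_
        have h1 := DD_lower (i := i) hn M T
        have h2 : (T:ℝ) < r := Nat.lt_ceil.1 (Finset.mem_range.1 hT)
        exact le_max_of_le_left (by linarith)
    _ ≤ _ := Finset.sum_le_sum_of_subset_of_nonneg (Finset.range_mono hL) fun _ _ _ => le_max_right _ _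
end

lemma small_inv_sqrt (ρ : ℝ) (hρ : 0 < ρ) : ∃ N : ℕ, 0 < N ∧ ∀ n : ℕ, N ≤ n → Real.sqrt n ≤ ρ * n := by
  obtain ⟨N, hN⟩ := exists_nat_gt (1 / ρ ^ 2)
  refine ⟨N + 1, by omega, fun n hn => ?_⟩
  have h1 : (N:ℝ) ≤ n := by exact_mod_cast (by omega : N ≤ n)
  have hn0 : (0:ℝ) < n := by exact_mod_cast (by omega : 0 < n)
  have h2 : 1 / ρ ^ 2 < n := by linarith
  rw [div_lt_iff₀ (by positivity)] at h2
  apply Real.sqrt_le_iff.2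
  constructor
  · positivity
  · nlinarith

theorem DD_small (i : ℕ) (C : ℕ) (hC : 1 ≤ C) (δ : ℝ) (hδ : 0 < δ) :
    ∃ N : ℕ, 0 < N ∧ ∀ n : ℕ, N ≤ n → ∀ M : ℕ, M ≤ C * n → DD n i M 0 ≤ δ * n := by
  have hC' : (1:ℝ) ≤ C := by exact_mod_cast hC
  set κ : ℝ := (δ/2)^2 / (8 * C) with hκ
  have hκ0 : 0 < κ := by positivity
  obtain ⟨A, hA⟩ : ∃ A : ℕ, 1 ≤ A ∧ δ ≤ A ∧ Real.exp (-(A:ℝ)) ≤ κ := by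
    obtain ⟨A, hA⟩ := exists_nat_gt (max (max 1 δ) (-Real.log κ))
    have h1 : (max (max 1 δ) (-Real.log κ)) ≤ A := hA.le
    have h2 := (le_max_left (max 1 δ) (-Real.log κ)).trans h1
    have h3 := (le_max_right (max 1 δ) (-Real.log κ)).trans h1
    refine ⟨A, by exact_mod_cast (le_max_left 1 δ).trans h2, (le_max_right 1 δ).trans h2, ?_⟩
    rw [← Real.le_log_iff_exp_le hκ0]; linarith
  obtain ⟨hA1, hAδ, hAe⟩ := hA
  set B : ℝ := Real.sqrt (C + A + 1) with hB
  have hB0 : 0 ≤ B := Real.sqrt_nonneg _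
  set ρ : ℝ := min (κ^2 / (2 * A * B + 1)) (κ / (i + 4)) with hρ
  have hρ0 : 0 < ρ := by
    apply lt_min <;> positivity
  obtain ⟨N, hN0, hN⟩ := small_inv_sqrt ρ hρ0
  refine ⟨N, hN0, fun n hn M hM => ?_⟩
  have hnp : 0 < n := by omega
  have hn' : (0:ℝ) < n := by exact_mod_cast hnp
  have hn1 : (1:ℝ) ≤ n := by exact_mod_cast hnp
  by_contra hcon
  push Not at hcon
  set s : ℕ := ⌈κ * n⌉₊ with hs
  have hs0 : 0 < s := Nat.ceil_pos.2 (by positivity)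
  have hs1 : κ * n ≤ s := Nat.le_ceil _
  have hs2 : (s:ℝ) < κ * n + 1 := Nat.ceil_lt_add_one (by positivity)
  have h1 := DD_sum (i := i) hnp M (A * n) s hs0 M le_rfl
  have h2 := DD_sum_lower (i := i) hnp M (A * n) (δ/2 * n) (by positivity) (by linarith) (by
    push_cast; nlinarith)
  have hsq := hN n hn
  have hsqrt1 : 1 ≤ Real.sqrt n := by rw [Real.one_le_sqrt]; exact hn1
  have hMC : (M:ℝ) ≤ C * n := by exact_mod_cast hM
  have h3 : Real.sqrt (M + (A * n : ℕ) + 1) ≤ B * Real.sqrt n := by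
    rw [hB, ← Real.sqrt_mul (by positivity)]
    apply Real.sqrt_le_sqrt
    push_cast; nlinarith
  have hr1 : 2 * A * B * Real.sqrt n ≤ κ ^ 2 * n := by
    have : Real.sqrt n ≤ κ^2 / (2 * A * B + 1) * n :=
      hsq.trans (mul_le_mul_of_nonneg_right (min_le_left _ _) hn'.le)
    have h5 : (2 * A * B + 1) * Real.sqrt n ≤ κ ^ 2 * n := by
      rw [div_mul_eq_mul_div, le_div_iff₀ (by positivity)] at this; linarith
    linarith
  have hr2 : (i + 4 : ℝ) ≤ κ * n := by
    have : Real.sqrt n ≤ κ / (i + 4) * n :=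
      hsq.trans (mul_le_mul_of_nonneg_right (min_le_right _ _) hn'.le)
    rw [div_mul_eq_mul_div, le_div_iff₀ (by positivity)] at this
    have : (0:ℝ) ≤ i := by positivity
    nlinarith
  have h4 : ((A * n : ℕ):ℝ) * (2 * Real.sqrt (M + (A * n : ℕ) + 1)) / s ≤ κ * n := by
    rw [div_le_iff₀ (by exact_mod_cast hs0)]
    have : ((A * n : ℕ):ℝ) * (2 * Real.sqrt (M + (A * n : ℕ) + 1)) ≤ (A * n : ℝ) * (2 * (B * Real.sqrt n)) := by
      push_cast at h3 ⊢
      gcongr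
    have h6 : (A * n : ℝ) * (2 * (B * Real.sqrt n)) ≤ κ ^ 2 * n * n := by nlinarith
    have h7 : κ * n * (κ * n) ≤ κ * n * s := by gcongr
    nlinarith
  have h5 : (n:ℝ) * Real.exp (-(((A * n : ℕ):ℝ) / n)) ≤ κ * n := by
    have : ((A * n : ℕ):ℝ) / n = A := by push_cast; field_simp
    rw [this, mul_comm]; gcongr
  have h6 : (M:ℝ) * (n * Real.exp (-(((A * n : ℕ):ℝ) / n)) + ((i + 1 : ℝ) + (A * n : ℕ) * (2 * Real.sqrt (M + (A * n : ℕ) + 1)) / s + 2 * s + 1))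
     ≤ (C * n) * (κ * n + (κ * n + κ * n + 2 * (κ * n))) := by
    refine mul_le_mul hMC ?_ (by positivity) (by positivity)
    linarith
  have h7 : (C * n : ℝ) * (κ * n + (κ * n + κ * n + 2 * (κ * n))) = 5/8 * (δ/2 * n)^2 := by
    rw [hκ]; field_simp; ring
  have h8 : 0 < (δ/2 * n)^2 := by positivity
  linarith

/-- Theorem A -/
theorem thmA {i : ℕ} (hi : 1 ≤ i) {lam : ℝ} (hlam : 0 < lam) (hroot : psi lam = (i + 2 : ℕ)) (δ : ℝ) (hδ : 0 < δ) :
    ∃ N : ℕ, 0 < N ∧ ∀ n : ℕ, N ≤ n → ∀ m : ℕ, (m:ℝ) ≤ gfun (i+2) lam * n →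
      (m:ℝ) - δ * n ≤ (S n (i+2) ^ ((i+2) * m)) rk ⊥ := by
  obtain ⟨C, hC⟩ := exists_nat_gt (gfun (i+2) lam * (i+2))
  obtain ⟨N, hN0, hN⟩ := DD_small i (C+1) (by omega) δ hδ
  refine ⟨N, hN0, fun n hn m hm => ?_⟩
  have hnp : 0 < n := by omega
  have hn' : (0:ℝ) < n := by exact_mod_cast hnp
  have hM : (i+2) * m ≤ (C+1) * n := by
    have : (((i+2) * m : ℕ):ℝ) ≤ ((C+1) * n : ℕ) := by
      push_cast
      have h1 : ((i:ℝ)+2) * m ≤ (i+2) * (gfun (i+2) lam * n) := by gcongr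
      nlinarith
    exact_mod_cast this
  have h := hN n hn _ hM
  unfold DD HH Kh at h
  have e : (((i+2) * m : ℕ):ℝ) / ((i+2) * n) = m / n := by push_cast; field_simp
  rw [e] at h
  have h2 := KK_star hi hlam hroot (c := m / n) (by positivity) (by rw [div_le_iff₀ hn']; exact hm)
  have h3 := mul_le_mul_of_nonneg_left h2 hn'.le
  have e2 : (n:ℝ) * (1 - m / n) = n - m := by field_simp
  have e3 : ph n (i+2) ((i+2)*m) 0 rk = (S n (i+2) ^ ((i+2) * m)) rk ⊥ := by unfold ph; simp
  rw [e3] at h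
  simp only [Nat.cast_zero, zero_div] at h
  linarith

end KX

namespace KX

lemma pow_compare {n : ℕ} {A B : Module.End ℝ (Sub n → ℝ)} (hA : Av 1 A) (hB : Av 1 B) (hc : Commute A B)
    (f : Sub n → ℝ) (c : ℝ) (h : ∀ W, B f W ≤ A f W + c) (N : ℕ) (W : Sub n) :
    (B ^ N) f W ≤ (A ^ N) f W + N * c := by
  induction N generalizing W with
  | zero => simp
  | succ N ih =>
    have h1 := (hB.pow N).mono _ _ h W
    rw [(hB.pow N).add_const (A f)] at h1
    have h2 : (B ^ N) (A f) W = A ((B ^ N) f) W := by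
      rw [← Module.End.mul_apply, ← Module.End.mul_apply, (hc.pow_right N).eq]
    have h3 := hA.mono _ _ ih W
    rw [hA.add_const ((A ^ N) f)] at h3
    rw [pow_succ, pow_succ', Module.End.mul_apply, Module.End.mul_apply]
    rw [h2] at h1
    push_cast; linarith

noncomputable def ZZ {n : ℕ} (W : Sub n) : ℝ := ∑ i : Fin n, ind (∀ w ∈ W, w i = 0)

lemma rk_le_ZZ {n : ℕ} (W : Sub n) : rk W ≤ n - ZZ W := by
  set Q : Fin n → Prop := fun i => ∀ w ∈ W, w i = 0 with hQ
  let φ : W →ₗ[ZMod 2] ({i : Fin n // ¬ Q i} → ZMod 2) :=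
    { toFun := fun w i => (w : V n) i
      map_add' := fun a b => by ext i; simp
      map_smul' := fun a b => by ext i; simp }
  have hφ : Function.Injective φ := by
    intro a b hab
    ext i
    by_cases hi : Q i
    · rw [hi a a.2, hi b b.2]
    · exact congrFun hab ⟨i, hi⟩
  have h1 := LinearMap.finrank_le_finrank_of_injective hφ
  rw [Module.finrank_fintype_fun_eq_card] at h1
  have h2 : (Fintype.card {i : Fin n // ¬ Q i} : ℝ) = n - ZZ W := by
    have h3 := Fintype.card_subtype_compl Q
    have h4 : Fintype.card {i // Q i} ≤ Fintype.card (Fin n) := Fintype.card_subtype_le _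
    have h5 : ZZ W = (Fintype.card {i // Q i} : ℝ) := by
      unfold ZZ ind
      rw [Fintype.card_subtype, Finset.card_filter]
      push_cast
      exact Finset.sum_congr rfl fun i _ => by congr
    rw [h3, Nat.cast_sub h4, h5, Fintype.card_fin]
  unfold rk
  rw [← h2]; exact_mod_cast h1

lemma ZZ_adj {n : ℕ} (W : Sub n) (t : Fin n) : ZZ (adj W (e t)) = ZZ W - ind (∀ w ∈ W, w t = 0) := by
  unfold ZZ
  have : ∀ i : Fin n, ind (∀ w ∈ adj W (e t), w i = 0) =
      ind (∀ w ∈ W, w i = 0) - (if i = t then ind (∀ w ∈ W, w i = 0) else 0) := by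
    intro i
    split_ifs with h
    · subst h
      have : ¬ (∀ w ∈ adj W (e i), w i = 0) := by
        intro h; have := h _ (mem_adj W (e i)); simp [e] at this
      simp [ind, this]
    · have : (∀ w ∈ adj W (e t), w i = 0) ↔ (∀ w ∈ W, w i = 0) := by
        constructor
        · intro h w hw; exact h w (le_adj _ _ hw)
        · intro h' w hw
          unfold adj at hw
          obtain ⟨a, ha, b, hb, rfl⟩ := Submodule.mem_sup.1 hw
          obtain ⟨c, rfl⟩ := Submodule.mem_span_singleton.1 hb
          simp [h' a ha, e, Pi.single_apply, h]
      simp only [this]; ring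
  rw [Finset.sum_congr rfl fun i _ => this i, Finset.sum_sub_distrib]
  simp

lemma ZZ_eig {n : ℕ} (hn : 0 < n) (q : ℝ) : op (mix q (unif (e (n := n)))) ZZ = (1 - q / n) • ZZ := by
  have hne : Nonempty (Fin n) := ⟨⟨0, hn⟩⟩
  have hn' : (0:ℝ) < n := by exact_mod_cast hn
  ext W
  rw [op_mix]
  simp only [LinearMap.add_apply, Pi.add_apply, LinearMap.smul_apply, Pi.smul_apply, smul_eq_mul,
    Module.End.one_apply, op_unif, ZZ_adj]
  rw [avg_sub, avg_const]
  have : avg (fun t : Fin n => ind (∀ w ∈ W, w t = 0)) = ZZ W / n := by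
    unfold avg ZZ; simp
  rw [this]; field_simp; ring

lemma pow_eig {n : ℕ} {A : Module.End ℝ (Sub n → ℝ)} {f : Sub n → ℝ} {r : ℝ} (h : A f = r • f) (N : ℕ) :
    (A ^ N) f = r ^ N • f := by
  induction N with
  | zero => simp
  | succ N ih => rw [pow_succ, Module.End.mul_apply, h, map_smul, ih, smul_smul, pow_succ']

lemma ZZ_bot {n : ℕ} : ZZ (⊥ : Sub n) = n := by
  unfold ZZ ind; simp

lemma thmB_aux {n : ℕ} (hn : 0 < n) (i : ℕ) {a : ℝ} (ha0 : 0 ≤ a) (ha1 : a ≤ 1) (N : ℕ) :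
    (S n (i+2) ^ N) rk ⊥ ≤ n - n * (1 - a ^ (i+1) / n) ^ N +
      N * ((1 / (i+2:ℝ)) * (1 + (i+1) * a ^ (i+2)) - a ^ (i+1)) := by
  have hne : Nonempty (Fin n) := ⟨⟨0, hn⟩⟩
  set q := a ^ (i+1) with hq
  have hq0 : 0 ≤ q := by positivity
  have hq1 : q ≤ 1 := pow_le_one₀ ha0 ha1
  have hA : Av 1 (op (mix q (unif (e (n := n))))) := Av.op (mix_prob hq0 hq1 (unif_prob _))
  have h := pow_compare hA (S_av (i+2) (by omega) hn) (op_comm _ _) rk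
    ((1 / (i+2:ℝ)) * (1 + (i+1) * a ^ (i+2)) - q) (fun W => by
      rw [S_rk _ hn, mix_rk]
      have h1 := X_pow_le (i+2) W
      have h2 := tangent (X_mem hn W).1 ha0 (i+1)
      have h3 : (i+2:ℝ) * q * X W - (i+1) * a ^ (i+2) ≤ Y (i+2) W := by
        push_cast at h2
        have : X W ^ (i+1+1) = X W ^ (i+2) := rfl
        have : a ^ (i+1+1) = a ^ (i+2) := rfl
        have : (i:ℝ)+1+1 = i+2 := by ring
        simp only [*] at *
        linarith
      have h4 := mul_le_mul_of_nonneg_left h3 (by positivity : (0:ℝ) ≤ 1 / (i+2:ℝ))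
      have h5 : (1 / (i+2:ℝ)) * ((i+2:ℝ) * q * X W - (i+1) * a ^ (i+2)) = q * X W - (1 / (i+2:ℝ)) * ((i+1) * a ^ (i+2)) := by
        field_simp
      push_cast
      linarith) N ⊥
  have h2 := (hA.pow N).mono _ _ (fun W => rk_le_ZZ W) ⊥
  have h3 : (fun W : Sub n => (n:ℝ) - ZZ W) = fun W => (-1) * ZZ W + n := by ext; ring
  rw [h3, (hA.pow N).add_const (fun W => (-1) * ZZ W), Av.smul _ (-1) ZZ, pow_eig (ZZ_eig hn q)] at h2
  simp only [Pi.smul_apply, smul_eq_mul, ZZ_bot] at h2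
  linarith

/-- Theorem B -/
theorem thmB {i : ℕ} (hi : 1 ≤ i) {lam : ℝ} (hlam : 0 < lam) (hroot : psi lam = (i + 2 : ℕ)) {n : ℕ} (hn : 0 < n)
    (m : ℕ) : (S n (i+2) ^ ((i+2) * m)) rk ⊥ ≤
      m - (m - gfun (i+2) lam * n) * (1 - Real.exp (-lam)) ^ (i+2) + (i+2) * m / n := by
  obtain ⟨ha0, ha1⟩ := als_mem hlam hroot
  have hn' : (0:ℝ) < n := by exact_mod_cast hn
  have hn1 : (1:ℝ) ≤ n := by exact_mod_cast hn
  have hB := thmB_aux hn i ha0.le ha1.le ((i+2) * m)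
  have hP := Phi0_ge (k := i+2) (by omega) hlam hroot (m / n)
  set a := 1 - Real.exp (-lam) with ha
  set q := a ^ (i+1) with hq
  have hq0 : 0 ≤ q := by positivity
  have hq1 : q ≤ 1 := pow_le_one₀ ha0.le ha1.le
  have e1 : a ^ (i + 2 - 1) = q := rfl
  rw [e1] at hP
  have hx1 : q / n ≤ 1 := by rw [div_le_one hn']; linarith
  have hx0 : 0 ≤ q / n := by positivity
  have h1 : Real.exp (-(q/n)) - (1 - q/n) ≤ (q/n)^2 := by
    have := Real.abs_exp_sub_one_sub_id_le (x := -(q/n)) (by rw [abs_neg, abs_of_nonneg hx0]; exact hx1)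
    have := (abs_le.1 this).2
    nlinarith
  have h1' : 0 ≤ Real.exp (-(q/n)) - (1 - q/n) := by
    have := Real.add_one_le_exp (-(q/n)); linarith
  have h2 := pow_sub_le (x := Real.exp (-(q/n))) (y := 1 - q/n) (Real.exp_pos _).le
    (by rw [Real.exp_le_one_iff]; linarith) (by linarith) (by linarith) ((i+2)*m)
  rw [abs_of_nonneg h1', ← Real.exp_nat_mul] at h2
  have e2 : (((i+2) * m : ℕ):ℝ) * -(q/n) = -((m:ℝ)/n * ((i+2:ℕ):ℝ) * q) := by push_cast; ring
  rw [e2] at h2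
  set E := Real.exp (-((m:ℝ)/n * ((i+2:ℕ):ℝ) * q)) with hE
  have h3 : (((i+2) * m : ℕ):ℝ) * (Real.exp (-(q/n)) - (1 - q/n)) ≤ (i+2) * m / n * (1/n) := by
    have : (((i+2) * m : ℕ):ℝ) * (Real.exp (-(q/n)) - (1 - q/n)) ≤ (((i+2) * m : ℕ):ℝ) * (1/n)^2 := by
      refine mul_le_mul_of_nonneg_left (h1.trans ?_) (by positivity)
      gcongr
    refine this.trans (le_of_eq ?_)
    push_cast; ring
  have h4 := mul_le_mul_of_nonneg_left (h2.trans h3) hn'.le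
  have e3 : (n:ℝ) * ((i+2) * m / n * (1/n)) = (i+2) * m / n := by field_simp
  rw [e3] at h4
  have h5 := mul_le_mul_of_nonneg_left hP hn'.le
  have e4 : (n:ℝ) * (1 - m/n + (m/n - gfun (i+2) lam) * a ^ (i+2)) = n - m + (m - gfun (i+2) lam * n) * a ^ (i+2) := by
    field_simp
  have e5 : (n:ℝ) * (E - m/n + m/n * ((i+2:ℕ):ℝ) * q - m/n * (((i+2:ℕ):ℝ) - 1) * a^(i+2)) =
     n * E - m + m * (i+2) * q - m * (i+1) * a^(i+2) := by
    push_cast; field_simp; ring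
  rw [e4, e5] at h5
  have e6 : (((i+2) * m : ℕ):ℝ) * ((1 / (i+2:ℝ)) * (1 + (i+1) * a ^ (i+2)) - q) =
     m * (1 + (i+1) * a ^ (i+2)) - (i+2) * m * q := by push_cast; field_simp
  rw [e6] at hB
  linarith

lemma lip_pow {n : ℕ} {μ : V n → ℝ} (hμ : IsProb μ) {f : Sub n → ℝ} (hf : Lip f) (a b : ℕ) (W : Sub n) :
    (op μ ^ a) f W ≤ (op μ ^ (a+b)) f W ∧ (op μ ^ (a+b)) f W ≤ (op μ ^ a) f W + b := by
  induction b with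
  | zero => simp
  | succ b ih =>
    have hl := ((Av.op hμ).pow (a+b)).lip f hf
    have h1 : (op μ ^ (a+(b+1))) f W = ∑ v, μ v * ((op μ ^ (a+b)) f (adj W v)) := by
      rw [← add_assoc, pow_succ', Module.End.mul_apply]; rfl
    have h2 : ∀ c : ℝ, ∑ v, μ v * c = c := fun c => by rw [← Finset.sum_mul, hμ.sum_one, one_mul]
    rw [h1]
    constructor
    · refine ih.1.trans ?_
      rw [← h2 ((op μ ^ (a+b)) f W)]
      exact Finset.sum_le_sum fun v _ => mul_le_mul_of_nonneg_left (hl W v).1 (hμ.nonneg v)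
    · have : ∑ v, μ v * ((op μ ^ (a+b)) f (adj W v)) ≤ (op μ ^ (a+b)) f W + 1 := by
        rw [← h2 ((op μ ^ (a+b)) f W + 1)]
        exact Finset.sum_le_sum fun v _ => mul_le_mul_of_nonneg_left (hl W v).2 (hμ.nonneg v)
      push_cast; linarith [ih.2]

lemma lip_pow_abs {n : ℕ} {μ : V n → ℝ} (hμ : IsProb μ) {f : Sub n → ℝ} (hf : Lip f) (a b : ℕ) (W : Sub n) :
    |(op μ ^ a) f W - (op μ ^ b) f W| ≤ |(b:ℝ) - a| := by
  rcases le_total a b with h | h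
  · obtain ⟨d, rfl⟩ := Nat.exists_eq_add_of_le h
    have := lip_pow hμ hf a d W
    rw [abs_le]; push_cast
    rw [show (a:ℝ) + d - a = d by ring, abs_of_nonneg (by positivity)]
    constructor <;> linarith [(by positivity : (0:ℝ) ≤ d)]
  · obtain ⟨d, rfl⟩ := Nat.exists_eq_add_of_le h
    have := lip_pow hμ hf b d W
    rw [abs_le]; push_cast
    rw [show (b:ℝ) - (b + d) = -d by ring, abs_neg, abs_of_nonneg (by positivity)]
    constructor <;> linarith [(by positivity : (0:ℝ) ≤ d)]

lemma binom_transfer {n : ℕ} {μ : V n → ℝ} (hμ : IsProb μ) {f : Sub n → ℝ} (hf : Lip f) (k m : ℕ) (hk : 1 ≤ k)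
    (W : Sub n) : |(op (mix (1/(k:ℝ)) μ) ^ (k * m)) f W - (op μ ^ m) f W| ≤ Real.sqrt (m + 1) := by
  have hk1 : (1:ℝ) ≤ k := by exact_mod_cast hk
  set p : ℝ := 1 / k with hp
  have hp0 : 0 ≤ p := by positivity
  have hp1 : p ≤ 1 := by rw [hp, div_le_one] <;> linarith
  set N := k * m with hN
  set w : ℕ → ℝ := fun ν => (bernsteinPolynomial ℝ N ν).eval p with hw
  have hwe : ∀ ν, w ν = N.choose ν * p ^ ν * (1 - p) ^ (N - ν) := by
    intro ν; simp [hw, bernsteinPolynomial]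
  have hw0 : ∀ ν, 0 ≤ w ν := by
    intro ν; rw [hwe]
    have : 0 ≤ 1 - p := by linarith
    positivity
  have hsum : ∑ ν ∈ Finset.range (N+1), w ν = 1 := by
    have := congrArg (Polynomial.eval p) (bernsteinPolynomial.sum ℝ N)
    rw [Polynomial.eval_finset_sum] at this
    simpa using this
  have hNp : (N:ℝ) * p = m := by rw [hN, hp]; push_cast; field_simp
  have hvar : ∑ ν ∈ Finset.range (N+1), ((m:ℝ) - ν)^2 * w ν = m * (1 - p) := by
    have := congrArg (Polynomial.eval p) (bernsteinPolynomial.variance ℝ N)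
    rw [Polynomial.eval_finset_sum] at this
    simp only [Polynomial.eval_mul, Polynomial.eval_pow, Polynomial.eval_sub, Polynomial.eval_smul,
      Polynomial.eval_X, Polynomial.eval_natCast, Polynomial.eval_one, nsmul_eq_mul, hNp] at this
    exact this
  have hexp : (op (mix p μ) ^ N) f W = ∑ ν ∈ Finset.range (N+1), w ν * (op μ ^ ν) f W := by
    have hc : Commute (p • op μ) ((1-p) • (1 : Module.End ℝ (Sub n → ℝ))) :=
      ((Commute.one_right (op μ)).smul_right (1-p)).smul_left p
    rw [op_mix, hc.add_pow]
    simp only [LinearMap.sum_apply, Finset.sum_apply]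
    refine Finset.sum_congr rfl fun ν _ => ?_
    rw [hwe, smul_pow, smul_pow, one_pow]
    have : p ^ ν • op μ ^ ν * (1 - p) ^ (N - ν) • (1 : Module.End ℝ (Sub n → ℝ)) * ((N.choose ν : ℕ) : Module.End ℝ (Sub n → ℝ))
      = ((N.choose ν : ℝ) * p ^ ν * (1 - p) ^ (N - ν)) • op μ ^ ν := by
      rw [← nsmul_one, ← Nat.cast_smul_eq_nsmul ℝ]
      simp only [smul_mul_assoc, mul_smul_comm, mul_one, smul_smul]
      congr 1; ring
    rw [this]; rfl
  have hm : (op μ ^ m) f W = ∑ ν ∈ Finset.range (N+1), w ν * (op μ ^ m) f W := by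
    rw [← Finset.sum_mul, hsum, one_mul]
  rw [hexp, hm, ← Finset.sum_sub_distrib]
  refine (Finset.abs_sum_le_sum_abs _ _).trans ?_
  set c := Real.sqrt (m + 1) with hc
  have hc0 : 0 < c := Real.sqrt_pos.2 (by positivity)
  have hcs : c ^ 2 = m + 1 := Real.sq_sqrt (by positivity)
  have hpt : ∀ ν ∈ Finset.range (N+1), |w ν * (op μ ^ ν) f W - w ν * (op μ ^ m) f W| ≤
      (1/(2*c)) * (((m:ℝ) - ν)^2 * w ν) + c / 2 * w ν := by
    intro ν _
    rw [← mul_sub, abs_mul, abs_of_nonneg (hw0 ν)]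
    have h1 := lip_pow_abs hμ hf ν m W
    have h2 : |(m:ℝ) - ν| ≤ (1/(2*c)) * ((m:ℝ) - ν)^2 + c / 2 := by
      rw [← sq_abs ((m:ℝ) - ν)]
      have : (1 / (2 * c)) * |(m:ℝ) - ν| ^ 2 + c / 2 - |(m:ℝ) - ν| = (|(m:ℝ) - ν| - c) ^ 2 / (2 * c) := by
        field_simp; ring
      have h2 : 0 ≤ (|(m:ℝ) - ν| - c) ^ 2 / (2 * c) := by positivity
      linarith
    have := mul_le_mul_of_nonneg_left (h1.trans h2) (hw0 ν)
    linarith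
  refine (Finset.sum_le_sum hpt).trans ?_
  rw [Finset.sum_add_distrib, ← Finset.mul_sum, ← Finset.mul_sum, hsum, hvar]
  have h4 : (1 / (2 * c)) * ((m:ℝ) * (1 - p)) ≤ (1 / (2 * c)) * (m + 1) := by
    gcongr; nlinarith [(by positivity : (0:ℝ) ≤ m)]
  have h5 : (1 / (2 * c)) * ((m : ℝ) + 1) = c / 2 := by rw [← hcs]; field_simp
  linarith

end KX

namespace KX

abbrev IU (n k : ℕ) := {v : V n // (Finset.univ.filter (fun j : Fin n => v j = 1)).card = k}
noncomputable abbrev U (n k : ℕ) : Module.End ℝ (Sub n → ℝ) :=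
  op (unif (fun v : IU n k => (v : V n)))

lemma IU_card (n k : ℕ) : n.choose k ≤ Fintype.card (IU n k) := by
  have h0 : n.choose k = Fintype.card (Finset.powersetCard k (Finset.univ : Finset (Fin n))) := by
    rw [Fintype.card_coe, Finset.card_powersetCard, Finset.card_fin]
  rw [h0]
  refine Fintype.card_le_of_injective (fun s : Finset.powersetCard k (Finset.univ : Finset (Fin n)) =>
    (⟨fun j => if j ∈ s.1 then 1 else 0, by
      have := (Finset.mem_powersetCard.1 s.2).2
      simpa using this⟩ : IU n k)) ?_
  intro s t h
  simp only [Subtype.mk.injEq] at h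
  ext j
  have := congrFun h j
  by_cases h1 : j ∈ s.1 <;> by_cases h2 : j ∈ t.1 <;> simp_all

noncomputable def pU (n k : ℕ) : ℝ := (k.factorial : ℝ) * Fintype.card (IU n k) / (n:ℝ) ^ k

lemma IU_nonempty {n k : ℕ} (h : k ≤ n) : Nonempty (IU n k) := by
  rw [← Fintype.card_pos_iff]
  exact (Nat.choose_pos h).trans_le (IU_card n k)

lemma pU_ge {n k : ℕ} (hn : 0 < n) (h : k ≤ n) : 1 - (k:ℝ)^2 / n ≤ pU n k := by
  have hn' : (0:ℝ) < n := by exact_mod_cast hn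
  have h1 : ((n:ℝ) - k) ^ k ≤ (k.factorial : ℝ) * Fintype.card (IU n k) := by
    have h2 := Nat.pow_sub_le_descFactorial n k
    rw [Nat.descFactorial_eq_factorial_mul_choose] at h2
    have h3 := h2.trans (Nat.mul_le_mul_left k.factorial (IU_card n k))
    have h4 : (n - k) ^ k ≤ (n + 1 - k) ^ k := Nat.pow_le_pow_left (by omega) k
    have h5 := h4.trans h3
    have h6 : (((n - k : ℕ) : ℝ)) ^ k ≤ (k.factorial : ℝ) * Fintype.card (IU n k) := by exact_mod_cast h5
    rwa [Nat.cast_sub h] at h6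
  have hkn : (k:ℝ) ≤ n := by exact_mod_cast h
  have h7 : 1 + (k:ℝ) * (-(k/n)) ≤ (1 + (-((k:ℝ)/n))) ^ k := by
    apply one_add_mul_le_pow
    have : (k:ℝ)/n ≤ 1 := by rw [div_le_one hn']; exact hkn
    linarith
  unfold pU
  rw [le_div_iff₀ (by positivity)]
  refine le_trans ?_ h1
  have h8 : ((n:ℝ) - k)^k = (1 + (-((k:ℝ)/n))) ^ k * n^k := by
    rw [← mul_pow]; congr 1; field_simp; ring
  rw [h8]
  gcongr
  refine le_trans (le_of_eq ?_) h7
  ring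

lemma rowv_equiv {n k : ℕ} (v : IU n k) (σ : Fin k ≃ {x // v.1 x = 1}) :
    rowv k (fun j => (σ j).1) = v.1 := by
  unfold rowv
  rw [Equiv.sum_comp σ (fun x => e x.1)]
  ext x
  rw [Finset.sum_apply]
  simp only [e, Pi.single_apply]
  by_cases hx : v.1 x = 1
  · rw [Finset.sum_eq_single (⟨x, hx⟩ : {x // v.1 x = 1})]
    · simp [hx]
    · intro b _ hb
      rw [if_neg]; rintro rfl; exact hb rfl
    · simp
  · have : v.1 x = 0 := by
      have : ∀ a : ZMod 2, a ≠ 1 → a = 0 := by decide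
      exact this _ hx
    rw [this]
    apply Finset.sum_eq_zero
    intro b _
    rw [if_neg]; rintro rfl; exact hx b.2

lemma U_le_R {n k : ℕ} (hn : 0 < n) (h : k ≤ n) (g : V n → ℝ) (hg : ∀ v, 0 ≤ g v) :
    pU n k * avg (fun v : IU n k => g v) ≤ avg (fun t => g (rowv k t)) := by
  have := IU_nonempty h
  have hn' : (0:ℝ) < n := by exact_mod_cast hn
  have hc : (0:ℝ) < Fintype.card (IU n k) := by exact_mod_cast Fintype.card_pos
  have h1 : pU n k * avg (fun v : IU n k => g v) = (k.factorial * ∑ v : IU n k, g v) / n^k := by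
    unfold pU avg; field_simp
  rw [h1]
  unfold avg
  rw [Fintype.card_fun, Fintype.card_fin, Fintype.card_fin]
  push_cast
  gcongr
  let F : (Σ v : IU n k, (Fin k ≃ {x // v.1 x = 1})) → (Fin k → Fin n) := fun p j => (p.2 j).1
  have hF : Function.Injective F := by
    rintro ⟨v, σ⟩ ⟨w, τ⟩ hvw
    have h2 : v = w := by
      apply Subtype.ext
      rw [← rowv_equiv v σ, ← rowv_equiv w τ]
      exact congrArg _ hvw
    subst h2
    congr
    ext j
    exact congrArg _ (congrFun hvw j)
  have h3 : (k.factorial : ℝ) * ∑ v : IU n k, g v = ∑ p : (Σ v : IU n k, (Fin k ≃ {x // v.1 x = 1})), g (rowv k (F p)) := by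
    rw [Fintype.sum_sigma, Finset.mul_sum]
    refine Finset.sum_congr rfl fun v _ => ?_
    have h4 : ∀ σ : (Fin k ≃ {x // v.1 x = 1}), g (rowv k (F ⟨v, σ⟩)) = g v := fun σ => by
      rw [← rowv_equiv v σ]
    simp only [h4]
    have h5 : Fintype.card (Fin k) = Fintype.card {x // v.1 x = 1} := by
      rw [Fintype.card_fin, Fintype.card_subtype, v.2]
    rw [Finset.sum_const, Finset.card_univ, Fintype.card_equiv (Fintype.equivOfCardEq h5), Fintype.card_fin, nsmul_eq_mul]
  rw [h3, ← Finset.sum_image (f := fun t => g (rowv k t)) (fun a _ b _ hab => hF hab)]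
  exact Finset.sum_le_univ_sum_of_nonneg fun t => hg _

lemma U_av {n k : ℕ} (h : k ≤ n) : Av 1 (U n k) := by
  have := IU_nonempty h
  exact Av.op (unif_prob _)

lemma avg_nonneg {ι : Type*} [Fintype ι] {f : ι → ℝ} (h : ∀ i, 0 ≤ f i) : 0 ≤ avg f := by
  unfold avg; exact div_nonneg (Finset.sum_nonneg fun i _ => h i) (by positivity)

lemma U_le_two {n k : ℕ} (hn : 0 < n) (h : k ≤ n) (h2 : 2 * k^2 ≤ n) (g : V n → ℝ) (hg : ∀ v, 0 ≤ g v) :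
    avg (fun v : IU n k => g v) ≤ 2 * avg (fun t => g (rowv k t)) := by
  have h1 := U_le_R hn h g hg
  have h3 := pU_ge hn h
  have hn' : (0:ℝ) < n := by exact_mod_cast hn
  have h4 : (k:ℝ)^2/n ≤ 1/2 := by
    rw [div_le_div_iff₀ hn' (by norm_num)]
    have : (2:ℝ) * k^2 ≤ n := by exact_mod_cast h2
    linarith
  have h5 : 0 ≤ avg (fun v : IU n k => g v) := avg_nonneg fun v => hg _
  nlinarith

lemma R_sub_U {n k : ℕ} (hn : 0 < n) (h : k ≤ n) {f : Sub n → ℝ} (hf : Lip f) (W : Sub n) :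
    |R n k f W - U n k f W| ≤ (k:ℝ)^2 / n := by
  have i1 := IU_nonempty h
  have : Nonempty (Fin n) := ⟨⟨0, hn⟩⟩
  rw [op_unif, op_unif]
  have h1 := U_le_R hn h (fun v => f (adj W v) - f W) (fun v => by linarith [(hf W v).1])
  have h2 := U_le_R hn h (fun v => f W + 1 - f (adj W v)) (fun v => by linarith [(hf W v).2])
  rw [avg_sub, avg_sub, avg_const, avg_const] at h1
  rw [avg_sub, avg_sub, avg_const, avg_const] at h2
  have h3 := pU_ge hn h
  have h4 : avg (fun i : IU n k => f W) ≤ avg (fun i : IU n k => f (adj W i)) :=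
    avg_mono fun i => (hf W i).1
  have h5 : avg (fun i : IU n k => f (adj W i)) ≤ avg (fun i : IU n k => f W + 1) :=
    avg_mono fun i => (hf W i).2
  rw [avg_const] at h4 h5
  have h6 : pU n k ≤ 1 := by
    have := U_le_R hn h (fun v => 1) (fun v => by norm_num)
    rw [avg_const, avg_const] at this; linarith
  rw [abs_le]
  constructor <;> nlinarith

lemma Av.abs_le {n N : ℕ} {A : Module.End ℝ (Sub n → ℝ)} (hA : Av N A) (f g : Sub n → ℝ) (c : ℝ)
    (h : ∀ W, |f W - g W| ≤ c) (W : Sub n) : |A f W - A g W| ≤ c := by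
  have h1 := hA.mono f (fun W => g W + c) (fun W => by linarith [(_root_.abs_le.1 (h W)).2]) W
  have h2 := hA.mono g (fun W => f W + c) (fun W => by linarith [(_root_.abs_le.1 (h W)).1]) W
  rw [hA.add_const] at h1 h2
  rw [_root_.abs_le]; constructor <;> linarith

lemma R_pow_sub_U_pow {n k : ℕ} (hn : 0 < n) (h : k ≤ n) {f : Sub n → ℝ} (hf : Lip f) (m : ℕ) (W : Sub n) :
    |(R n k ^ m) f W - (U n k ^ m) f W| ≤ m * ((k:ℝ)^2 / n) := by
  induction m generalizing W with
  | zero => simp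
  | succ m ih =>
    rw [pow_succ', pow_succ', Module.End.mul_apply, Module.End.mul_apply]
    have h1 := (R_av k hn).abs_le _ _ _ ih W
    have h2 := R_sub_U hn h (((U_av h).pow m).lip f hf) W
    have h3 := abs_add_le (R n k ((R n k ^ m) f) W - R n k ((U n k ^ m) f) W) (R n k ((U n k ^ m) f) W - U n k ((U n k ^ m) f) W)
    rw [sub_add_sub_cancel] at h3
    push_cast; linarith

end KX

namespace KX

lemma card_sat {m n : ℕ} (A : Matrix (Fin m) (Fin n) (ZMod 2)) :
    (Finset.univ.filter (fun b : Fin m → ZMod 2 => ∃ x, A.mulVec x = b)).card =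
      2 ^ Module.finrank (ZMod 2) (Submodule.span (ZMod 2) (Set.range A.row)) := by
  rw [← Matrix.rank_eq_finrank_span_row]
  unfold Matrix.rank
  rw [← Fintype.card_subtype]
  have h := Module.card_eq_pow_finrank (K := ZMod 2) (V := LinearMap.range A.mulVecLin)
  rw [ZMod.card] at h
  rw [← h]
  refine Fintype.card_congr (Equiv.subtypeEquivRight fun b => ?_)
  simp [LinearMap.mem_range]

lemma uS_sum {k m n : ℕ} (F : Matrix (Fin m) (Fin n) (ZMod 2) → ℝ) :
    ∑ A ∈ unconstrainedSet k m n, F A =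
      ∑ t : Fin m → IU n k, F (Matrix.of (fun i => ((t i : IU n k) : V n))) := by
  have hinj : Function.Injective (fun t : Fin m → IU n k =>
      (Matrix.of (fun i => ((t i : IU n k) : V n)) : Matrix (Fin m) (Fin n) (ZMod 2))) := by
    intro s t h
    ext i j
    exact congrFun (congrFun h i) j
  rw [← Finset.sum_image (f := F) (fun a _ b _ hab => hinj hab)]
  refine Finset.sum_congr ?_ fun _ _ => rfl
  ext A
  simp only [unconstrainedSet, Finset.mem_filter, Finset.mem_univ, true_and, Finset.mem_image]
  constructor
  · intro h
    exact ⟨fun i => ⟨A i, h i⟩, rfl⟩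
  · rintro ⟨t, rfl⟩ i
    exact (t i).2

lemma satProbU_eq (k m n : ℕ) :
    satProbU k m n = (U n k ^ m) (fun W => 2 ^ (Module.finrank (ZMod 2) W) / 2 ^ m) ⊥ := by
  rw [op_unif_pow]
  unfold satProbU avg
  have h1 : (((unconstrainedSet k m n ×ˢ (Finset.univ : Finset (Fin m → ZMod 2))).filter
      (fun p => ∃ x : Fin n → ZMod 2, p.1.mulVec x = p.2)).card : ℝ) =
      ∑ A ∈ unconstrainedSet k m n, (2:ℝ) ^ Module.finrank (ZMod 2) (Submodule.span (ZMod 2) (Set.range A.row)) := by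
    rw [Finset.card_filter, Finset.sum_product]
    push_cast
    refine Finset.sum_congr rfl fun A _ => ?_
    have := card_sat A
    rw [Finset.card_filter] at this
    exact_mod_cast this
  have h2 : ((unconstrainedSet k m n).card : ℝ) = Fintype.card (Fin m → IU n k) := by
    have := uS_sum (k := k) (m := m) (n := n) (fun _ => 1)
    simpa using this
  rw [h1, h2, uS_sum, ← Finset.sum_div, div_div, mul_comm]
  congr 1
  refine Finset.sum_congr rfl fun t _ => ?_
  rw [bot_sup_eq]; rfl

/-- upper bound -/
lemma satProbU_le {k m n L : ℕ} (h : k ≤ n) (d : ℝ) (hd : 0 < d)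
    (hE : (U n k ^ m) rk ⊥ + L + d ≤ m) :
    satProbU k m n ≤ 1 / 2 ^ L + m / d ^ 2 := by
  rw [satProbU_eq]
  have hA := (U_av h).pow m
  set E := (U n k ^ m) rk ⊥ with hE'
  have h0 := hA.mono (fun W => 2 ^ (Module.finrank (ZMod 2) W) / 2 ^ m)
  rw [op_unif_pow]
  have hdv := hA.dev_sq rk_lip ⊥
  rw [← hE', op_unif_pow] at hdv
  have i1 := IU_nonempty h
  have hpt : ∀ t : Fin m → IU n k, (2:ℝ) ^ (Module.finrank (ZMod 2) ((⊥ ⊔ Submodule.span (ZMod 2) (Set.range (fun i => (t i : V n))) : Sub n))) / 2 ^ m ≤ 1 / 2^L + (1 / d^2) * (rk (⊥ ⊔ Submodule.span (ZMod 2) (Set.range (fun i => (t i : V n))) : Sub n) - E)^2 := by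
    intro t
    set W := (⊥ ⊔ Submodule.span (ZMod 2) (Set.range (fun i => (t i : V n))) : Sub n) with hW
    have hle : Module.finrank (ZMod 2) W ≤ m := by
      rw [hW, bot_sup_eq]
      have := finrank_range_le_card (R := ZMod 2) (fun i => (t i : V n))
      rwa [Fintype.card_fin] at this
    by_cases hc : Module.finrank (ZMod 2) W + L ≤ m
    · have : (2:ℝ) ^ (Module.finrank (ZMod 2) W) / 2 ^ m ≤ 1 / 2 ^ L := by
        rw [div_le_div_iff₀ (by positivity) (by positivity), one_mul, ← pow_add]
        exact pow_le_pow_right₀ (by norm_num) hc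
      have : 0 ≤ (1 / d^2) * (rk W - E)^2 := by positivity
      linarith
    · have h1 : (2:ℝ) ^ (Module.finrank (ZMod 2) W) / 2 ^ m ≤ 1 := by
        rw [div_le_one (by positivity)]
        exact pow_le_pow_right₀ (by norm_num) hle
      have h2 : (m:ℝ) ≤ rk W + L := by
        unfold rk; push Not at hc; exact_mod_cast hc.le
      have h3 : d ≤ rk W - E := by linarith
      have h4 : d^2 ≤ (rk W - E)^2 := by gcongr
      have h5 : 1 ≤ (1 / d^2) * (rk W - E)^2 := by
        rw [one_div_mul_eq_div, le_div_iff₀ (by positivity)]; linarith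
      have : (0:ℝ) ≤ 1 / 2^L := by positivity
      linarith
  refine (avg_mono hpt).trans ?_
  rw [avg_add, avg_const, avg_mul_left]
  have : (1/d^2) * avg (fun t : Fin m → IU n k => (rk (⊥ ⊔ Submodule.span (ZMod 2) (Set.range (fun i => (t i : V n))) : Sub n) - E)^2) ≤ (1/d^2) * m := by
    gcongr
  have h9 : (1/d^2) * (m:ℝ) = m / d^2 := by ring
  linarith

lemma one_le_psi_k {k : ℕ} (hk : 3 ≤ k) : ∃ i, 1 ≤ i ∧ k = i + 2 := ⟨k - 2, by omega, by omega⟩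

/-- transfer: S^{km} rk vs U^m rk -/
lemma S_U_transfer {n k : ℕ} (hn : 0 < n) (hk : 1 ≤ k) (h : k ≤ n) (m : ℕ) :
    |(S n k ^ (k * m)) rk ⊥ - (U n k ^ m) rk ⊥| ≤ Real.sqrt (m + 1) + m * ((k:ℝ)^2 / n) := by
  have : Nonempty (Fin n) := ⟨⟨0, hn⟩⟩
  have h1 := binom_transfer (unif_prob (rowv (n := n) k)) (rk_lip (n := n)) k m hk ⊥
  have h2 := R_pow_sub_U_pow hn h (rk_lip (n := n)) m ⊥
  have h3 := abs_add_le ((S n k ^ (k * m)) rk ⊥ - (R n k ^ m) rk ⊥) ((R n k ^ m) rk ⊥ - (U n k ^ m) rk ⊥)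
  rw [sub_add_sub_cancel] at h3
  linarith

end KX

open Filter

namespace KX

lemma ev_sqrt (C D ρ : ℝ) (hC : 0 ≤ C) (hρ : 0 < ρ) :
    ∀ᶠ n : ℕ in atTop, ∀ m : ℕ, (m:ℝ) ≤ C * n → Real.sqrt (m + 1) + D ≤ ρ * n := by
  set η := ρ / (2 * (C + 1)) with hη
  have hη0 : 0 < η := by positivity
  have h1 : ∀ᶠ n : ℕ in atTop, (η + 1 / (4*η) + D) * (2/ρ) ≤ (n:ℝ) :=
    tendsto_natCast_atTop_atTop.eventually_ge_atTop _
  filter_upwards [h1] with n hn m hm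
  have h2 : ∀ x : ℝ, 0 ≤ x → Real.sqrt x ≤ η * x + 1/(4*η) := by
    intro x hx
    have h3 := Real.sq_sqrt hx
    have h4 : η * x + 1/(4*η) - Real.sqrt x = η * (Real.sqrt x - 1/(2*η))^2 := by
      nth_rewrite 1 [← h3]; field_simp; ring
    have : 0 ≤ η * (Real.sqrt x - 1/(2*η))^2 := by positivity
    linarith
  have h5 := h2 (m+1) (by positivity)
  have h6 : η * ((m:ℝ) + 1) ≤ η * (C * n + 1) := by gcongr
  have h7 : η * C ≤ ρ / 2 := by
    rw [hη, div_mul_eq_mul_div, div_le_div_iff₀ (by positivity) (by norm_num)]; nlinarith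
  have h8 : η * C * n ≤ ρ / 2 * n := by gcongr
  have h9 : η + 1 / (4*η) + D ≤ ρ/2 * n := by
    have := mul_le_mul_of_nonneg_left hn (by positivity : 0 ≤ ρ/2)
    have e1 : ρ/2 * ((η + 1 / (4*η) + D) * (2/ρ)) = η + 1 / (4*η) + D := by field_simp
    linarith
  nlinarith

lemma ratio_bounds {m n : ℕ → ℕ} (hn : ∀ j, 0 < n j) {c : ℝ}
    (hc : Tendsto (fun j => (m j : ℝ) / (n j : ℝ)) atTop (nhds c)) {a b : ℝ} (ha : a < c) (hb : c < b) :
    ∀ᶠ j in atTop, a * n j ≤ m j ∧ (m j:ℝ) ≤ b * n j := by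
  filter_upwards [hc.eventually (lt_mem_nhds ha), hc.eventually (gt_mem_nhds hb)] with j h1 h2
  have : (0:ℝ) < n j := by exact_mod_cast hn j
  rw [lt_div_iff₀ this] at h1
  rw [div_lt_iff₀ this] at h2
  exact ⟨h1.le, h2.le⟩

theorem unsat {i : ℕ} (hi : 1 ≤ i) {lam : ℝ} (hlam : 0 < lam) (hroot : psi lam = (i+2 : ℕ))
    (m n : ℕ → ℕ) (hn : ∀ j, 0 < n j) (hntop : Tendsto n atTop atTop) (c : ℝ)
    (hc : Tendsto (fun j => (m j : ℝ) / (n j : ℝ)) atTop (nhds c)) (h : gfun (i+2) lam < c) :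
    Tendsto (fun j => satProbU (i+2) (m j) (n j)) atTop (nhds 0) := by
  have hal := (als_mem hlam hroot).1
  have hcs := c_star_pos (by omega : 3 ≤ i+2) hlam hroot
  set cs := gfun (i+2) lam with hcs'
  set al := 1 - Real.exp (-lam) with hal'
  set k := i + 2 with hk
  set τ := (c - cs)/2 * al^k with hτ
  have hτ0 : 0 < τ := by have : 0 < c - cs := by linarith
                         positivity
  set ρ := τ / 4 with hρ
  have hρ0 : 0 < ρ := by positivity
  have hb : Tendsto (fun n : ℕ => (1:ℝ) / 2 ^ (⌊ρ * (n:ℝ)⌋₊) + (c+1)/(ρ^2) * (1/(n:ℝ))) atTop (nhds 0) := by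
    have h1 : Tendsto (fun n : ℕ => (1:ℝ) / 2 ^ (⌊ρ * (n:ℝ)⌋₊)) atTop (nhds 0) := by
      have h2 : Tendsto (fun n : ℕ => ⌊ρ * (n:ℝ)⌋₊) atTop atTop :=
        tendsto_nat_floor_atTop.comp (tendsto_natCast_atTop_atTop.const_mul_atTop hρ0)
      have h3 := (tendsto_pow_atTop_nhds_zero_of_lt_one (r := (1/2:ℝ)) (by norm_num) (by norm_num)).comp h2
      refine h3.congr fun x => ?_
      simp
    have h4 := (tendsto_one_div_atTop_nhds_zero_nat (𝕜 := ℝ)).const_mul ((c+1)/(ρ^2))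
    simpa using h1.add h4
  have hb' := hb.comp hntop
  refine tendsto_of_tendsto_of_tendsto_of_le_of_le' tendsto_const_nhds hb' ?_ ?_
  · exact Eventually.of_forall fun j => by unfold satProbU; positivity
  have e1 := ratio_bounds hn hc (a := (cs + c)/2) (b := c + 1) (by linarith) (by linarith)
  have e2 := hntop.eventually (ev_sqrt (c+1) ((c+1) * ((k:ℝ)^2 + k)) (2*ρ) (by linarith) (by positivity))
  filter_upwards [e1, e2, hntop.eventually_ge_atTop k] with j h1 h2 h3
  have hn' : (0:ℝ) < n j := by exact_mod_cast hn j
  have hB := thmB hi hlam hroot (hn j) (m j)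
  rw [← hcs', ← hal', ← hk] at hB
  have hT := (abs_le.1 (S_U_transfer (hn j) (by omega : 1 ≤ k) h3 (m j))).1
  have h4 := h2 (m j) h1.2
  have h5 : (m j:ℝ) / n j ≤ c + 1 := by rw [div_le_iff₀ hn']; exact h1.2
  have h6 : (m j : ℝ) * ((k:ℝ)^2/n j) ≤ (c+1) * (k:ℝ)^2 := by
    have : (m j : ℝ) * ((k:ℝ)^2/n j) = m j / n j * (k:ℝ)^2 := by ring
    rw [this]; gcongr
  have h7 : (k:ℝ) * m j / n j ≤ (c+1) * k := by
    have : (k:ℝ) * m j / n j = m j / n j * k := by ring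
    rw [this]; gcongr
  have h8 : τ * n j ≤ (m j - cs * n j) * al^k := by
    have : (c-cs)/2 * n j ≤ m j - cs * n j := by linarith [h1.1]
    calc τ * n j = ((c-cs)/2 * n j) * al^k := by rw [hτ]; ring
      _ ≤ _ := by gcongr
  have hL : (⌊ρ * (n j:ℝ)⌋₊ : ℝ) ≤ ρ * n j := Nat.floor_le (by positivity)
  have hE : (U (n j) k ^ (m j)) rk ⊥ + (⌊ρ * (n j:ℝ)⌋₊ : ℝ) + ρ * n j ≤ m j := by
    have hk' : ((i:ℝ)+2) = (k:ℝ) := by rw [hk]; push_cast; ring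
    try rw [hk'] at hB
    have : τ = 4 * ρ := by rw [hρ]; ring
    rw [this] at h8
    linarith
  refine (satProbU_le h3 (ρ * n j) (by positivity) hE).trans ?_
  simp only [Function.comp]
  gcongr
  rw [div_mul_div_comm, mul_one, div_le_div_iff₀ (by positivity) (by positivity)]
  have := mul_le_mul_of_nonneg_right h1.2 (by positivity : 0 ≤ ρ^2 * n j)
  nlinarith

end KX

namespace KX

noncomputable def q {n : ℕ} (w : ℕ) (u : V n) : ℝ := avg (fun t : Fin w → Fin n => ind (rowv w t = u))

lemma rowv_insertNth {n w : ℕ} (p : Fin (w+1)) (x : Fin n) (t : Fin w → Fin n) :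
    rowv (w+1) (p.insertNth x t : Fin (w+1) → Fin n) = e x + rowv w t := by
  unfold rowv
  rw [Fin.sum_univ_succAbove _ p]
  simp

lemma vneg {n : ℕ} (u : V n) : -u = u := by
  ext i
  have : ∀ a : ZMod 2, -a = a := by decide
  exact this _

lemma vsub {n : ℕ} (u v : V n) : u - v = u + v := by rw [sub_eq_add_neg, vneg]

lemma q_nonneg {n : ℕ} (w : ℕ) (u : V n) : 0 ≤ q w u := avg_nonneg fun _ => ind_nonneg _

lemma q_succ {n : ℕ} (w : ℕ) (u : V n) : q (w+1) u = avg (fun x => q w (u - e x)) := by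
  unfold q
  rw [avg_insertNth 0]
  congr 1; ext x; congr 1; ext t
  rw [rowv_insertNth]
  congr 1
  rw [eq_sub_iff_add_eq, add_comm]

lemma q_add {n : ℕ} (k w : ℕ) (u : V n) :
    avg (fun s : Fin k → Fin n => q w (u - rowv k s)) = q (w + k) u := by
  induction k generalizing u with
  | zero => simp [avg, rowv]
  | succ k ih =>
    rw [avg_insertNth 0, ← add_assoc, q_succ]
    congr 1; ext x
    rw [← ih]
    congr 1; ext s
    rw [rowv_insertNth, sub_sub]

noncomputable def wt {m : ℕ} (g : Fin m → ZMod 2) : ℕ := ∑ i, if g i = 1 then 1 else 0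

lemma dep_le {n k : ℕ} (hn : 0 < n) (h : k ≤ n) (h2 : 2 * k^2 ≤ n) (m : ℕ) (g : Fin m → ZMod 2) (u : V n) :
    avg (fun t : Fin m → IU n k => ind (∑ i, g i • (t i : V n) = u)) ≤ 2 ^ (wt g) * q (k * wt g) u := by
  induction m generalizing u with
  | zero =>
    have hw0 : wt g = 0 := by simp [wt]
    have hw : k * wt g = 0 := by rw [hw0, mul_zero]
    rw [hw, hw0]
    simp [avg, q, rowv]
  | succ m ih =>
    have i1 := IU_nonempty h
    rw [avg_insertNth 0]
    have hw : wt g = (if g 0 = 1 then 1 else 0) + wt (fun i : Fin m => g i.succ) := by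
      unfold wt; rw [Fin.sum_univ_succ]
    have h3 : ∀ (v : IU n k) (t : Fin m → IU n k),
        (∑ i, g i • ((Fin.insertNth (α := fun _ => IU n k) 0 v t i : IU n k) : V n) = u) ↔ (∑ i : Fin m, g i.succ • (t i : V n) = u - g 0 • (v : V n)) := by
      intro v t
      rw [Fin.sum_univ_succ, eq_sub_iff_add_eq, add_comm]
      simp
    simp only [h3]
    have h01 : ∀ a : ZMod 2, a = 0 ∨ a = 1 := by decide
    rcases h01 (g 0) with h0 | h0
    · have := ih (fun i => g i.succ) u
      rw [hw, h0]
      simp only [zero_smul, sub_zero]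
      rw [avg_const]
      simpa using this
    · have h4 := avg_mono (fun v : IU n k => ih (fun i => g i.succ) (u - (v : V n)))
      rw [avg_mul_left] at h4
      have h5 := U_le_two hn h h2 (fun v => q (k * wt (fun i : Fin m => g i.succ)) (u - v)) (fun v => q_nonneg _ _)
      rw [q_add] at h5
      rw [hw, h0]
      simp only [one_smul, if_true]
      refine h4.trans ?_
      rw [mul_add, mul_one, add_comm k, pow_add, pow_one, mul_assoc, mul_left_comm]
      gcongr

lemma q_rec {n : ℕ} (hn : 0 < n) (w : ℕ) : q (w+2) (0 : V n) ≤ ((w+1:ℕ):ℝ)/n * q w (0 : V n) := by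
  have : Nonempty (Fin n) := ⟨⟨0, hn⟩⟩
  have h1 : q (w+2) (0 : V n) ≤ avg (fun x : Fin n => avg (fun t : Fin (w+1) → Fin n =>
      ∑ j, ind (t j = x ∧ e x + rowv (w+1) t = 0))) := by
    unfold q
    rw [avg_insertNth 0]
    refine avg_mono fun x => avg_mono fun t => ?_
    rw [rowv_insertNth]
    by_cases hc : e x + rowv (w+1) t = 0
    · have : ∃ j, t j = x := by
        by_contra hne
        push Not at hne
        have h2 := congrFun hc x
        simp only [rowv, e, Pi.add_apply, Finset.sum_apply, Pi.single_eq_same, Pi.zero_apply] at h2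
        rw [Finset.sum_eq_zero] at h2
        · simp at h2
        · intro j _
          exact Pi.single_eq_of_ne (hne j).symm _
      obtain ⟨j, hj⟩ := this
      have h3 := Finset.single_le_sum (f := fun j => ind (t j = x ∧ e x + rowv (w+1) t = 0)) (fun j _ => ind_nonneg _) (Finset.mem_univ j)
      refine le_trans ?_ h3
      exact ind_mono fun h => ⟨hj, h⟩
    · simp only [ind, hc, if_false]
      exact Finset.sum_nonneg fun j _ => by split_ifs <;> norm_num
  refine h1.trans ?_
  simp only [avg_sum]
  have h4 : ∀ j : Fin (w+1), avg (fun x : Fin n => avg (fun t : Fin (w+1) → Fin n =>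
      ind (t j = x ∧ e x + rowv (w+1) t = 0))) ≤ 1/n * q w (0 : V n) := by
    intro j
    have h5 : ∀ x : Fin n, avg (fun t : Fin (w+1) → Fin n =>
      ind (t j = x ∧ e x + rowv (w+1) t = 0)) ≤ 1/n * q w (0 : V n) := by
      intro x
      rw [avg_insertNth j]
      have h6 : ∀ y : Fin n, avg (fun t : Fin w → Fin n => ind ((j.insertNth y t : Fin (w+1) → Fin n) j = x ∧ e x + rowv (w+1) (j.insertNth y t : Fin (w+1) → Fin n) = 0)) ≤ (if y = x then 1 else 0) * q w (0 : V n) := by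
        intro y
        unfold q
        rw [← avg_mul_left]
        refine avg_mono fun t => ?_
        rw [rowv_insertNth]
        simp only [Fin.insertNth_apply_same]
        by_cases hy : y = x
        · subst hy
          simp only [if_true, one_mul]
          refine ind_mono fun h => ?_
          have h7 := h.2
          rw [← add_assoc, ← vsub (e y), sub_self, zero_add] at h7
          exact h7
        · simp [hy, ind]
      refine (avg_mono h6).trans (le_of_eq ?_)
      unfold avg
      rw [← Finset.sum_mul]
      simp
      ring
    refine (avg_mono h5).trans (le_of_eq ?_)
    rw [avg_const]
  refine (Finset.sum_le_sum fun j _ => h4 j).trans (le_of_eq ?_)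
  simp
  ring

lemma q_bound {n : ℕ} (hn : 0 < n) (w : ℕ) : q w (0 : V n) ^ 2 ≤ ((w:ℝ)/n) ^ w := by
  have hn' : (0:ℝ) < n := by exact_mod_cast hn
  have : Nonempty (Fin n) := ⟨⟨0, hn⟩⟩
  induction w using Nat.strong_induction_on with
  | _ w ih =>
    match w with
    | 0 => simp [q, avg, rowv, ind]
    | 1 =>
      have : q 1 (0 : V n) = 0 := by
        unfold q avg
        rw [Finset.sum_eq_zero, zero_div]
        intro t _
        have : rowv 1 t ≠ 0 := by
          intro h
          have := congrFun h (t 0)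
          simp [rowv, e] at this
        simp [ind, this]
      rw [this]; simp
    | w+2 =>
      have h1 := q_rec hn w
      have h2 := ih w (by omega)
      have h0 := q_nonneg (w+2) (0 : V n)
      calc q (w+2) (0 : V n) ^ 2 ≤ (((w+1:ℕ):ℝ)/n * q w (0 : V n))^2 := by gcongr
        _ = (((w+1:ℕ):ℝ)/n)^2 * q w (0 : V n)^2 := by ring
        _ ≤ (((w+2:ℕ):ℝ)/n)^2 * (((w+2:ℕ):ℝ)/n)^w := by
            gcongr
            · norm_num
            · refine h2.trans ?_
              gcongr; simp
        _ = _ := by rw [pow_add, mul_comm]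

lemma term_bound {n m k s : ℕ} (hn : 0 < n) (hk : 3 ≤ k) (hs : 1 ≤ s) {B D Q : ℝ} (hB : 1 ≤ B)
    (hD : D = 4 * (Real.exp 1)^2 * B^2 * k^3) (hsn : 16 * D * s ≤ n) (hm : (m:ℝ) ≤ B * n) (hQ : 0 ≤ Q)
    (hQ2 : Q^2 ≤ (((k*s:ℕ):ℝ)/n)^(k*s)) :
    (m.choose s : ℝ) * (2^s * Q) ≤ Real.sqrt (D / n) * (1/2)^(s-1) := by
  have hn' : (0:ℝ) < n := by exact_mod_cast hn
  have hs' : (0:ℝ) < s := by exact_mod_cast hs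
  have hk' : (3:ℝ) ≤ k := by exact_mod_cast hk
  have he : 1 ≤ Real.exp 1 := Real.one_le_exp (by norm_num)
  have hDk : (k:ℝ) ≤ D := by
    rw [hD]
    have h1 : 1 ≤ (Real.exp 1)^2 := one_le_pow₀ he
    have h2 : 1 ≤ B^2 := one_le_pow₀ hB
    have h3 : (k:ℝ) ≤ k^3 := le_self_pow₀ (by linarith) (by norm_num)
    have h4 : 1 ≤ 4 * (Real.exp 1)^2 * B^2 := by nlinarith
    nlinarith
  have hD0 : 0 < D := by linarith
  have hks : ((k*s:ℕ):ℝ)/n ≤ 1 := by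
    rw [div_le_one hn']; push_cast; nlinarith
  have hC : (m.choose s : ℝ) ≤ (Real.exp 1 * B * n / s)^s := by
    have h1 := Nat.choose_le_pow_div (α := ℝ) s m
    have h2 := Real.pow_div_factorial_le_exp (s:ℝ) hs'.le s
    have h3 : (m:ℝ)^s / s.factorial = (m/s)^s * ((s:ℝ)^s / s.factorial) := by
      rw [div_pow]; field_simp
    have h4 : Real.exp s = (Real.exp 1)^s := by rw [← Real.exp_nat_mul]; simp
    calc (m.choose s : ℝ) ≤ _ := h1
      _ = (m/s)^s * ((s:ℝ)^s / s.factorial) := h3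
      _ ≤ (B * n/s)^s * (Real.exp 1)^s := by rw [← h4]; gcongr
      _ = _ := by rw [← mul_pow]; congr 1; ring
  have hq3 : Q^2 ≤ (((k*s:ℕ):ℝ)/n)^(3*s) := hQ2.trans
    (pow_le_pow_of_le_one (by positivity) hks (by nlinarith))
  have hx : D * s / n ≤ 1/16 := by rw [div_le_div_iff₀ hn' (by norm_num)]; linarith
  have hsq : ((m.choose s : ℝ) * (2^s * Q))^2 ≤ (D/n) * (1/4)^(s-1) := by
    calc ((m.choose s : ℝ) * (2^s * Q))^2 = (m.choose s : ℝ)^2 * (4^s * Q^2) := by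
          rw [mul_pow, mul_pow, ← pow_mul, mul_comm s 2, pow_mul]; norm_num
      _ ≤ ((Real.exp 1 * B * n / s)^s)^2 * (4^s * (((k*s:ℕ):ℝ)/n)^(3*s)) := by gcongr
      _ = ((Real.exp 1 * B * n / s)^2 * (4 * (((k*s:ℕ):ℝ)/n)^3))^s := by
          rw [mul_pow, mul_pow, pow_mul, ← pow_mul, ← pow_mul, ← pow_mul, mul_comm s 2]
      _ = (D * s / n)^s := by
          congr 1; rw [hD]; push_cast; field_simp
      _ = (D * s / n) * (D * s / n)^(s-1) := by
          rw [← pow_succ']; congr 1; omega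
      _ ≤ (D * s / n) * (1/16)^(s-1) := by gcongr
      _ = (D/n) * (s * ((1/16)^(s-1))) := by ring
      _ ≤ (D/n) * (1/4)^(s-1) := by
          gcongr
          have h5 : (s:ℝ) ≤ 4^(s-1) := by
            have : s - 1 < 4^(s-1) := Nat.lt_pow_self (by norm_num)
            have h6 : s ≤ 4^(s-1) := by omega
            exact_mod_cast h6
          calc (s:ℝ) * (1/16)^(s-1) ≤ 4^(s-1) * (1/16)^(s-1) := by gcongr
            _ = (1/4)^(s-1) := by rw [← mul_pow]; norm_num
  have h7 : (Real.sqrt (D / n) * (1/2)^(s-1))^2 = (D/n) * (1/4)^(s-1) := by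
    rw [mul_pow, Real.sq_sqrt (by positivity), ← pow_mul, mul_comm _ 2, pow_mul]; norm_num
  rw [← h7] at hsq
  exact (le_abs_self _).trans (abs_le_of_sq_le_sq hsq (by positivity))

end KX

namespace KX

noncomputable abbrev frU (n k : ℕ) : Sub n → ℝ := fr (fun v : IU n k => (v : V n))

lemma wt_eq {m : ℕ} (g : Fin m → ZMod 2) : wt g = (Finset.univ.filter (fun i => g i = 1)).card := by
  unfold wt; rw [Finset.card_filter]

lemma wt_sum {m : ℕ} (f : ℕ → ℝ) :
    ∑ g : Fin m → ZMod 2, f (wt g) = ∑ s ∈ Finset.range (m+1), (m.choose s : ℝ) * f s := by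
  have h := Finset.sum_powerset_apply_card f (x := (Finset.univ : Finset (Fin m)))
  rw [Finset.card_fin] at h
  simp only [nsmul_eq_mul] at h
  rw [← h, Finset.powerset_univ]
  refine Finset.sum_nbij' (fun g => Finset.univ.filter (fun i => g i = 1))
    (fun I i => if i ∈ I then 1 else 0) ?_ ?_ ?_ ?_ ?_
  · simp
  · simp
  · intro g _
    ext i
    have : ∀ a : ZMod 2, (if a = 1 then (1 : ZMod 2) else 0) = a := by decide
    simpa using this (g i)
  · intro I _
    ext i; simp
  · intro g _
    rw [wt_eq]

lemma large_avg {n k m0 : ℕ} (p : Fin (m0+1)) :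
    avg (fun t : Fin (m0+1) → IU n k => ind ((t p : V n) ∈ Submodule.span (ZMod 2) (Set.range (fun j => (t (p.succAbove j) : V n))))) =
      (U n k ^ m0) (frU n k) ⊥ := by
  rw [avg_insertNth p, avg_comm, op_unif_pow]
  congr 1; ext t
  unfold frU fr
  congr 1; ext v
  simp

lemma one_sub_le {n k m0 : ℕ} (h : k ≤ n) (hn : 0 < n) (D : ℝ) (hD : 0 < D) (t : Fin (m0+1) → IU n k) :
    1 - (2:ℝ) ^ (Module.finrank (ZMod 2) ((⊥ ⊔ Submodule.span (ZMod 2) (Set.range (fun i => (t i : V n))) : Sub n))) / 2 ^ (m0+1)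
    ≤ (∑ g : Fin (m0+1) → ZMod 2, (if 1 ≤ wt g ∧ 16 * D * wt g ≤ n then 1 else 0) * ind (∑ i, g i • (t i : V n) = 0))
      + (16 * D / n) * ∑ p : Fin (m0+1), ind ((t p : V n) ∈ Submodule.span (ZMod 2) (Set.range (fun j => (t (p.succAbove j) : V n)))) := by
  have hn' : (0:ℝ) < n := by exact_mod_cast hn
  have hA : ∀ g ∈ (Finset.univ : Finset (Fin (m0+1) → ZMod 2)), (0:ℝ) ≤ (if 1 ≤ wt g ∧ 16 * D * wt g ≤ n then 1 else 0) * ind (∑ i, g i • (t i : V n) = 0) := by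
    intro g _
    refine mul_nonneg ?_ (ind_nonneg _)
    split_ifs <;> norm_num
  have hB : 0 ≤ ∑ p : Fin (m0+1), ind ((t p : V n) ∈ Submodule.span (ZMod 2) (Set.range (fun j => (t (p.succAbove j) : V n)))) :=
    Finset.sum_nonneg fun p _ => ind_nonneg _
  have hB' : 0 ≤ (16 * D / n) * ∑ p : Fin (m0+1), ind ((t p : V n) ∈ Submodule.span (ZMod 2) (Set.range (fun j => (t (p.succAbove j) : V n)))) := by positivity
  by_cases hli : LinearIndependent (ZMod 2) (fun i => (t i : V n))
  · have h1 := finrank_span_eq_card hli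
    rw [bot_sup_eq, h1, Fintype.card_fin, div_self (by positivity)]
    have := Finset.sum_nonneg hA
    linarith
  · have hlhs : 1 - (2:ℝ) ^ (Module.finrank (ZMod 2) ((⊥ ⊔ Submodule.span (ZMod 2) (Set.range (fun i => (t i : V n))) : Sub n))) / 2 ^ (m0+1) ≤ 1 := by
      have : (0:ℝ) ≤ (2:ℝ) ^ (Module.finrank (ZMod 2) ((⊥ ⊔ Submodule.span (ZMod 2) (Set.range (fun i => (t i : V n))) : Sub n))) / 2 ^ (m0+1) := by positivity
      linarith
    refine hlhs.trans ?_
    obtain ⟨g, hg, i0, hi0⟩ := Fintype.not_linearIndependent_iff.1 hli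
    have h01 : ∀ a : ZMod 2, a ≠ 0 → a = 1 := by decide
    have hw1 : 1 ≤ wt g := by
      rw [wt_eq]
      exact Finset.card_pos.2 ⟨i0, by simpa using h01 _ hi0⟩
    by_cases hs : 16 * D * wt g ≤ n
    · have := Finset.single_le_sum hA (Finset.mem_univ g)
      rw [if_pos ⟨hw1, hs⟩] at this
      simp only [ind, hg, if_true] at this
      simp only [ind] at hB' ⊢
      linarith
    · push Not at hs
      have h2 : (wt g : ℝ) ≤ ∑ p : Fin (m0+1), ind ((t p : V n) ∈ Submodule.span (ZMod 2) (Set.range (fun j => (t (p.succAbove j) : V n)))) := by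
        unfold wt
        push_cast
        refine Finset.sum_le_sum fun p _ => ?_
        have hi : (if g p = 1 then (1:ℝ) else 0) = ind (g p = 1) := by unfold ind; congr
        rw [hi]
        refine ind_mono fun hp => ?_
        rw [Fin.sum_univ_succAbove _ p, hp, one_smul] at hg
        rw [eq_neg_of_add_eq_zero_left hg]
        refine Submodule.neg_mem _ (Submodule.sum_mem _ fun j _ => Submodule.smul_mem _ _ (Submodule.subset_span ⟨j, rfl⟩))
      have h3 : 1 ≤ (16 * D / n) * wt g := by
        rw [div_mul_eq_mul_div, le_div_iff₀ hn']; linarith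
      have h4 : (16 * D / n) * wt g ≤ (16 * D / n) * ∑ p : Fin (m0+1), ind ((t p : V n) ∈ Submodule.span (ZMod 2) (Set.range (fun j => (t (p.succAbove j) : V n)))) := by gcongr
      have := Finset.sum_nonneg hA
      linarith

lemma sat_lower {n k m0 : ℕ} (hk : 3 ≤ k) (h : 2 * k^2 ≤ n) {B D : ℝ} (hB : 1 ≤ B)
    (hD : D = 4 * (Real.exp 1)^2 * B^2 * k^3) (hm : ((m0+1:ℕ):ℝ) ≤ B * n) :
    1 - satProbU k (m0+1) n ≤ 2 * Real.sqrt (D / n) + 16 * D * B * (U n k ^ m0) (frU n k) ⊥ := by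
  have hkn : k ≤ n := by nlinarith
  have hn : 0 < n := by omega
  have hn' : (0:ℝ) < n := by exact_mod_cast hn
  have hD0 : 0 < D := by rw [hD]; positivity
  have i1 := IU_nonempty hkn
  rw [satProbU_eq, op_unif_pow]
  have h1 := avg_mono (fun t : Fin (m0+1) → IU n k => one_sub_le hkn hn D hD0 t)
  rw [avg_sub, avg_const, avg_add, avg_mul_left, avg_sum, avg_sum] at h1
  simp only [large_avg, avg_mul_left] at h1
  refine h1.trans ?_
  have h2 : (16 * D / n) * ∑ p : Fin (m0+1), (U n k ^ m0) (frU n k) ⊥ ≤ 16 * D * B * (U n k ^ m0) (frU n k) ⊥ := by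
    have hF : 0 ≤ (U n k ^ m0) (frU n k) ⊥ := by
      rw [op_unif_pow]; exact avg_nonneg fun t => fr_nonneg _ _
    rw [Finset.sum_const, Finset.card_fin, nsmul_eq_mul]
    have h3 : ((m0+1:ℕ):ℝ)/n ≤ B := by rw [div_le_iff₀ hn']; exact hm
    calc 16 * D / n * (((m0+1:ℕ):ℝ) * (U n k ^ m0) (frU n k) ⊥) = 16 * D * (((m0+1:ℕ):ℝ)/n) * (U n k ^ m0) (frU n k) ⊥ := by ring
      _ ≤ _ := by gcongr
  have h4 : ∑ g : Fin (m0+1) → ZMod 2, (if 1 ≤ wt g ∧ 16 * D * wt g ≤ n then (1:ℝ) else 0) * avg (fun t : Fin (m0+1) → IU n k => ind (∑ i, g i • (t i : V n) = 0)) ≤ 2 * Real.sqrt (D/n) := by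
    have h5 : ∑ g : Fin (m0+1) → ZMod 2, (if 1 ≤ wt g ∧ 16 * D * wt g ≤ n then (1:ℝ) else 0) * avg (fun t : Fin (m0+1) → IU n k => ind (∑ i, g i • (t i : V n) = 0)) ≤
      ∑ g : Fin (m0+1) → ZMod 2, (fun s : ℕ => (if 1 ≤ s ∧ 16 * D * s ≤ n then (1:ℝ) else 0) * (2 ^ s * q (k * s) (0 : V n))) (wt g) := by
      refine Finset.sum_le_sum fun g _ => ?_
      have := dep_le hn hkn h (m0+1) g 0
      refine mul_le_mul_of_nonneg_left this ?_
      split_ifs <;> norm_num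
    refine h5.trans ?_
    refine (le_of_eq (wt_sum (fun s : ℕ => (if 1 ≤ s ∧ 16 * D * s ≤ n then (1:ℝ) else 0) * (2 ^ s * q (k * s) (0 : V n))))).trans ?_
    rw [Finset.sum_range_succ']
    have h6 : ∀ s ∈ Finset.range (m0+1), ((m0+1).choose (s+1) : ℝ) * ((if 1 ≤ s+1 ∧ 16 * D * ((s+1:ℕ):ℝ) ≤ n then (1:ℝ) else 0) * (2 ^ (s+1) * q (k * (s+1)) (0 : V n))) ≤ Real.sqrt (D/n) * (1/2)^s := by
      intro s _
      split_ifs with hc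
      · have := term_bound (m := m0+1) hn hk hc.1 hB hD hc.2 hm (q_nonneg (k * (s+1)) (0 : V n)) (q_bound hn _)
        simpa using this
      · rw [zero_mul, mul_zero]; positivity
    have h7 := Finset.sum_le_sum h6
    rw [← Finset.mul_sum] at h7
    have h8 := sum_geometric_two_le (m0+1)
    have h9 := mul_le_mul_of_nonneg_left h8 (Real.sqrt_nonneg (D/n))
    have h10 : ((m0+1).choose 0 : ℝ) * ((if 1 ≤ 0 ∧ 16 * D * ((0:ℕ):ℝ) ≤ n then (1:ℝ) else 0) * (2 ^ 0 * q (k * 0) (0 : V n))) = 0 := by simp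
    rw [h10]
    linarith
  linarith

lemma frU_pow_mono {n k : ℕ} (h : k ≤ n) : Monotone (fun j => (U n k ^ j) (frU n k) ⊥) := by
  refine monotone_nat_of_le_succ fun j => ?_
  have := IU_nonempty h
  rw [pow_succ, Module.End.mul_apply]
  refine ((U_av h).pow j).mono _ _ (fun W => ?_) ⊥
  rw [op_unif]
  have h1 := avg_mono (fun v : IU n k => fr_up (fun v : IU n k => (v : V n)) W v)
  rwa [avg_const] at h1

lemma U_pow_rk {n k : ℕ} (h : k ≤ n) (M : ℕ) :
    (U n k ^ M) rk ⊥ = M - ∑ j ∈ Finset.range M, (U n k ^ j) (frU n k) ⊥ := by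
  have := IU_nonempty h
  induction M with
  | zero => simp [rk]
  | succ M ih =>
    rw [Finset.sum_range_succ, pow_succ, Module.End.mul_apply]
    have h1 : U n k rk = fun W => (rk W - frU n k W) + 1 := by
      ext W; rw [op_unif_rk]; ring
    rw [h1, ((U_av h).pow M).add_const, Av.sub, ih]
    push_cast; ring

lemma frU_le {n k : ℕ} (h : k ≤ n) {m0 M : ℕ} (hM : m0 ≤ M) :
    ((M:ℝ) - m0) * (U n k ^ m0) (frU n k) ⊥ ≤ M - (U n k ^ M) rk ⊥ := by
  have h0 : ∀ j, 0 ≤ (U n k ^ j) (frU n k) ⊥ := fun j => by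
    rw [op_unif_pow]; exact avg_nonneg fun t => fr_nonneg _ _
  rw [U_pow_rk h M, ← Finset.sum_range_add_sum_Ico _ hM]
  have h1 : ∑ j ∈ Finset.Ico m0 M, (U n k ^ m0) (frU n k) ⊥ ≤ ∑ j ∈ Finset.Ico m0 M, (U n k ^ j) (frU n k) ⊥ :=
    Finset.sum_le_sum fun j hj => frU_pow_mono h (Finset.mem_Ico.1 hj).1
  rw [Finset.sum_const, Nat.card_Ico, nsmul_eq_mul, Nat.cast_sub hM] at h1
  have h2 : 0 ≤ ∑ j ∈ Finset.range m0, (U n k ^ j) (frU n k) ⊥ := Finset.sum_nonneg fun j _ => h0 j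
  linarith

lemma satProbU_le_one (k m n : ℕ) (h : k ≤ n) : satProbU k m n ≤ 1 := by
  have := IU_nonempty h
  rw [satProbU_eq, op_unif_pow]
  refine (avg_mono (g := fun _ => 1) fun t => ?_).trans (le_of_eq (avg_const _))
  rw [div_le_one (by positivity), bot_sup_eq]
  refine pow_le_pow_right₀ (by norm_num) ?_
  have := finrank_range_le_card (R := ZMod 2) (fun i => (t i : V n))
  rwa [Fintype.card_fin] at this

end KX

namespace KX

theorem sat {i : ℕ} (hi : 1 ≤ i) {lam : ℝ} (hlam : 0 < lam) (hroot : psi lam = (i+2 : ℕ))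
    (m n : ℕ → ℕ) (hm : ∀ j, 0 < m j) (hn : ∀ j, 0 < n j) (hntop : Tendsto n atTop atTop) (c : ℝ)
    (hc : Tendsto (fun j => (m j : ℝ) / (n j : ℝ)) atTop (nhds c)) (h : c < gfun (i+2) lam) :
    Tendsto (fun j => satProbU (i+2) (m j) (n j)) atTop (nhds 1) := by
  have hcs := c_star_pos (by omega : 3 ≤ i+2) hlam hroot
  have hA := thmA hi hlam hroot
  set cs := gfun (i+2) lam with hcs'
  set k := i + 2 with hk
  set B := cs + 1 with hB
  have hB1 : 1 ≤ B := by linarith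
  set D := 4 * (Real.exp 1)^2 * B^2 * (k:ℝ)^3 with hD
  have hD0 : 0 < D := by positivity
  set d := (cs - c)/4 with hd
  have hd0 : 0 < d := by rw [hd]; linarith
  have key : ∀ ε > 0, ∀ᶠ j in atTop, 1 - ε < satProbU k (m j) (n j) := by
    intro ε hε
    set δ := ε * d / (64 * D * B) with hδ
    have hδ0 : 0 < δ := by positivity
    obtain ⟨N, _, hN⟩ := hA δ hδ0
    have e1 := ratio_bounds hn hc (a := c - 1) (b := (c + cs)/2) (by linarith) (by linarith)
    have e2 := hntop.eventually (ev_sqrt cs (cs * (k:ℝ)^2) δ hcs.le hδ0)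
    have e3 : ∀ᶠ j in atTop, 1/d ≤ (n j : ℝ) :=
      (tendsto_natCast_atTop_atTop.comp hntop).eventually_ge_atTop _
    have e4 : ∀ᶠ j in atTop, 2 * Real.sqrt (D / (n j : ℝ)) < ε/2 := by
      have h1 : Tendsto (fun n : ℕ => 2 * Real.sqrt (D / (n:ℝ))) atTop (nhds (2 * Real.sqrt 0)) :=
        ((tendsto_const_div_atTop_nhds_zero_nat D).sqrt).const_mul 2
      rw [Real.sqrt_zero, mul_zero] at h1
      exact (h1.comp hntop).eventually (gt_mem_nhds (by positivity))
    filter_upwards [e1, e2, e3, e4, hntop.eventually_ge_atTop (2 * k^2), hntop.eventually_ge_atTop N]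
      with j h1 h2 h3 h4 h5 h6
    have hkn : k ≤ n j := by nlinarith
    have hn' : (0:ℝ) < n j := by exact_mod_cast hn j
    obtain ⟨m0, hm0⟩ : ∃ m0, m j = m0 + 1 := ⟨m j - 1, by have := hm j; omega⟩
    have hmB : ((m0+1:ℕ):ℝ) ≤ B * n j := by
      rw [← hm0]
      refine h1.2.trans ?_
      gcongr; linarith
    have hS := sat_lower (k := k) (by omega) h5 hB1 hD hmB
    set M := ⌊cs * (n j:ℝ)⌋₊ with hM
    have hM1 : (M:ℝ) ≤ cs * n j := Nat.floor_le (by positivity)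
    have hM2 : cs * n j < M + 1 := Nat.lt_floor_add_one _
    have h7 : 1 ≤ d * n j := by
      have := mul_le_mul_of_nonneg_left h3 hd0.le
      rwa [mul_one_div_cancel hd0.ne'] at this
    have h8 : d * n j ≤ M - m0 := by
      have : (m0:ℝ) + 1 = m j := by rw [hm0]; push_cast; ring
      have h9 : (c + cs)/2 = cs - 2 * d := by rw [hd]; ring
      have h10 := h1.2
      rw [h9] at h10
      nlinarith
    have h9 : m0 ≤ M := by
      have : (m0:ℝ) ≤ M := by nlinarith
      exact_mod_cast this
    have hF := frU_le hkn h9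
    have hT := (abs_le.1 (S_U_transfer (hn j) (by omega : 1 ≤ k) hkn M)).2
    have hAA := hN (n j) h6 M hM1
    have h10 := h2 M hM1
    have h11 : (M : ℝ) * ((k:ℝ)^2/n j) ≤ cs * (k:ℝ)^2 := by
      have h5 : (M:ℝ) / n j ≤ cs := by rw [div_le_iff₀ hn']; exact hM1
      have : (M : ℝ) * ((k:ℝ)^2/n j) = M / n j * (k:ℝ)^2 := by ring
      rw [this]; gcongr
    set F := (U (n j) k ^ m0) (frU (n j) k) ⊥ with hFd
    have hF0 : 0 ≤ F := by
      rw [hFd, op_unif_pow]; exact avg_nonneg fun t => fr_nonneg _ _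
    have h12 : d * n j * F ≤ 2 * δ * n j := by
      have : d * n j * F ≤ (M - m0) * F := by gcongr
      linarith
    have h13 : d * F ≤ 2 * δ := by
      have : (d * F) * n j ≤ (2 * δ) * n j := by linarith
      exact le_of_mul_le_mul_right this hn'
    have h14 : 16 * D * B * F ≤ ε / 2 := by
      have e5 : 16 * D * B * (2 * δ / d) = ε / 2 := by rw [hδ]; field_simp; norm_num
      have e6 : F ≤ 2 * δ / d := by rw [le_div_iff₀ hd0]; linarith
      rw [← e5]; gcongr
    rw [hm0]
    linarith
  rw [tendsto_order]
  constructor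
  · intro a ha
    have := key (1 - a) (by linarith)
    simpa using this
  · intro a ha
    filter_upwards [hntop.eventually_ge_atTop k] with j hj
    exact (satProbU_le_one k (m j) (n j) hj).trans_lt ha

end KX

theorem unconstrained_kxorsat_threshold
    (k : ℕ) (hk : 3 ≤ k)
    (lam : ℝ) (hlam : 0 < lam) (hroot : psi lam = k)
    (m n : ℕ → ℕ) (hm : ∀ j, 0 < m j) (hn : ∀ j, 0 < n j)
    (hmtop : Filter.Tendsto m Filter.atTop Filter.atTop)
    (hntop : Filter.Tendsto n Filter.atTop Filter.atTop)
    (c : ℝ)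
    (hc : Filter.Tendsto (fun j => (m j : ℝ) / (n j : ℝ)) Filter.atTop (nhds c)) :
    (c < gfun k lam →
      Filter.Tendsto (fun j => satProbU k (m j) (n j)) Filter.atTop (nhds 1)) ∧
    (gfun k lam < c →
      Filter.Tendsto (fun j => satProbU k (m j) (n j)) Filter.atTop (nhds 0)) := by
  obtain ⟨i, hi, rfl⟩ := KX.one_le_psi_k hk
  exact ⟨KX.sat hi hlam hroot m n hm hn hntop c hc, KX.unsat hi hlam hroot m n hn hntop c hc⟩
end

section
/- Let ψ: ℝ → ℝ be defined by ψ(x) = x(e^x − 1)/(e^x − 1 − x) for x ≠ 0 and ψ(0) = 2 (the continuous extension). Then ψ is strictly increasing on ℝ and strictly convex on ℝ; in fact ψ′(x) > 0 and ψ″(x) > 0 for all x ∈ ℝ. -/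
open Real Set Filter Topology

lemma aux_right {h h' : ℝ → ℝ} (hd : ∀ x, HasDerivAt h (h' x) x) (h0 : h 0 = 0) {x : ℝ}
    (hp : ∀ y, 0 < y → y < x → 0 < h' y) (hx : 0 < x) : 0 < h x := by
  have hm : StrictMonoOn h (Icc 0 x) := by
    apply strictMonoOn_of_deriv_pos (convex_Icc 0 x)
    · exact fun y _ => (hd y).continuousAt.continuousWithinAt
    · intro y hy
      rw [interior_Icc] at hy
      rw [(hd y).deriv]
      exact hp y hy.1 hy.2
  have := hm (left_mem_Icc.2 hx.le) (right_mem_Icc.2 hx.le) hx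
  rwa [h0] at this

lemma aux_left {h h' : ℝ → ℝ} (hd : ∀ x, HasDerivAt h (h' x) x) (h0 : h 0 = 0) {x : ℝ}
    (hp : ∀ y, y < 0 → x < y → h' y < 0) (hx : x < 0) : 0 < h x := by
  have hd2 : ∀ y, HasDerivAt (fun z => h (-z)) (-(h' (-y))) y := by
    intro y
    have := (hd (-y)).comp y (hasDerivAt_neg y)
    simpa [Function.comp_def] using this
  have := aux_right (x := -x) hd2 (by simpa using h0)
    (fun y h1 h2 => by have := hp (-y) (by linarith) (by linarith); linarith) (by linarith)
  simpa using this

lemma aux_two {h h' h'' : ℝ → ℝ} (hd : ∀ x, HasDerivAt h (h' x) x)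
    (hd' : ∀ x, HasDerivAt h' (h'' x) x) (h0 : h 0 = 0) (h0' : h' 0 = 0)
    (hp : ∀ x, x ≠ 0 → 0 < h'' x) : ∀ x, x ≠ 0 → 0 < h x := by
  intro x hx
  rcases lt_or_gt_of_ne hx with h1 | h1
  · refine aux_left hd h0 (fun y hy _ => ?_) h1
    have := aux_left (h := fun z => - h' z) (h' := fun z => - h'' z) (fun z => (hd' z).neg)
      (by simp [h0']) (x := y) (fun z hz _ => by have := hp z hz.ne; linarith) hy
    linarith
  · refine aux_right hd h0 (fun y hy _ => ?_) h1
    exact aux_right hd' h0' (fun z hz _ => hp z hz.ne') hy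

lemma hE (x : ℝ) : HasDerivAt (fun y => rexp (-y)) (-rexp (-x)) x := by
  simpa [Function.comp_def] using (Real.hasDerivAt_exp (-x)).comp x (hasDerivAt_neg x)

lemma hpolyderiv (a b c d x : ℝ) :
    HasDerivAt (fun y : ℝ => a + b * y + c * y ^ 2 + d * y ^ 3) (b + 2 * c * x + 3 * d * x ^ 2) x := by
  have h1 := (hasDerivAt_id x).const_mul b
  have h2 := (hasDerivAt_pow 2 x).const_mul c
  have h3 := (hasDerivAt_pow 3 x).const_mul d
  refine ((((hasDerivAt_const x a).add h1).add h2).add h3).congr_deriv ?_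
  push_cast; ring

/-- general form `e^x p(x) + q e^{-x} + r(x)` -/
lemma hgen (a b c q a' b' c' d' x : ℝ) :
    HasDerivAt (fun y : ℝ => rexp y * (a + b * y + c * y ^ 2 + 0 * y ^ 3) + q * rexp (-y)
        + (a' + b' * y + c' * y ^ 2 + d' * y ^ 3))
      (rexp x * ((a + b) + (b + 2 * c) * x + c * x ^ 2 + 0 * x ^ 3) + (-q) * rexp (-x)
        + (b' + (2 * c') * x + (3 * d') * x ^ 2 + 0 * x ^ 3)) x := by
  refine ((((Real.hasDerivAt_exp x).mul (hpolyderiv a b c 0 x)).add ((hE x).const_mul q)).add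
    (hpolyderiv a' b' c' d' x)).congr_deriv ?_
  ring

lemma M_pos (x : ℝ) (hx : x ≠ 0) : 0 < rexp x + rexp (-x) - 2 - x ^ 2 := by
  have := aux_two (hgen 1 0 0 1 (-2) 0 (-1) 0) (hgen _ _ _ _ _ _ _ _) (by norm_num) (by norm_num)
    (fun y hy => by
      have h1 := Real.add_one_lt_exp hy
      have h2 := Real.add_one_lt_exp (neg_ne_zero.2 hy)
      linarith) x hx
  linarith

lemma R_pos (x : ℝ) (hx : x ≠ 0) : 0 < rexp (2 * x) * (x ^ 2 + 4 * x - 2) + 2 := by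
  have hd : ∀ y : ℝ, HasDerivAt (fun y : ℝ => rexp (2 * y) * (y ^ 2 + 4 * y - 2) + 2)
      (rexp (2 * y) * (2 * y * (y + 5))) y := by
    intro y
    have h1 : HasDerivAt (fun y : ℝ => rexp (2 * y)) (rexp (2 * y) * (2 * 1)) y :=
      ((hasDerivAt_id y).const_mul 2).exp
    have h2 := ((h1.mul (hpolyderiv (-2) 4 1 0 y)).add_const 2).congr_deriv
      (g' := rexp (2 * y) * (2 * y * (y + 5))) (by ring)
    refine h2.congr_of_eventuallyEq (Eventually.of_forall fun z => ?_)
    simp only [Pi.mul_apply]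
    ring
  rcases lt_or_gt_of_ne hx with h1 | h1
  · by_cases h5 : x < -5
    · have := Real.exp_pos (2 * x)
      have h3 : 0 < x ^ 2 + 4 * x - 2 := by nlinarith
      positivity
    · refine aux_left hd (by norm_num) (fun y hy hxy => ?_) h1
      have := Real.exp_pos (2 * y)
      have h3 : 2 * y * (y + 5) < 0 := by nlinarith
      exact mul_neg_of_pos_of_neg this h3
  · refine aux_right hd (by norm_num) (fun y hy hxy => ?_) h1
    positivity

lemma Q_pos (x : ℝ) (hx : x ≠ 0) :
    0 < rexp x * (2 - 4 * x + x ^ 2) + 2 * rexp (-x) + (-4 + 4 * x + x ^ 2 + x ^ 3) := by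
  have key := aux_two (hgen 2 (-4) 1 2 (-4) 4 1 1) (hgen _ _ _ _ _ _ _ _)
    (by norm_num) (by norm_num)
    (aux_two (hgen _ _ _ _ _ _ _ _) (hgen _ _ _ _ _ _ _ _) (by norm_num) (by norm_num)
      (fun y hy => by
        have h1 := R_pos y hy
        have h2 : rexp (2 * y) = rexp y * rexp y := by rw [← Real.exp_add]; ring_nf
        have h3 : rexp y * rexp (-y) = 1 := by rw [← Real.exp_add]; simp
        have h4 := Real.exp_pos y
        rw [h2] at h1
        refine pos_of_mul_pos_right (b := _) (a := rexp y) ?_ h4.le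
        calc (0:ℝ) < _ := h1
          _ = rexp y * rexp y * (y ^ 2 + 4 * y - 2) + 2 * (rexp y * rexp (-y)) := by rw [h3]; ring
          _ = _ := by ring)) x hx
  refine key.trans_eq ?_
  ring

lemma f_pos (x : ℝ) (hx : x ≠ 0) : 0 < rexp x - 1 - x := by
  linarith [Real.add_one_lt_exp hx]

lemma N_pos (x : ℝ) (hx : x ≠ 0) : 0 < (rexp x - 1) ^ 2 - x ^ 2 * rexp x := by
  have h1 := mul_pos (Real.exp_pos x) (M_pos x hx)
  have h3 : rexp x * rexp (-x) = 1 := by rw [← Real.exp_add]; simp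
  nlinarith

lemma P_pos (x : ℝ) (hx : x ≠ 0) :
    0 < (2 * rexp x * (rexp x - 1 - x) - x ^ 2 * rexp x) * (rexp x - 1 - x)
      - 2 * ((rexp x - 1) ^ 2 - x ^ 2 * rexp x) * (rexp x - 1) := by
  have h1 := mul_pos (Real.exp_pos x) (Q_pos x hx)
  have h3 : rexp x * rexp (-x) = 1 := by rw [← Real.exp_add]; simp
  refine h1.trans_eq ?_
  linear_combination 2 * h3

noncomputable def psiD (x : ℝ) : ℝ :=
  if x = 0 then 1 / 3 else ((rexp x - 1) ^ 2 - x ^ 2 * rexp x) / (rexp x - 1 - x) ^ 2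

noncomputable def kk (x : ℝ) : ℝ := (rexp x - (1 + x + x ^ 2 / 2 + x ^ 3 / 6)) / x ^ 4

lemma kk_eq (x : ℝ) (hx : x ≠ 0) : rexp x = 1 + x + x ^ 2 / 2 + x ^ 3 / 6 + x ^ 4 * kk x := by
  unfold kk; field_simp; ring

lemma kk_tendsto : Tendsto kk (𝓝[≠] 0) (𝓝 (1 / 24)) := by
  rw [tendsto_iff_norm_sub_tendsto_zero]
  have hlim : Tendsto (fun x : ℝ => |x|) (𝓝[≠] 0) (𝓝 0) := by
    have : Tendsto (fun x : ℝ => |x|) (𝓝 0) (𝓝 |0|) := continuous_abs.tendsto 0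
    rw [abs_zero] at this
    exact this.mono_left nhdsWithin_le_nhds
  refine squeeze_zero' (Eventually.of_forall fun _ => norm_nonneg _) ?_ hlim
  have hs : ∀ᶠ x : ℝ in 𝓝[≠] 0, |x| < 1 := hlim.eventually (gt_mem_nhds one_pos)
  filter_upwards [hs, self_mem_nhdsWithin] with x hx1 hx0
  have hx0 : x ≠ 0 := hx0
  have hb := Real.exp_bound hx1.le (n := 5) (by norm_num)
  simp only [Finset.sum_range_succ, Finset.sum_range_zero, Nat.factorial] at hb
  norm_num at hb
  have h4 : 0 < |x| ^ 4 := by positivity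
  have e : kk x - 1 / 24 = (rexp x - (1 + x + x ^ 2 / 2 + x ^ 3 / 6 + x ^ 4 / 24)) / x ^ 4 := by
    unfold kk; field_simp; ring
  rw [Real.norm_eq_abs, e, abs_div, abs_pow, div_le_iff₀ h4]
  refine hb.trans ?_
  have : 0 ≤ |x| ^ 5 := by positivity
  nlinarith

lemma psi_deriv0 : HasDerivAt psi (1 / 3) 0 := by
  rw [hasDerivAt_iff_tendsto_slope]
  have hx : Tendsto (fun x : ℝ => x) (𝓝[≠] 0) (𝓝 0) := nhdsWithin_le_nhds
  have hk := kk_tendsto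
  have hlim : Tendsto (fun x : ℝ => (1 / 6 + x * (1/6) + x * kk x * (x - 2))
      / (1 / 2 + x / 6 + x ^ 2 * kk x)) (𝓝[≠] 0) (𝓝 ((1 / 6 + 0 * (1/6) + 0 * (1/24) * (0 - 2))
      / (1 / 2 + 0 / 6 + 0 ^ 2 * (1/24)))) := by
    refine Tendsto.div ?_ ?_ (by norm_num)
    · exact (tendsto_const_nhds.add (hx.mul_const _)).add ((hx.mul hk).mul (hx.sub_const _))
    · exact (tendsto_const_nhds.add (hx.div_const _)).add ((hx.pow 2).mul hk)
  norm_num only at hlim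
  refine hlim.congr' ?_
  filter_upwards [self_mem_nhdsWithin] with x hx0
  have hx0 : x ≠ 0 := hx0
  have hf := (f_pos x hx0).ne'
  have he : rexp x - 1 - x = x ^ 2 * (1 / 2 + x / 6 + x ^ 2 * kk x) := by rw [kk_eq x hx0]; ring
  have hg : 1 / 2 + x / 6 + x ^ 2 * kk x ≠ 0 := by
    intro h; rw [he, h] at hf; simp at hf
  have he1 : rexp x - 1 = x + x ^ 2 * (1 / 2 + x / 6 + x ^ 2 * kk x) := by linarith
  simp only [slope_def_field, psi, hx0, if_true, if_false]
  rw [he, he1, sub_zero, div_eq_div_iff hg hx0, div_sub' (by positivity)]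
  rw [eq_comm, div_mul_eq_mul_div, div_eq_iff (by positivity)]
  ring

lemma psiD_deriv0 : HasDerivAt psiD (1 / 9) 0 := by
  rw [hasDerivAt_iff_tendsto_slope]
  have hx : Tendsto (fun x : ℝ => x) (𝓝[≠] 0) (𝓝 0) := nhdsWithin_le_nhds
  have hk := kk_tendsto
  have hG : Tendsto (fun x : ℝ => 1 / 2 + x / 6 + x ^ 2 * kk x) (𝓝[≠] 0)
      (𝓝 (1 / 2 + 0 / 6 + 0 ^ 2 * (1/24))) :=
    (tendsto_const_nhds.add (hx.div_const _)).add ((hx.pow 2).mul hk)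
  norm_num only at hG
  have hlim : Tendsto (fun x : ℝ => (2 * kk x + 2 / 3 * (1 / 6 + x * kk x)
      * ((1 / 2 + x / 6 + x ^ 2 * kk x) - 1)) / (1 / 2 + x / 6 + x ^ 2 * kk x) ^ 2) (𝓝[≠] 0)
      (𝓝 ((2 * (1 / 24) + 2 / 3 * (1 / 6 + 0 * (1 / 24)) * (1 / 2 - 1)) / (1 / 2) ^ 2)) := by
    refine Tendsto.div ?_ (hG.pow 2) (by norm_num)
    exact (hk.const_mul 2).add (((tendsto_const_nhds.add (hx.mul hk)).const_mul _).mul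
      (hG.sub_const 1))
  norm_num only at hlim
  refine hlim.congr' ?_
  filter_upwards [self_mem_nhdsWithin] with x hx0
  have hx0 : x ≠ 0 := hx0
  have hf := (f_pos x hx0).ne'
  have he : rexp x - 1 - x = x ^ 2 * (1 / 2 + x / 6 + x ^ 2 * kk x) := by rw [kk_eq x hx0]; ring
  have hg : 1 / 2 + x / 6 + x ^ 2 * kk x ≠ 0 := by
    intro h; rw [he, h] at hf; simp at hf
  have he1 : rexp x = 1 + x + x ^ 2 * (1 / 2 + x / 6 + x ^ 2 * kk x) := by linarith
  simp only [slope_def_field, psiD, hx0, if_true, if_false]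
  rw [he, he1, sub_zero, div_eq_div_iff (pow_ne_zero 2 hg) hx0, div_sub' (by positivity)]
  rw [eq_comm, div_mul_eq_mul_div, div_eq_iff (by positivity)]
  ring

lemma psi_hasDeriv (x : ℝ) : HasDerivAt psi (psiD x) x := by
  by_cases hx : x = 0
  · subst hx; simpa [psiD] using psi_deriv0
  have hf := (f_pos x hx).ne'
  have h1 : HasDerivAt (fun y => y * (rexp y - 1) / (rexp y - 1 - y)) (psiD x) x := by
    have ha := (hasDerivAt_id' x).mul ((Real.hasDerivAt_exp x).sub_const 1)
    have hb := ((Real.hasDerivAt_exp x).sub_const 1).sub (hasDerivAt_id' x)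
    refine (ha.div hb hf).congr_deriv (Eq.symm ?_)
    simp only [psiD, hx, if_false]
    congr 1
    simp
    ring
  refine h1.congr_of_eventuallyEq ?_
  filter_upwards [isOpen_ne.mem_nhds hx] with y hy
  have hy : y ≠ 0 := hy
  simp [psi, hy]

lemma psiD_hasDeriv (x : ℝ) (hx : x ≠ 0) : HasDerivAt psiD
    (((2 * rexp x * (rexp x - 1 - x) - x ^ 2 * rexp x) * (rexp x - 1 - x)
      - 2 * ((rexp x - 1) ^ 2 - x ^ 2 * rexp x) * (rexp x - 1)) / (rexp x - 1 - x) ^ 3) x := by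
  have hf := (f_pos x hx).ne'
  have h1 : HasDerivAt (fun y => ((rexp y - 1) ^ 2 - y ^ 2 * rexp y) / (rexp y - 1 - y) ^ 2)
    (((2 * rexp x * (rexp x - 1 - x) - x ^ 2 * rexp x) * (rexp x - 1 - x)
      - 2 * ((rexp x - 1) ^ 2 - x ^ 2 * rexp x) * (rexp x - 1)) / (rexp x - 1 - x) ^ 3) x := by
    have ha := (((Real.hasDerivAt_exp x).sub_const 1).pow 2).sub
      ((hasDerivAt_pow 2 x).mul (Real.hasDerivAt_exp x))
    have hb := (((Real.hasDerivAt_exp x).sub_const 1).sub (hasDerivAt_id' x)).pow 2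
    refine (ha.div hb (pow_ne_zero 2 hf)).congr_deriv (Eq.symm ?_)
    simp only [Pi.sub_apply, Pi.pow_apply, Pi.mul_apply]
    push_cast
    rw [div_eq_div_iff (by positivity) (by positivity)]
    ring
  refine h1.congr_of_eventuallyEq ?_
  filter_upwards [isOpen_ne.mem_nhds hx] with y hy
  have hy : y ≠ 0 := hy
  simp [psiD, hy]

theorem psi_strictMono_strictConvex :
    StrictMono psi ∧ StrictConvexOn ℝ Set.univ psi ∧
    (∀ x : ℝ, 0 < deriv psi x) ∧ (∀ x : ℝ, 0 < deriv (deriv psi) x) := by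
  have hD : deriv psi = psiD := funext fun x => (psi_hasDeriv x).deriv
  have h1 : ∀ x : ℝ, 0 < deriv psi x := by
    intro x
    rw [hD]
    by_cases hx : x = 0
    · simp [psiD, hx]
    · simp only [psiD, hx, if_false]
      exact div_pos (N_pos x hx) (pow_pos (f_pos x hx) 2)
  have h2 : ∀ x : ℝ, 0 < deriv (deriv psi) x := by
    intro x
    rw [hD]
    by_cases hx : x = 0
    · rw [hx, psiD_deriv0.deriv]; norm_num
    · rw [(psiD_hasDeriv x hx).deriv]
      exact div_pos (P_pos x hx) (pow_pos (f_pos x hx) 3)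
  refine ⟨strictMono_of_deriv_pos h1, ?_, h1, h2⟩
  apply strictConvexOn_univ_of_deriv2_pos
  · exact continuous_iff_continuousAt.2 fun x => (psi_hasDeriv x).continuousAt
  · intro x
    simpa using h2 x
end

section
/- Let f(x) = e^x − 1 − x and define g(x) = 2f(x)² − 4x f′(x) f(x) − x² f″(x) f(x) + 2x² f′(x)². Then g(x) > 0 for every real x ≠ 0. Moreover, writing g(x) = ∑_{j≥0} g_j x^j, one has g_j = 0 for j ≤ 5 and g_j = ((j−1)/j!)·(2^{j−2}(j−8) + j² − j + 4) > 0 for all j ≥ 6. -/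
/-- `f(x) = e^x - 1 - x`. -/
noncomputable def fEx (x : ℝ) : ℝ := Real.exp x - 1 - x

/-- `g = 2 f² - 4 x f' f - x² f'' f + 2 x² (f')²`, where `f' = e^x - 1`, `f'' = e^x`. -/
noncomputable def gEx (x : ℝ) : ℝ :=
  2 * (fEx x) ^ 2 - 4 * x * (Real.exp x - 1) * fEx x
    - x ^ 2 * Real.exp x * fEx x + 2 * x ^ 2 * (Real.exp x - 1) ^ 2

/-- The coefficient `g_j = ((j-1)/j!) (2^{j-2} (j-8) + j² - j + 4)` for `j ≥ 6`,
and `g_j = 0` for `j ≤ 5`. -/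
noncomputable def gCoeff (j : ℕ) : ℝ :=
  if j ≤ 5 then 0
  else ((j : ℝ) - 1) / (Nat.factorial j) *
    ((2 : ℝ) ^ (j - 2) * ((j : ℝ) - 8) + (j : ℝ) ^ 2 - (j : ℝ) + 4)


lemma hs_congr {f g : ℕ → ℝ} {a b : ℝ} (H : HasSum f a) (hf : ∀ n, g n = f n) (hb : b = a) :
    HasSum g b := by
  have : g = f := funext hf
  rw [this, hb]; exact H

lemma hs_base (c x : ℝ) (k : ℕ) :
    HasSum (fun j : ℕ => (j.descFactorial k : ℝ) * c ^ (j - k) / (Nat.factorial j) * x ^ j)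
      (x ^ k * Real.exp (c * x)) := by
  rw [← hasSum_nat_add_iff' k]
  have h0 : ∑ i ∈ Finset.range k,
      ((i.descFactorial k : ℝ) * c ^ (i - k) / (Nat.factorial i) * x ^ i) = 0 := by
    apply Finset.sum_eq_zero
    intro i hi
    rw [Nat.descFactorial_eq_zero_iff_lt.2 (Finset.mem_range.1 hi)]
    simp
  rw [h0, sub_zero]
  have h := (NormedSpace.expSeries_div_hasSum_exp (c * x)).mul_left (x ^ k)
  rw [← Real.exp_eq_exp_ℝ] at h
  refine hs_congr h (fun n => ?_) rfl
  have h1 := Nat.factorial_mul_descFactorial (Nat.le_add_left k n)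
  rw [Nat.add_sub_cancel] at h1
  have h2 : ((n + k).factorial : ℝ) = n.factorial * (n + k).descFactorial k := by
    exact_mod_cast h1.symm
  have h3 : ((n + k).factorial : ℝ) ≠ 0 := by exact_mod_cast (n + k).factorial_ne_zero
  have h4 : (n.factorial : ℝ) ≠ 0 := by exact_mod_cast n.factorial_ne_zero
  rw [Nat.add_sub_cancel, div_mul_eq_mul_div, mul_div_assoc', div_eq_div_iff h3 h4, h2]
  ring

lemma df1 (n : ℕ) : ((n + 6).descFactorial 1 : ℝ) = n + 6 := by simp
lemma df2 (n : ℕ) : ((n + 6).descFactorial 2 : ℝ) = (n + 6) * (n + 5) := by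
  simp [Nat.descFactorial]; ring
lemma df3 (n : ℕ) : ((n + 6).descFactorial 3 : ℝ) = (n + 6) * (n + 5) * (n + 4) := by
  simp [Nat.descFactorial]; ring

lemma gEx_eq (x : ℝ) : gEx x = (x ^ 2 - 4 * x + 2) * Real.exp (2 * x)
    + (x ^ 3 + x ^ 2 + 4 * x - 4) * Real.exp x + 2 := by
  have : Real.exp (2 * x) = Real.exp x ^ 2 := by rw [← Real.exp_nat_mul]; norm_num
  rw [this, gEx, fEx]; ring

lemma g_hasSum (x : ℝ) : HasSum (fun j => gCoeff j * x ^ j) (gEx x) := by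
  rw [← hasSum_nat_add_iff' 6]
  have H := ((((((hs_base 2 x 2).add ((hs_base 2 x 1).mul_left (-4))).add
    ((hs_base 2 x 0).mul_left 2)).add (hs_base 1 x 3)).add (hs_base 1 x 2)).add
    ((hs_base 1 x 1).mul_left 4)).add ((hs_base 1 x 0).mul_left (-4))
  rw [← hasSum_nat_add_iff' 6] at H
  refine hs_congr H (fun n => ?_) ?_
  · simp only [df1, df2, df3, Nat.descFactorial_zero, one_pow, gCoeff]
    rw [if_neg (by omega)]
    rw [show n + 6 - 2 = n + 4 by omega, show n + 6 - 1 = n + 5 by omega,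
      show n + 6 - 0 = n + 6 by omega]
    push_cast
    simp only [pow_add (2:ℝ)]
    ring
  · rw [gEx_eq]
    simp [Finset.sum_range_succ, gCoeff, Nat.descFactorial, Nat.factorial]
    ring

lemma two_pow_ge (n : ℕ) : (n : ℝ) + 1 ≤ 2 ^ n := by
  exact_mod_cast Nat.lt_two_pow_self

lemma gCoeff_pos (j : ℕ) (hj : 6 ≤ j) : 0 < gCoeff j := by
  obtain ⟨n, rfl⟩ := Nat.exists_eq_add_of_le' hj
  rw [gCoeff, if_neg (by omega), show n + 6 - 2 = n + 4 by omega]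
  push_cast
  have hf : (0:ℝ) < (n + 6).factorial := by exact_mod_cast (n + 6).factorial_pos
  have hn : (0:ℝ) ≤ n := n.cast_nonneg
  apply mul_pos
  · apply div_pos _ hf; linarith
  · rcases n with _ | _ | n
    · norm_num
    · norm_num
    · push_cast
      have : (0:ℝ) ≤ 2 ^ (n + 1 + 1 + 4) * ((n:ℝ) + 1 + 1 + 6 - 8) := by
        apply mul_nonneg (by positivity); 
        have : (0:ℝ) ≤ n := n.cast_nonneg
        linarith
      nlinarith [(n.cast_nonneg : (0:ℝ) ≤ n)]

lemma cpos (n : ℕ) : (n + 6 : ℤ) * (n + 5) * (n + 4) + 4 * (n + 6) + 4 <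
    2 ^ (n + 7) + (n + 6) * (n + 5) := by
  induction n with
  | zero => norm_num
  | succ n ih =>
    rw [show n + 1 + 7 = (n + 7) + 1 by omega, pow_succ]
    push_cast
    nlinarith [(by positivity : (0:ℤ) ≤ n), (by positivity : (0:ℤ) ≤ (n:ℤ)^2),
      (by positivity : (0:ℤ) ≤ (n:ℤ)^3)]

lemma h_pos (t : ℝ) (ht : 0 < t) : 0 < (t ^ 2 + 4 * t + 2) +
    (-t ^ 3 + t ^ 2 - 4 * t - 4) * Real.exp t + 2 * Real.exp (2 * t) := by
  have H := (((((hs_base 2 t 0).mul_left 2).add ((hs_base 1 t 3).mul_left (-1))).add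
    (hs_base 1 t 2)).add ((hs_base 1 t 1).mul_left (-4))).add ((hs_base 1 t 0).mul_left (-4))
  rw [← hasSum_nat_add_iff' 6] at H
  have key : ∀ n : ℕ, 0 < (2 ^ (n + 7) + (n + 6) * (n + 5) -
      ((n + 6 : ℝ) * (n + 5) * (n + 4) + 4 * (n + 6) + 4)) / ((n + 6).factorial : ℝ)
        * t ^ (n + 6) := by
    intro n
    have hf : (0:ℝ) < (n + 6).factorial := by exact_mod_cast (n + 6).factorial_pos
    apply mul_pos (div_pos _ hf) (by positivity)
    rw [sub_pos]
    exact_mod_cast cpos n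
  have H2 : HasSum (fun n : ℕ => (2 ^ (n + 7) + (n + 6) * (n + 5) -
      ((n + 6 : ℝ) * (n + 5) * (n + 4) + 4 * (n + 6) + 4)) / ((n + 6).factorial : ℝ)
        * t ^ (n + 6)) ((t ^ 2 + 4 * t + 2) +
    (-t ^ 3 + t ^ 2 - 4 * t - 4) * Real.exp t + 2 * Real.exp (2 * t)) := by
    refine hs_congr H (fun n => ?_) ?_
    · simp only [df1, df2, df3, Nat.descFactorial_zero, one_pow]
      rw [show n + 6 - 0 = n + 6 by omega]
      push_cast
      simp only [pow_add (2:ℝ)]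
      ring
    · simp [Finset.sum_range_succ, Nat.descFactorial, Nat.factorial]
      ring
  exact (key 0).trans_le (le_hasSum H2 0 (fun n _ => (key n).le))

theorem g_positive_and_coefficients :
    (∀ x : ℝ, x ≠ 0 → 0 < gEx x) ∧
    (∀ x : ℝ, gEx x = ∑' j : ℕ, gCoeff j * x ^ j) ∧
    (∀ j : ℕ, 6 ≤ j → 0 < gCoeff j) := by
  refine ⟨?_, fun x => (g_hasSum x).tsum_eq.symm, gCoeff_pos⟩
  intro x hx
  rcases lt_or_gt_of_ne hx with h | h
  · have h1 := h_pos (-x) (by linarith)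
    have e1 : Real.exp x * Real.exp (-x) = 1 := by rw [← Real.exp_add]; simp
    have e2 : Real.exp (2 * -x) = Real.exp (-x) ^ 2 := by rw [← Real.exp_nat_mul]; norm_num
    have e3 : Real.exp (2 * x) = Real.exp x ^ 2 := by rw [← Real.exp_nat_mul]; norm_num
    have h2 := mul_pos (pow_pos (Real.exp_pos x) 2) h1
    rw [gEx_eq, e3]
    rw [e2] at h2
    refine lt_of_lt_of_eq h2 (Eq.symm ?_)
    generalize Real.exp x = E at *
    generalize Real.exp (-x) = F at *
    linear_combination (-(x ^ 3 + x ^ 2 + 4 * x - 4) * E - 2 * (E * F + 1)) * e1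
  · have key : ∀ j, 0 ≤ gCoeff j * x ^ j := by
      intro j
      by_cases hj : j ≤ 5
      · simp [gCoeff, hj]
      · exact (mul_pos (gCoeff_pos j (by omega)) (pow_pos h j)).le
    exact (mul_pos (gCoeff_pos 6 le_rfl) (pow_pos h 6)).trans_le
      (le_hasSum (g_hasSum x) 6 (fun n _ => key n))
end

section
/- Let ψ(x) = x(e^x − 1)/(e^x − 1 − x) for x > 0. For every real y > 2 there exists a unique x > 0 with ψ(x) = y. Moreover ψ(x) > 2 for every x > 0 and ψ(x) → ∞ as x → ∞. -/
theorem psi_aux_den {x : ℝ} (hx : 0 < x) : 0 < Real.exp x - 1 - x := by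
  have := Real.add_one_lt_exp hx.ne'
  linarith

theorem psi_aux_sq {x : ℝ} (hx : 0 < x) :
    0 < (Real.exp x - 1) ^ 2 - x ^ 2 * Real.exp x := by
  have h : x / 2 < Real.sinh (x / 2) := Real.self_lt_sinh_iff.2 (by linarith)
  rw [Real.sinh_eq] at h
  have hE : Real.exp x = Real.exp (x / 2) ^ 2 := by
    rw [← Real.exp_nat_mul]; congr 1; push_cast; ring
  have hm : Real.exp (x / 2) * Real.exp (-(x / 2)) = 1 := by
    rw [← Real.exp_add]; simp
  have hp := Real.exp_pos (x / 2)
  rw [hE]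
  set a := Real.exp (x / 2)
  set b := Real.exp (-(x / 2))
  have h1 : x * a < a ^ 2 - 1 := by nlinarith
  have h2 : 0 < x * a := by positivity
  nlinarith

theorem psi_aux_hasDeriv {x : ℝ} (hx : 0 < x) :
    HasDerivAt (fun x : ℝ => x * (Real.exp x - 1) / (Real.exp x - 1 - x))
      (((Real.exp x - 1) ^ 2 - x ^ 2 * Real.exp x) / (Real.exp x - 1 - x) ^ 2) x := by
  have h1 : HasDerivAt (fun x : ℝ => Real.exp x - 1) (Real.exp x) x :=
    (Real.hasDerivAt_exp x).sub_const 1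
  have h2 := ((hasDerivAt_id' x).mul h1).div (h1.sub (hasDerivAt_id' x)) (psi_aux_den hx).ne'
  refine h2.congr_deriv ?_
  simp only [Pi.mul_apply, Pi.sub_apply]
  congr 1
  ring

theorem psi_aux_cont : ContinuousOn
    (fun x : ℝ => x * (Real.exp x - 1) / (Real.exp x - 1 - x)) (Set.Ioi 0) :=
  fun _ hx => (psi_aux_hasDeriv hx).continuousAt.continuousWithinAt

theorem psi_aux_mono : StrictMonoOn
    (fun x : ℝ => x * (Real.exp x - 1) / (Real.exp x - 1 - x)) (Set.Ioi 0) := by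
  refine strictMonoOn_of_deriv_pos (convex_Ioi 0) psi_aux_cont ?_
  intro x hx
  rw [interior_Ioi] at hx
  rw [(psi_aux_hasDeriv hx).deriv]
  exact div_pos (psi_aux_sq hx) (pow_pos (psi_aux_den hx) 2)

theorem psi_aux_gt {x : ℝ} (hx : 0 < x) :
    2 < x * (Real.exp x - 1) / (Real.exp x - 1 - x) := by
  rw [lt_div_iff₀ (psi_aux_den hx)]
  have hd : ∀ t : ℝ, HasDerivAt (fun t : ℝ => t * (Real.exp t + 1) - 2 * (Real.exp t - 1))
      (1 * (Real.exp t + 1) + t * Real.exp t - 2 * Real.exp t) t := fun t =>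
    ((hasDerivAt_id' t).mul ((Real.hasDerivAt_exp t).add_const 1)).sub
      (((Real.hasDerivAt_exp t).sub_const 1).const_mul 2)
  have hm : StrictMonoOn (fun t : ℝ => t * (Real.exp t + 1) - 2 * (Real.exp t - 1))
      (Set.Ici 0) := by
    refine strictMonoOn_of_deriv_pos (convex_Ici 0)
      (fun t _ => (hd t).continuousAt.continuousWithinAt) ?_
    intro t ht
    rw [interior_Ici] at ht
    have ht : 0 < t := ht
    rw [(hd t).deriv]
    have h1 := Real.add_one_lt_exp (neg_ne_zero.2 ht.ne')
    have h2 : Real.exp t * Real.exp (-t) = 1 := by rw [← Real.exp_add]; simp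
    nlinarith [Real.exp_pos t]
  have := hm (Set.mem_Ici.2 le_rfl) (Set.mem_Ici.2 hx.le) hx
  simp at this
  linarith

theorem psi_aux_lower {x : ℝ} (hx : 0 < x) :
    x ≤ x * (Real.exp x - 1) / (Real.exp x - 1 - x) := by
  rw [le_div_iff₀ (psi_aux_den hx)]
  nlinarith

theorem psi_aux_upper {x : ℝ} (hx : 0 < x) :
    x * (Real.exp x - 1) / (Real.exp x - 1 - x) ≤ x + 2 := by
  rw [div_le_iff₀ (psi_aux_den hx)]
  nlinarith [Real.quadratic_le_exp_of_nonneg hx.le]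

theorem psi_aux_eq {x : ℝ} (hx : 0 < x) :
    psi x = x * (Real.exp x - 1) / (Real.exp x - 1 - x) := by
  simp [psi, hx.ne']

theorem psi_unique_root :
    (∀ y : ℝ, 2 < y → ∃! x : ℝ, 0 < x ∧ psi x = y) ∧
    (∀ x : ℝ, 0 < x → 2 < psi x) ∧
    Filter.Tendsto psi Filter.atTop Filter.atTop := by
  refine ⟨fun y hy => ?_, fun x hx => ?_, ?_⟩
  · have h0 : 0 < y - 2 := by linarith
    have hy0 : 0 < y := by linarith
    obtain ⟨x, hx, hxy⟩ := intermediate_value_Icc (by linarith : y - 2 ≤ y)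
      (psi_aux_cont.mono (fun t ht => lt_of_lt_of_le h0 ht.1))
      ⟨(psi_aux_upper h0).trans (by linarith), psi_aux_lower hy0⟩
    have hx0 : 0 < x := lt_of_lt_of_le h0 hx.1
    refine ⟨x, ⟨hx0, (psi_aux_eq hx0).trans hxy⟩, ?_⟩
    rintro z ⟨hz, hzy⟩
    rw [psi_aux_eq hz] at hzy
    exact psi_aux_mono.injOn hz hx0 (hzy.trans hxy.symm)
  · rw [psi_aux_eq hx]
    exact psi_aux_gt hx
  · refine Filter.tendsto_atTop_mono' _ ?_ Filter.tendsto_id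
    filter_upwards [Filter.eventually_gt_atTop 0] with x hx
    rw [psi_aux_eq hx]
    exact psi_aux_lower hx
end
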